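/- Let d ≥ 1, 0 < q < ∞, s, m ∈ ℝ, and a ∈ S^m_{1,1}. Suppose a satisfies Hörmander's twisted diagonal condition: there is C₀ > 1 such that â(η,ξ) = 0 on the region where C₀(|η+ξ|+1) ≤ |ξ|, where â(η,ξ) denotes the partial Fourier transform of a(x,ξ) in the x-variable. Then there is a constant C such that for every tempered distribution f with ‖f‖_{F_∞^{s+m,q}} < ∞, the limit T_a f := lim_{N→∞} Σ_{j=0}^{N} Σ_{k=0}^{N} T_{a_{j,k}} f exists in S′(ℝ^d) and ‖T_a f‖_{F_∞^{s,q}} ≤ C ‖f‖_{F_∞^{s+m,q}}; in particular, no restriction s > τ_q is needed. -/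

import Mathlib

noncomputable section

open MeasureTheory SchwartzMap Complex RealInnerProductSpace Filter
open scoped ENNReal NNReal ContDiff SchwartzMap

/-- Euclidean space `ℝ^d`. -/
abbrev RD (d : ℕ) : Type := EuclideanSpace ℝ (Fin d)

/-- Tempered distributions on `ℝ^d`. -/
abbrev TD (d : ℕ) : Type := 𝓢(RD d, ℂ) →L[ℂ] ℂ

/-- Fourier transform of a Schwartz function (with the convention
`f̂(ξ) = ∫ f(x) e^{-2πi⟨x,ξ⟩} dx`). -/
def fourierS {d : ℕ} (f : 𝓢(RD d, ℂ)) : 𝓢(RD d, ℂ) :=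
  SchwartzMap.fourierTransformCLM ℂ f

/-- Hörmander symbol class `S^m_{1,1}`: `a` is smooth and
`‖∂_ξ^α ∂_x^β a(x,ξ)‖ ≤ c_{α,β} (1+‖ξ‖)^{m-|α|+|β|}` for all orders of derivatives. -/
def IsSymbolS11 (d : ℕ) (m : ℝ) (a : RD d → RD d → ℂ) : Prop :=
  ContDiff ℝ ∞ (fun p : RD d × RD d => a p.1 p.2) ∧
  ∀ α β : ℕ, ∃ c : ℝ, ∀ x ξ : RD d,
    ‖iteratedFDeriv ℝ α (fun ξ' => iteratedFDeriv ℝ β (fun x' => a x' ξ') x) ξ‖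
      ≤ c * (1 + ‖ξ‖) ^ (m - (α : ℝ) + (β : ℝ))

/-- The pseudo-differential operator `T_a f(x) = ∫ a(x,ξ) f̂(ξ) e^{2πi⟨x,ξ⟩} dξ`
acting on a Schwartz function `f`. -/
def pdo {d : ℕ} (a : RD d → RD d → ℂ) (f : 𝓢(RD d, ℂ)) (x : RD d) : ℂ :=
  ∫ ξ, a x ξ * fourierS f ξ * Complex.exp (2 * Real.pi * Complex.I * ((⟪x, ξ⟫ : ℝ) : ℂ))

/-- Littlewood–Paley data: a Schwartz function `φ` with `φ̂` supported in
`{1/2 ≤ |ξ| ≤ 2}` and `Σ_{k∈ℤ} φ̂(2^{-k}ξ) = 1` for `ξ ≠ 0`, together with the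
low-frequency piece `Φ` determined by `Φ̂ = 1 - Σ_{k≥1} φ̂(2^{-k}·)`. -/
structure LPData (d : ℕ) where
  φ : 𝓢(RD d, ℂ)
  Φ : 𝓢(RD d, ℂ)
  supp_φ : ∀ ξ : RD d, fourierS φ ξ ≠ 0 → 1/2 ≤ ‖ξ‖ ∧ ‖ξ‖ ≤ 2
  sum_φ : ∀ ξ : RD d, ξ ≠ 0 → HasSum (fun k : ℤ => fourierS φ ((2:ℝ)^(-k) • ξ)) 1
  Φ_def : ∀ ξ : RD d, fourierS Φ ξ = 1 - ∑' k : ℕ, fourierS φ (((2:ℝ)^(k+1))⁻¹ • ξ)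

/-- The Littlewood–Paley convolution kernel: `Φ` for `k = 0` and
`φ_k = 2^{kd} φ(2^k ·)` for `k ≥ 1`. -/
def LPkernel {d : ℕ} (D : LPData d) : ℕ → RD d → ℂ
  | 0, x => D.Φ x
  | (k+1), x => (((2:ℝ)^((k+1) * d) : ℝ) : ℂ) * D.φ ((2:ℝ)^(k+1) • x)

/-- The Fourier transform of the `k`-th Littlewood–Paley kernel, i.e. `φ̂_k = φ̂(2^{-k}·)`
for `k ≥ 1` and `Φ̂` for `k = 0`. -/
def LPhat {d : ℕ} (D : LPData d) : ℕ → RD d → ℂ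
  | 0, ξ => fourierS D.Φ ξ
  | (k+1), ξ => fourierS D.φ (((2:ℝ)^(k+1))⁻¹ • ξ)

/-- Littlewood–Paley operator `Π_k g = φ_k ∗ g` (with `φ_0 := Φ`) acting on functions. -/
def LP {d : ℕ} (D : LPData d) (k : ℕ) (g : RD d → ℂ) (x : RD d) : ℂ :=
  ∫ y, LPkernel D k y * g (x - y)

/-- `Π*_k = Π_{k-1} + Π_k + Π_{k+1}` (with the convention `φ_{-1} := 0`). -/
def LPstar {d : ℕ} (D : LPData d) (k : ℕ) (g : RD d → ℂ) (x : RD d) : ℂ :=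
  (if k = 0 then 0 else LP D (k-1) g x) + LP D k g x + LP D (k+1) g x

open Classical in
/-- Pairing of a tempered distribution with a plain function: it gives `u ψ` if the
function is (the coercion of) a Schwartz function `ψ`, and `0` otherwise. -/
def pairing {d : ℕ} (u : TD d) (g : RD d → ℂ) : ℂ :=
  if h : ∃ ψ : 𝓢(RD d, ℂ), ⇑ψ = g then u h.choose else 0

/-- Fourier transform of a tempered distribution, `⟨û, ψ⟩ = ⟨u, ψ̂⟩`. -/
def fourierTD {d : ℕ} (u : TD d) : TD d :=
  u.comp (SchwartzMap.fourierTransformCLM ℂ)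

/-- Littlewood–Paley operator on tempered distributions:
`Π_k u (x) = ⟨u, φ_k(x - ·)⟩`. -/
def LPdist {d : ℕ} (D : LPData d) (k : ℕ) (u : TD d) (x : RD d) : ℂ :=
  pairing u (fun y => LPkernel D k (x - y))

/-- The symbol `a_{j,k}(x,ξ) = (φ_j ∗ a(·,ξ))(x) · φ̂_k(ξ)` (with `Φ` replacing `φ_0`). -/
def symbolPiece {d : ℕ} (D : LPData d) (a : RD d → RD d → ℂ) (j k : ℕ)
    (x ξ : RD d) : ℂ :=
  (∫ y, LPkernel D j y * a (x - y) ξ) * LPhat D k ξ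

/-- `T_{a_{j,k}} u (x) = ⟨û, a_{j,k}(x,·) e^{2πi⟨x,·⟩}⟩` for a tempered distribution `u`. -/
def pdoPieceD {d : ℕ} (D : LPData d) (a : RD d → RD d → ℂ) (j k : ℕ)
    (u : TD d) (x : RD d) : ℂ :=
  pairing (fourierTD u)
    (fun ξ => symbolPiece D a j k x ξ * Complex.exp (2 * Real.pi * Complex.I * ((⟪x, ξ⟫ : ℝ) : ℂ)))

/-- Partial sums `Σ_{j=0}^N Σ_{k=0}^N T_{a_{j,k}} u (x)`. -/
def pdoPartial {d : ℕ} (D : LPData d) (a : RD d → RD d → ℂ) (N : ℕ)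
    (u : TD d) (x : RD d) : ℂ :=
  ∑ j ∈ Finset.range (N+1), ∑ k ∈ Finset.range (N+1), pdoPieceD D a j k u x

/-- `T_a u` converges in `S'` to the tempered distribution `Tf`: the partial sums
`Σ_{j,k≤N} T_{a_{j,k}} u` (which are functions) converge to `Tf` weakly. -/
def ConvergesInSPrime {d : ℕ} (D : LPData d) (a : RD d → RD d → ℂ)
    (u : TD d) (Tf : TD d) : Prop :=
  ∀ ψ : 𝓢(RD d, ℂ),
    Tendsto (fun N => ∫ x, pdoPartial D a N u x * ψ x) atTop (nhds (Tf ψ))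

/-- The dyadic cube of level `ν` (side length `2^{-ν}`) indexed by `n ∈ ℤ^d`. -/
def dyadicCube (d : ℕ) (ν : ℤ) (n : Fin d → ℤ) : Set (RD d) :=
  {x | ∀ i, (n i : ℝ) * (2:ℝ)^(-ν) ≤ x i ∧ x i < ((n i : ℝ) + 1) * (2:ℝ)^(-ν)}

/-- The local quantity `(|P|⁻¹ ∫_P Σ_{k=k₀}^∞ 2^{skq} ‖g_k(x)‖^q dx)^{1/q}` for the
dyadic cube `P` of level `μ` indexed by `n` (so that `|P|⁻¹ = 2^{μd}`). -/
def cubePiece (d : ℕ) (μ : ℕ) (n : Fin d → ℤ) (k₀ : ℕ) (s q : ℝ)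
    (g : ℕ → RD d → ℂ) : ℝ≥0∞ :=
  ((2:ℝ≥0∞)^((μ:ℝ)*(d:ℝ)) *
    ∫⁻ x in dyadicCube d μ n,
      ∑' j : ℕ, (2:ℝ≥0∞)^(s*((k₀:ℝ)+(j:ℝ))*q) * (‖g (k₀+j) x‖₊ : ℝ≥0∞)^q) ^ (1/q)

/-- The `F_∞^{s,q}` norm (for `q < ∞`) of a function, computed from its
Littlewood–Paley pieces:
`‖Π_0 g‖_∞ + sup_{l(P)<1 dyadic} (|P|⁻¹ ∫_P Σ_{k=-log₂ l(P)}^∞ 2^{skq}|Π_k g|^q)^{1/q}`. -/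
def FinftyNormFun {d : ℕ} (D : LPData d) (s q : ℝ) (g : RD d → ℂ) : ℝ≥0∞ :=
  (⨆ x : RD d, (‖LP D 0 g x‖₊ : ℝ≥0∞)) +
  ⨆ (μ : ℕ) (_ : 1 ≤ μ) (n : Fin d → ℤ),
    cubePiece d μ n μ s q (fun k x => LP D k g x)

/-- The `F_∞^{s,q}` norm (for `q < ∞`) of a tempered distribution. -/
def FinftyNormDist {d : ℕ} (D : LPData d) (s q : ℝ) (u : TD d) : ℝ≥0∞ :=
  (⨆ x : RD d, (‖LPdist D 0 u x‖₊ : ℝ≥0∞)) +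
  ⨆ (μ : ℕ) (_ : 1 ≤ μ) (n : Fin d → ℤ),
    cubePiece d μ n μ s q (fun k x => LPdist D k u x)

/-- The (axis-parallel, closed) cube with corner `c` and side length `L`. -/
def cube (d : ℕ) (c : RD d) (L : ℝ) : Set (RD d) :=
  {x | ∀ i, c i ≤ x i ∧ x i ≤ c i + L}

/-- The average of `g` over the cube with corner `c` and side length `L`. -/
def cubeMean {d : ℕ} (c : RD d) (L : ℝ) (g : RD d → ℂ) : ℂ :=
  (L^d)⁻¹ • ∫ x in cube d c L, g x

/-- The `bmo` norm (local BMO):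
`sup_{l(Q)≥1} |Q|⁻¹∫_Q |g| + sup_{l(Q)<1} |Q|⁻¹∫_Q |g - g_Q|`, over all cubes `Q`. -/
def bmoNorm (d : ℕ) (g : RD d → ℂ) : ℝ≥0∞ :=
  (⨆ (c : RD d) (L : ℝ) (_ : 1 ≤ L),
    ENNReal.ofReal ((L^d)⁻¹) * ∫⁻ x in cube d c L, (‖g x‖₊ : ℝ≥0∞)) +
  (⨆ (c : RD d) (L : ℝ) (_ : 0 < L) (_ : L < 1),
    ENNReal.ofReal ((L^d)⁻¹) * ∫⁻ x in cube d c L, (‖g x - cubeMean c L g‖₊ : ℝ≥0∞))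

/-- The Peetre maximal function `𝔐_{σ,R} g(x) = sup_y ‖g(x-y)‖/(1+R‖y‖)^σ`. -/
def peetre {d : ℕ} (σ R : ℝ) (g : RD d → ℂ) (x : RD d) : ℝ≥0∞ :=
  ⨆ y : RD d, (‖g (x - y)‖₊ : ℝ≥0∞) / ENNReal.ofReal ((1 + R * ‖y‖) ^ σ)

/-- `g` has (distributional) Fourier support contained in `K`: the pairing
`⟨ĝ, ψ⟩ = ∫ g · ψ̂` vanishes for every Schwartz `ψ` whose support does not meet `K`. -/
def HasFourierSupportIn {d : ℕ} (g : RD d → ℂ) (K : Set (RD d)) : Prop :=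
  ∀ ψ : 𝓢(RD d, ℂ), tsupport ⇑ψ ∩ K = ∅ → ∫ x, g x * fourierS ψ x = 0

section Auxiliary

open scoped FourierTransform

variable {d : ℕ}

/-! ### Differentiation under the integral sign -/

set_option maxSynthPendingDepth 5 in
/-- Iterated derivatives commute with a parametric integral whose derivatives are dominated. -/
theorem iteratedFDeriv_integral_of_dominated {α V W : Type*} [MeasurableSpace α] {μ : Measure α}
    [NormedAddCommGroup V] [NormedSpace ℝ V] [NormedAddCommGroup W] [NormedSpace ℝ W]
    [CompleteSpace W] {F : α → V → W}
    (hsm : ∀ y, ContDiff ℝ ∞ (F y))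
    (hmeas : ∀ l ξ, AEStronglyMeasurable (fun y => iteratedFDeriv ℝ l (F y) ξ) μ)
    (hbd : ∀ l, ∃ g : α → ℝ, Integrable g μ ∧ ∃ M : ℕ, ∀ y ξ,
      ‖iteratedFDeriv ℝ l (F y) ξ‖ ≤ g y * (1 + ‖ξ‖) ^ M) :
    ContDiff ℝ ∞ (fun ξ => ∫ y, F y ξ ∂μ) ∧
      ∀ l ξ, iteratedFDeriv ℝ l (fun ξ => ∫ y, F y ξ ∂μ) ξ
        = ∫ y, iteratedFDeriv ℝ l (F y) ξ ∂μ := by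
  have hInt : ∀ l ξ, Integrable (fun y => iteratedFDeriv ℝ l (F y) ξ) μ := by
    intro l ξ
    obtain ⟨g, hg, M, h⟩ := hbd l
    exact (hg.mul_const ((1 + ‖ξ‖) ^ M)).mono' (hmeas l ξ) (Eventually.of_forall fun y => h y ξ)
  have key : HasFTaylorSeriesUpTo ∞ (fun ξ => ∫ y, F y ξ ∂μ)
      (fun ξ l => ∫ y, iteratedFDeriv ℝ l (F y) ξ ∂μ) := by
    have hder : ∀ l : ℕ, ∀ ξ, HasFDerivAt (fun ξ => ∫ y, iteratedFDeriv ℝ l (F y) ξ ∂μ)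
        (∫ y, iteratedFDeriv ℝ (l + 1) (F y) ξ ∂μ).curryLeft ξ := by
      intro l ξ
      obtain ⟨g, hg, M, h⟩ := hbd (l + 1)
      have hm : AEStronglyMeasurable (fun y => fderiv ℝ (iteratedFDeriv ℝ l (F y)) ξ) μ := by
        have := (continuousMultilinearCurryLeftEquiv ℝ (fun _ : Fin (l+1) => V) W).continuous
          |>.comp_aestronglyMeasurable (hmeas (l + 1) ξ)
        refine this.congr (Eventually.of_forall fun y => ?_)
        simp only [fderiv_iteratedFDeriv, Function.comp]
      have hc : Integrable (fun y => fderiv ℝ (iteratedFDeriv ℝ l (F y)) ξ) μ :=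
        (hInt (l + 1) ξ).norm.mono' hm
          (Eventually.of_forall fun y => by rw [norm_fderiv_iteratedFDeriv])
      have e : (∫ y, iteratedFDeriv ℝ (l + 1) (F y) ξ ∂μ).curryLeft
          = ∫ y, fderiv ℝ (iteratedFDeriv ℝ l (F y)) ξ ∂μ := by
        ext v w
        rw [ContinuousMultilinearMap.curryLeft_apply,
          ContinuousMultilinearMap.integral_apply (hInt (l + 1) ξ),
          ContinuousLinearMap.integral_apply hc,
          ContinuousMultilinearMap.integral_apply (hc.apply_continuousLinearMap v)]
        rfl
      rw [e]
      refine hasFDerivAt_integral_of_dominated_of_fderiv_le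
        (F := fun ξ y => iteratedFDeriv ℝ l (F y) ξ)
        (F' := fun ξ y => fderiv ℝ (iteratedFDeriv ℝ l (F y)) ξ)
        (bound := fun y => |g y| * (1 + (‖ξ‖ + 1)) ^ M)
        (Metric.ball_mem_nhds ξ one_pos) (Eventually.of_forall fun x => hmeas l x) (hInt l ξ) hm ?_
        (hg.abs.mul_const _) ?_
      · refine Eventually.of_forall fun y x hx => ?_
        rw [norm_fderiv_iteratedFDeriv]
        refine (h y x).trans ?_
        have hx' : ‖x‖ ≤ ‖ξ‖ + 1 := by
          have := norm_sub_norm_le x ξ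
          rw [Metric.mem_ball, dist_eq_norm] at hx
          linarith
        have := le_abs_self (g y)
        gcongr
      · refine Eventually.of_forall fun y x _ => ?_
        exact ((hsm y).differentiable_iteratedFDeriv
          (by exact_mod_cast ENat.natCast_lt_top l) x).hasFDerivAt
    refine ⟨fun ξ => ?_, fun l _ ξ => hder l ξ, fun l _ => ?_⟩
    · have := (ContinuousMultilinearMap.apply ℝ (fun _ : Fin 0 => V) W 0).integral_comp_comm
        (hInt 0 ξ)
      change ContinuousMultilinearMap.apply ℝ (fun _ : Fin 0 => V) W 0
        (∫ y, iteratedFDeriv ℝ 0 (F y) ξ ∂μ) = _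
      rw [← this]
      simp
    · exact continuous_iff_continuousAt.2 fun ξ => (hder l ξ).continuousAt
  refine ⟨key.contDiff, fun l ξ => ?_⟩
  exact (key.eq_iteratedFDeriv (by exact_mod_cast le_top) ξ).symm

/-! ### Exponentials and regular symbols -/

/-- The character `e_x(ξ) = exp (2πi⟨x,ξ⟩)`. -/
def ee {d : ℕ} (x ξ : RD d) : ℂ :=
  Complex.exp (2 * Real.pi * Complex.I * ((⟪x, ξ⟫ : ℝ) : ℂ))

theorem ee_add (x y ξ : RD d) : ee (x + y) ξ = ee x ξ * ee y ξ := by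
  rw [ee, ee, ee, ← Complex.exp_add, inner_add_left]
  congr 1
  push_cast
  ring

theorem ee_zero (ξ : RD d) : ee 0 ξ = 1 := by simp [ee]

theorem ee_comm (x ξ : RD d) : ee x ξ = ee ξ x := by rw [ee, ee, real_inner_comm]

theorem ee_neg_mul (x ξ : RD d) : ee (-x) ξ * ee x ξ = 1 := by
  rw [← ee_add, neg_add_cancel, ee_zero]

theorem contDiff_ee : ContDiff ℝ ∞ (fun p : RD d × RD d => ee p.1 p.2) := by
  unfold ee
  refine Complex.contDiff_exp.comp ?_
  refine contDiff_const.mul ?_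
  exact Complex.ofRealCLM.contDiff.comp contDiff_inner

theorem contDiff_ee_right (x : RD d) : ContDiff ℝ ∞ (ee x) :=
  contDiff_ee.comp (contDiff_prodMk_right x)

theorem norm_iteratedFDeriv_ee_le (l : ℕ) (x ξ : RD d) :
    ‖iteratedFDeriv ℝ l (ee x) ξ‖ ≤ (2 * Real.pi * ‖x‖) ^ l := by
  set g : ℝ → ℂ := fun t => Complex.exp ((2 * Real.pi * Complex.I) * (t : ℂ)) with hg
  have hgs : ContDiff ℝ ∞ g := by
    refine Complex.contDiff_exp.comp ?_
    exact contDiff_const.mul Complex.ofRealCLM.contDiff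
  have e : ee x = g ∘ (innerSL ℝ x) := by
    ext η; simp [ee, g]
  have hd1 : ∀ l : ℕ, ∀ t : ℝ, iteratedDeriv l g t = (2 * Real.pi * Complex.I) ^ l * g t := by
    intro l
    induction l with
    | zero => intro t; simp
    | succ l ih =>
      intro t
      rw [iteratedDeriv_succ, funext ih]
      have : HasDerivAt g (g t * ((2 * Real.pi * Complex.I) * 1)) t := by
        have h1 : HasDerivAt (fun t : ℝ => (2 * Real.pi * Complex.I) * (t : ℂ))
          ((2 * Real.pi * Complex.I) * 1) t := (Complex.ofRealCLM.hasDerivAt).const_mul _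
        exact h1.cexp
      rw [(this.const_mul _).deriv]
      ring
  rw [e, ContinuousLinearMap.iteratedFDeriv_comp_right _ hgs ξ (by exact_mod_cast le_top)]
  refine (ContinuousMultilinearMap.norm_compContinuousLinearMap_le _ _).trans ?_
  rw [norm_iteratedFDeriv_eq_norm_iteratedDeriv, hd1]
  have hgn : ∀ t, ‖g t‖ = 1 := by
    intro t
    simp only [hg]
    rw [show (2 * Real.pi * Complex.I * (t : ℂ))
      = ((2 * Real.pi * t : ℝ) : ℂ) * Complex.I by push_cast; ring]
    exact Complex.norm_exp_ofReal_mul_I _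
  simp only [norm_mul, norm_pow, hgn, innerSL_apply_norm, Finset.prod_const, Finset.card_univ,
    Fintype.card_fin]
  simp [abs_of_pos Real.pi_pos, mul_pow]

/-- Jointly smooth functions `c(y,ξ)` all of whose `ξ`-derivatives grow polynomially. -/
structure Reg (c : RD d → RD d → ℂ) : Prop where
  smooth : ContDiff ℝ ∞ (fun p : RD d × RD d => c p.1 p.2)
  bound : ∀ l : ℕ, ∃ (C : ℝ) (M : ℕ), 0 ≤ C ∧ ∀ y ξ,
    ‖iteratedFDeriv ℝ l (c y) ξ‖ ≤ C * (1 + ‖y‖) ^ M * (1 + ‖ξ‖) ^ M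

theorem contDiff_right_of_prod {c : RD d → RD d → ℂ}
    (h : ContDiff ℝ ∞ (fun p : RD d × RD d => c p.1 p.2)) (y : RD d) : ContDiff ℝ ∞ (c y) :=
  h.comp (contDiff_prodMk_right y)

/-- Partial derivatives of a jointly smooth function are jointly continuous. -/
theorem continuous_iteratedFDeriv_right {c : RD d → RD d → ℂ}
    (h : ContDiff ℝ ∞ (fun p : RD d × RD d => c p.1 p.2)) (l : ℕ) :
    Continuous (fun p : RD d × RD d => iteratedFDeriv ℝ l (c p.1) p.2) := by
  have e : ∀ p : RD d × RD d, iteratedFDeriv ℝ l (c p.1) p.2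
      = (iteratedFDeriv ℝ l (fun p : RD d × RD d => c p.1 p.2) p).compContinuousLinearMap
        (fun _ => ContinuousLinearMap.inr ℝ (RD d) (RD d)) := by
    rintro ⟨y, ξ⟩
    have h1 : c y = (fun p : RD d × RD d => c (p + (y, 0)).1 (p + (y, 0)).2) ∘
        (ContinuousLinearMap.inr ℝ (RD d) (RD d)) := by
      ext η; simp
    have h2 : ContDiff ℝ ∞ (fun p : RD d × RD d => c (p + (y, 0)).1 (p + (y, 0)).2) :=
      h.comp (contDiff_id.add contDiff_const)
    dsimp only
    rw [h1, ContinuousLinearMap.iteratedFDeriv_comp_right _ h2 ξ (by exact_mod_cast le_top)]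
    congr 1
    rw [iteratedFDeriv_comp_add_right (f := fun p : RD d × RD d => c p.1 p.2) l (y, 0)]
    simp
  rw [show (fun p : RD d × RD d => iteratedFDeriv ℝ l (c p.1) p.2) = _ from funext e]
  exact (ContinuousMultilinearMap.compContinuousLinearMapL
    (fun _ : Fin l => ContinuousLinearMap.inr ℝ (RD d) (RD d))).continuous.comp
      (h.continuous_iteratedFDeriv (by exact_mod_cast le_top))

theorem Reg.smooth_right {c : RD d → RD d → ℂ} (h : Reg c) (y : RD d) : ContDiff ℝ ∞ (c y) :=
  contDiff_right_of_prod h.smooth y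

theorem one_le_one_add_norm (y : RD d) : 1 ≤ 1 + ‖y‖ := by
  have := norm_nonneg y; linarith

theorem Reg.mul {b c : RD d → RD d → ℂ} (hb : Reg b) (hc : Reg c) :
    Reg (fun y ξ => b y ξ * c y ξ) := by
  refine ⟨hb.smooth.mul hc.smooth, fun l => ?_⟩
  choose Cb Mb hCb hb' using hb.bound
  choose Cc Mc hCc hc' using hc.bound
  refine ⟨∑ i ∈ Finset.range (l + 1), (l.choose i : ℝ) * Cb i * Cc (l - i),
    ∑ i ∈ Finset.range (l + 1), (Mb i + Mc (l - i)), ?_, fun y ξ => ?_⟩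
  · exact Finset.sum_nonneg fun i _ => by have := hCb i; have := hCc (l - i); positivity
  refine (norm_iteratedFDeriv_mul_le (hb.smooth_right y) (hc.smooth_right y) ξ
    (by exact_mod_cast le_top)).trans ?_
  rw [Finset.sum_mul, Finset.sum_mul]
  refine Finset.sum_le_sum fun i hi => ?_
  have hM : Mb i + Mc (l - i) ≤ ∑ i ∈ Finset.range (l + 1), (Mb i + Mc (l - i)) :=
    Finset.single_le_sum (f := fun i => Mb i + Mc (l - i)) (fun _ _ => Nat.zero_le _) hi
  have h1 := hCb i
  have h2 := hCc (l - i)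
  calc (l.choose i : ℝ) * ‖iteratedFDeriv ℝ i (b y) ξ‖ * ‖iteratedFDeriv ℝ (l - i) (c y) ξ‖
      ≤ (l.choose i : ℝ) * (Cb i * (1 + ‖y‖) ^ Mb i * (1 + ‖ξ‖) ^ Mb i)
        * (Cc (l - i) * (1 + ‖y‖) ^ Mc (l - i) * (1 + ‖ξ‖) ^ Mc (l - i)) := by
        gcongr
        · exact hb' i y ξ
        · exact hc' (l - i) y ξ
    _ = (l.choose i : ℝ) * Cb i * Cc (l - i) * (1 + ‖y‖) ^ (Mb i + Mc (l - i))
        * (1 + ‖ξ‖) ^ (Mb i + Mc (l - i)) := by ring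
    _ ≤ _ := by
      gcongr
      · exact one_le_one_add_norm y
      · exact one_le_one_add_norm ξ

theorem reg_ee : Reg (ee : RD d → RD d → ℂ) := by
  refine ⟨contDiff_ee, fun l => ⟨(2 * Real.pi) ^ l, l, by positivity, fun y ξ => ?_⟩⟩
  refine (norm_iteratedFDeriv_ee_le l y ξ).trans ?_
  rw [mul_pow]
  have h1 : ‖y‖ ^ l ≤ (1 + ‖y‖) ^ l := by gcongr; linarith
  have h2 : 1 ≤ (1 + ‖ξ‖) ^ l := one_le_pow₀ (one_le_one_add_norm ξ)
  calc (2 * Real.pi) ^ l * ‖y‖ ^ l ≤ (2 * Real.pi) ^ l * (1 + ‖y‖) ^ l := by gcongr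
    _ ≤ _ := le_mul_of_one_le_right (by positivity) h2

/-- Translating the first variable preserves regularity. -/
theorem Reg.comp_sub {c : RD d → RD d → ℂ} (h : Reg c) (z : RD d) :
    Reg (fun y ξ => c (y - z) ξ) := by
  refine ⟨h.smooth.comp ((contDiff_fst.sub contDiff_const).prodMk contDiff_snd), fun l => ?_⟩
  obtain ⟨C, M, hC, hb⟩ := h.bound l
  refine ⟨C * (1 + ‖z‖) ^ M, M, by positivity, fun y ξ => (hb (y - z) ξ).trans ?_⟩
  have : 1 + ‖y - z‖ ≤ (1 + ‖z‖) * (1 + ‖y‖) := by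
    have := norm_sub_le y z
    nlinarith [norm_nonneg y, norm_nonneg z, mul_nonneg (norm_nonneg y) (norm_nonneg z)]
  calc C * (1 + ‖y - z‖) ^ M * (1 + ‖ξ‖) ^ M
      ≤ C * ((1 + ‖z‖) * (1 + ‖y‖)) ^ M * (1 + ‖ξ‖) ^ M := by gcongr
    _ = _ := by rw [mul_pow]; ring

theorem Reg.comp_neg_sub {c : RD d → RD d → ℂ} (h : Reg c) (z : RD d) :
    Reg (fun y ξ => c (z - y) ξ) := by
  refine ⟨h.smooth.comp ((contDiff_const.sub contDiff_fst).prodMk contDiff_snd), fun l => ?_⟩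
  obtain ⟨C, M, hC, hb⟩ := h.bound l
  refine ⟨C * (1 + ‖z‖) ^ M, M, by positivity, fun y ξ => (hb (z - y) ξ).trans ?_⟩
  have : 1 + ‖z - y‖ ≤ (1 + ‖z‖) * (1 + ‖y‖) := by
    have := norm_sub_le z y
    nlinarith [norm_nonneg y, norm_nonneg z, mul_nonneg (norm_nonneg y) (norm_nonneg z)]
  calc C * (1 + ‖z - y‖) ^ M * (1 + ‖ξ‖) ^ M
      ≤ C * ((1 + ‖z‖) * (1 + ‖y‖)) ^ M * (1 + ‖ξ‖) ^ M := by gcongr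
    _ = _ := by rw [mul_pow]; ring

theorem Reg.hasTemperateGrowth {c : RD d → RD d → ℂ} (h : Reg c) (y : RD d) :
    (c y).HasTemperateGrowth := by
  refine ⟨h.smooth_right y, fun l => ?_⟩
  obtain ⟨C, M, hC, hb⟩ := h.bound l
  exact ⟨M, C * (1 + ‖y‖) ^ M, fun ξ => hb y ξ⟩

/-- The Schwartz function `c(y,·) κ`. -/
def Reg.cut {c : RD d → RD d → ℂ} (_ : Reg c) (κ : 𝓢(RD d, ℂ)) (y : RD d) : 𝓢(RD d, ℂ) :=
  SchwartzMap.smulLeftCLM ℂ (c y) κ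

theorem Reg.cut_apply {c : RD d → RD d → ℂ} (h : Reg c) (κ : 𝓢(RD d, ℂ)) (y ξ : RD d) :
    h.cut κ y ξ = c y ξ * κ ξ := by
  rw [Reg.cut, SchwartzMap.smulLeftCLM_apply_apply (h.hasTemperateGrowth y), smul_eq_mul]

/-! ### Schwartz seminorms -/

/-- The largest Schwartz seminorm of index at most `n`. -/
def SN (n : ℕ) (ψ : 𝓢(RD d, ℂ)) : ℝ :=
  ((Finset.Iic (n, n)).sup (schwartzSeminormFamily ℂ (RD d) ℂ)) ψ

theorem SN_nonneg (n : ℕ) (ψ : 𝓢(RD d, ℂ)) : 0 ≤ SN n ψ := apply_nonneg _ _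

theorem SN_mono {n n' : ℕ} (h : n ≤ n') (ψ : 𝓢(RD d, ℂ)) : SN n ψ ≤ SN n' ψ := by
  have : (Finset.Iic (n, n)) ⊆ Finset.Iic (n', n') := Finset.Iic_subset_Iic.2 ⟨h, h⟩
  exact Finset.sup_mono (f := schwartzSeminormFamily ℂ (RD d) ℂ) this ψ

theorem pow_mul_le_SN {n k l : ℕ} (hk : k ≤ n) (hl : l ≤ n) (ψ : 𝓢(RD d, ℂ)) (ξ : RD d) :
    (1 + ‖ξ‖) ^ k * ‖iteratedFDeriv ℝ l ψ ξ‖ ≤ 2 ^ n * SN n ψ :=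
  SchwartzMap.one_add_le_sup_seminorm_apply (𝕜 := ℂ) (m := (n, n)) hk hl ψ ξ

theorem SN_le {n : ℕ} {ψ : 𝓢(RD d, ℂ)} {B : ℝ} (hB : 0 ≤ B)
    (h : ∀ l ≤ n, ∀ ξ, (1 + ‖ξ‖) ^ n * ‖iteratedFDeriv ℝ l ψ ξ‖ ≤ B) : SN n ψ ≤ B := by
  refine Seminorm.finset_sup_apply_le hB fun i hi => ?_
  rw [Finset.mem_Iic] at hi
  refine SchwartzMap.seminorm_le_bound ℂ i.1 i.2 ψ hB fun ξ => (le_trans ?_ (h i.2 hi.2 ξ))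
  gcongr
  calc ‖ξ‖ ^ i.1 ≤ (1 + ‖ξ‖) ^ i.1 := by gcongr; linarith
    _ ≤ _ := pow_le_pow_right₀ (one_le_one_add_norm ξ) hi.1

theorem finset_sup_le_SN (s : Finset (ℕ × ℕ)) : ∃ n, ∀ ψ : 𝓢(RD d, ℂ),
    (s.sup (schwartzSeminormFamily ℂ (RD d) ℂ)) ψ ≤ SN n ψ := by
  refine ⟨s.sup fun i => max i.1 i.2, fun ψ => ?_⟩
  refine Finset.sup_mono (f := schwartzSeminormFamily ℂ (RD d) ℂ) ?_ ψ
  intro i hi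
  have := Finset.le_sup (f := fun i : ℕ × ℕ => max i.1 i.2) hi
  rw [Finset.mem_Iic]
  exact ⟨(le_max_left _ _).trans this, (le_max_right _ _).trans this⟩

theorem dist_le_SN (v : TD d) : ∃ (n : ℕ) (C : ℝ), 0 ≤ C ∧ ∀ ψ, ‖v ψ‖ ≤ C * SN n ψ := by
  have hq : Continuous ((normSeminorm ℂ ℂ).comp v.toLinearMap) := by
    change Continuous fun ψ => ‖v ψ‖
    fun_prop
  obtain ⟨s, C, -, h⟩ := Seminorm.bound_of_continuous (schwartz_withSeminorms ℂ (RD d) ℂ) _ hq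
  obtain ⟨n, hn⟩ := finset_sup_le_SN (d := d) s
  refine ⟨n, C, C.2, fun ψ => ?_⟩
  have h1 : ‖v ψ‖ ≤ C * (s.sup (schwartzSeminormFamily ℂ (RD d) ℂ)) ψ := h ψ
  exact h1.trans (mul_le_mul_of_nonneg_left (hn ψ) C.2)

theorem clm_SN_le (T : 𝓢(RD d, ℂ) →L[ℂ] 𝓢(RD d, ℂ)) (n : ℕ) :
    ∃ (n' : ℕ) (C : ℝ), 0 ≤ C ∧ ∀ ψ, SN n (T ψ) ≤ C * SN n' ψ := by
  have hq : Continuous (((Finset.Iic (n, n)).sup (schwartzSeminormFamily ℂ (RD d) ℂ)).comp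
      T.toLinearMap) := by
    refine Continuous.comp (g := fun ψ : 𝓢(RD d, ℂ) => SN n ψ) ?_ T.continuous
    have := (schwartz_withSeminorms ℂ (RD d) ℂ).finset_sups.continuous_seminorm (Finset.Iic (n, n))
    exact this
  obtain ⟨s, C, -, h⟩ := Seminorm.bound_of_continuous (schwartz_withSeminorms ℂ (RD d) ℂ) _ hq
  obtain ⟨n', hn⟩ := finset_sup_le_SN (d := d) s
  refine ⟨n', C, C.2, fun ψ => ?_⟩
  have h1 : SN n (T ψ) ≤ C * (s.sup (schwartzSeminormFamily ℂ (RD d) ℂ)) ψ := h ψ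
  exact h1.trans (mul_le_mul_of_nonneg_left (hn ψ) C.2)

theorem tendsto_schwartz_of_SN {ι : Type*} {f : Filter ι} {g : ι → 𝓢(RD d, ℂ)} {ψ : 𝓢(RD d, ℂ)}
    (h : ∀ n, Tendsto (fun i => SN n (g i - ψ)) f (nhds 0)) : Tendsto g f (nhds ψ) := by
  rw [(schwartz_withSeminorms ℂ (RD d) ℂ).tendsto_nhds]
  intro i ε hε
  filter_upwards [(h (max i.1 i.2)).eventually (gt_mem_nhds hε)] with j hj
  refine lt_of_le_of_lt ?_ hj
  have : i ∈ Finset.Iic (max i.1 i.2, max i.1 i.2) := by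
    rw [Finset.mem_Iic]; exact ⟨le_max_left _ _, le_max_right _ _⟩
  exact Finset.le_sup (f := schwartzSeminormFamily ℂ (RD d) ℂ) this (g j - ψ)

/-- Schwartz functions are integrable against polynomial weights. -/
theorem integrable_pow_mul_schwartz (M : ℕ) (w : 𝓢(RD d, ℂ)) :
    Integrable (fun y => (1 + ‖y‖) ^ M * ‖w y‖) := by
  have h : ∀ k : ℕ, Integrable (fun y => ‖y‖ ^ k * ‖w y‖) := fun k => by
    simpa using w.integrable_pow_mul volume k
  simp_rw [add_comm (1:ℝ), add_pow, Finset.sum_mul]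
  refine integrable_finsetSum _ fun i _ => ?_
  simpa [mul_assoc, mul_comm, mul_left_comm] using (h i).mul_const (M.choose i : ℝ)

/-! ### Continuity of `y ↦ c(y,·) κ` in the Schwartz space -/

theorem Reg.pow_mul_cut_le {c : RD d → RD d → ℂ} (h : Reg c) (p l : ℕ) :
    ∃ (C : ℝ) (M n : ℕ), 0 ≤ C ∧ ∀ κ y ξ,
      (1 + ‖ξ‖) ^ p * ‖iteratedFDeriv ℝ l (h.cut κ y) ξ‖ ≤ C * SN n κ * (1 + ‖y‖) ^ M := by
  choose Cb Mb hCb hb using h.bound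
  set M := ∑ i ∈ Finset.range (l + 1), Mb i with hMdef
  refine ⟨∑ i ∈ Finset.range (l + 1), (l.choose i : ℝ) * Cb i * 2 ^ (M + p + l), M, M + p + l,
    ?_, fun κ y ξ => ?_⟩
  · exact Finset.sum_nonneg fun i _ => by have := hCb i; positivity
  have e : (h.cut κ y : RD d → ℂ) = fun ξ => c y ξ * κ ξ := funext fun ξ => h.cut_apply κ y ξ
  rw [e]
  have h1 := norm_iteratedFDeriv_mul_le (n := l) (h.smooth_right y) (κ.smooth ⊤) ξ
    (by exact_mod_cast le_top)
  refine (mul_le_mul_of_nonneg_left h1 (by positivity)).trans ?_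
  rw [Finset.mul_sum, Finset.sum_mul, Finset.sum_mul]
  refine Finset.sum_le_sum fun i hi => ?_
  have hM : Mb i ≤ M := Finset.single_le_sum (f := Mb) (fun _ _ => Nat.zero_le _) hi
  have h2 := hCb i
  have h3 := pow_mul_le_SN (n := M + p + l) (k := Mb i + p) (l := l - i) (by omega) (by omega) κ ξ
  have h4 := SN_nonneg (M + p + l) κ
  calc (1 + ‖ξ‖) ^ p * ((l.choose i : ℝ) * ‖iteratedFDeriv ℝ i (c y) ξ‖ *
        ‖iteratedFDeriv ℝ (l - i) κ ξ‖)
      ≤ (1 + ‖ξ‖) ^ p * ((l.choose i : ℝ) * (Cb i * (1 + ‖y‖) ^ Mb i * (1 + ‖ξ‖) ^ Mb i) *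
        ‖iteratedFDeriv ℝ (l - i) κ ξ‖) := by
        gcongr; exact hb i y ξ
    _ = (l.choose i : ℝ) * Cb i * (1 + ‖y‖) ^ Mb i *
        ((1 + ‖ξ‖) ^ (Mb i + p) * ‖iteratedFDeriv ℝ (l - i) κ ξ‖) := by ring
    _ ≤ (l.choose i : ℝ) * Cb i * (1 + ‖y‖) ^ M * (2 ^ (M + p + l) * SN (M + p + l) κ) := by
        gcongr; exact one_le_one_add_norm y
    _ = _ := by ring

theorem Reg.SN_cut_le {c : RD d → RD d → ℂ} (h : Reg c) (n : ℕ) :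
    ∃ (C : ℝ) (M n' : ℕ), 0 ≤ C ∧ ∀ κ y, SN n (h.cut κ y) ≤ C * SN n' κ * (1 + ‖y‖) ^ M := by
  choose C M N hC hb using h.pow_mul_cut_le n
  refine ⟨∑ l ∈ Finset.range (n + 1), C l, ∑ l ∈ Finset.range (n + 1), M l,
    ∑ l ∈ Finset.range (n + 1), N l, Finset.sum_nonneg fun l _ => hC l, fun κ y => ?_⟩
  have hS := SN_nonneg (∑ l ∈ Finset.range (n + 1), N l) κ
  have hC' : 0 ≤ ∑ l ∈ Finset.range (n + 1), C l := Finset.sum_nonneg fun l _ => hC l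
  refine SN_le (by positivity) fun l hl ξ => (hb l κ y ξ).trans ?_
  have hl' : l ∈ Finset.range (n + 1) := Finset.mem_range.2 (by omega)
  have h0 := SN_nonneg (N l) κ
  have h00 := hC l
  gcongr
  · exact Finset.single_le_sum (f := C) (fun i _ => hC i) hl'
  · exact SN_mono (Finset.single_le_sum (f := N) (fun i _ => Nat.zero_le _) hl') κ
  · exact one_le_one_add_norm y
  · exact Finset.single_le_sum (f := M) (fun i _ => Nat.zero_le _) hl'

theorem Reg.continuous_cut {c : RD d → RD d → ℂ} (h : Reg c) (κ : 𝓢(RD d, ℂ)) :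
    Continuous (h.cut κ) := by
  rw [continuous_iff_continuousAt]
  intro y₀
  rw [ContinuousAt, (schwartz_withSeminorms ℂ (RD d) ℂ).tendsto_nhds]
  rintro ⟨p, l⟩ ε hε
  obtain ⟨C, M, n, hC, hb⟩ := h.pow_mul_cut_le (p + 1) l
  set K : ℝ := C * SN n κ * (1 + (‖y₀‖ + 1)) ^ M with hK
  have hK0 : 0 ≤ K := by have := SN_nonneg n κ; positivity
  have hbK : ∀ y ∈ Metric.ball y₀ 1, ∀ ξ,
      (1 + ‖ξ‖) ^ (p + 1) * ‖iteratedFDeriv ℝ l (h.cut κ y) ξ‖ ≤ K := by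
    intro y hy ξ
    refine (hb κ y ξ).trans ?_
    have hy' : ‖y‖ ≤ ‖y₀‖ + 1 := by
      have := norm_sub_norm_le y y₀
      rw [Metric.mem_ball, dist_eq_norm] at hy
      linarith
    have := SN_nonneg n κ
    rw [hK]
    gcongr
  have e : ∀ y, (h.cut κ y : RD d → ℂ) = fun ξ => c y ξ * κ ξ :=
    fun y => funext fun ξ => h.cut_apply κ y ξ
  have hcont : Continuous (fun q : RD d × RD d => iteratedFDeriv ℝ l (h.cut κ q.1) q.2) := by
    have := continuous_iteratedFDeriv_right (c := fun y ξ => c y ξ * κ ξ)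
      (h.smooth.mul ((κ.smooth ⊤).comp contDiff_snd)) l
    simpa only [e] using this
  obtain ⟨R, hR0, hR⟩ : ∃ R : ℝ, 0 < R ∧ 2 * K / R < ε / 2 := by
    refine ⟨4 * K / ε + 1, by positivity, ?_⟩
    rw [div_lt_div_iff₀ (by positivity) (by norm_num)]
    have : ε * (4 * K / ε + 1) = 4 * K + ε := by field_simp
    rw [this]; linarith
  have hloc : ∀ᶠ y in nhds y₀, ∀ ξ ∈ Metric.closedBall (0 : RD d) R,
      ‖ξ‖ ^ p * ‖iteratedFDeriv ℝ l (h.cut κ y) ξ - iteratedFDeriv ℝ l (h.cut κ y₀) ξ‖ < ε / 2 := by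
    refine (isCompact_closedBall (0 : RD d) R).eventually_forall_of_forall_eventually ?_
    intro ξ _
    have hc2 : Continuous (fun q : RD d × RD d => ‖q.2‖ ^ p *
        ‖iteratedFDeriv ℝ l (h.cut κ q.1) q.2 - iteratedFDeriv ℝ l (h.cut κ y₀) q.2‖) := by
      have := hcont.comp (Continuous.prodMk_right y₀ |>.comp continuous_snd (X := RD d × RD d))
      exact (continuous_snd.norm.pow p).mul (hcont.sub this).norm
    exact (hc2.tendsto (y₀, ξ)).eventually_lt_const (by simpa using hε)
  filter_upwards [hloc, Metric.ball_mem_nhds y₀ one_pos] with y hy1 hy2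
  refine lt_of_le_of_lt (SchwartzMap.seminorm_le_bound ℂ p l _ (M := ε / 2) (by positivity)
    fun ξ => ?_) (by linarith)
  have hsub : iteratedFDeriv ℝ l (h.cut κ y - h.cut κ y₀ : 𝓢(RD d, ℂ)) ξ
      = iteratedFDeriv ℝ l (h.cut κ y) ξ - iteratedFDeriv ℝ l (h.cut κ y₀) ξ := by
    have := iteratedFDeriv_sub_apply (i := l) (x := ξ) (𝕜 := ℝ) (f := h.cut κ y)
      (g := h.cut κ y₀)
      (((h.cut κ y).smooth l).contDiffAt) (((h.cut κ y₀).smooth l).contDiffAt)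
    exact this
  rw [hsub]
  by_cases hξ : ‖ξ‖ ≤ R
  · exact (hy1 ξ (by simpa using hξ)).le
  push Not at hξ
  refine le_trans ?_ hR.le
  rw [le_div_iff₀ hR0]
  have h1 := hbK y hy2 ξ
  have h2 := hbK y₀ (Metric.mem_ball_self one_pos) ξ
  have h3 : ‖ξ‖ ^ p * R ≤ (1 + ‖ξ‖) ^ (p + 1) := by
    rw [pow_succ]
    gcongr <;> linarith
  calc ‖ξ‖ ^ p * ‖iteratedFDeriv ℝ l (h.cut κ y) ξ - iteratedFDeriv ℝ l (h.cut κ y₀) ξ‖ * R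
      = (‖ξ‖ ^ p * R) * ‖iteratedFDeriv ℝ l (h.cut κ y) ξ - iteratedFDeriv ℝ l (h.cut κ y₀) ξ‖ := by
        ring
    _ ≤ (1 + ‖ξ‖) ^ (p + 1) * (‖iteratedFDeriv ℝ l (h.cut κ y) ξ‖
        + ‖iteratedFDeriv ℝ l (h.cut κ y₀) ξ‖) := by
        gcongr; exact norm_sub_le _ _
    _ ≤ 2 * K := by rw [mul_add]; linarith

section JetSpace

set_option maxSynthPendingDepth 5

/-! ### Tempered distributions and integrals of families of Schwartz functions -/

/-- The jets of order at most `n`. -/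
abbrev Jet (d n : ℕ) : Type := (l : Fin (n + 1)) → (RD d [×(l : ℕ)]→L[ℝ] ℂ)

/-- The weighted jet of a Schwartz function. -/
def jetFun (n : ℕ) (ψ : 𝓢(RD d, ℂ)) : RD d → Jet d n :=
  fun ξ l => (1 + ‖ξ‖) ^ n • iteratedFDeriv ℝ l ψ ξ

theorem continuous_jetFun (n : ℕ) (ψ : 𝓢(RD d, ℂ)) : Continuous (jetFun n ψ) := by
  refine continuous_pi fun l => ?_
  exact ((continuous_const.add continuous_norm).pow n).smul
    ((ψ.smooth ⊤).continuous_iteratedFDeriv (by exact_mod_cast le_top))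

theorem norm_jetFun_le (n : ℕ) (ψ : 𝓢(RD d, ℂ)) (ξ : RD d) : ‖jetFun n ψ ξ‖ ≤ 2 ^ n * SN n ψ := by
  have := SN_nonneg n ψ
  rw [pi_norm_le_iff_of_nonneg (by positivity)]
  intro l
  rw [jetFun, norm_smul, Real.norm_of_nonneg (by positivity)]
  exact pow_mul_le_SN le_rfl (by omega) ψ ξ

/-- The weighted jet of a Schwartz function as a bounded continuous function. -/
def jet (n : ℕ) (ψ : 𝓢(RD d, ℂ)) : BoundedContinuousFunction (RD d) (Jet d n) :=
  BoundedContinuousFunction.ofNormedAddCommGroup (jetFun n ψ) (continuous_jetFun n ψ) _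
    (norm_jetFun_le n ψ)

theorem jet_apply (n : ℕ) (ψ : 𝓢(RD d, ℂ)) (ξ : RD d) (l : Fin (n + 1)) :
    jet n ψ ξ l = (1 + ‖ξ‖) ^ n • iteratedFDeriv ℝ l ψ ξ := rfl

theorem norm_jet_le (n : ℕ) (ψ : 𝓢(RD d, ℂ)) : ‖jet n ψ‖ ≤ 2 ^ n * SN n ψ :=
  BoundedContinuousFunction.norm_ofNormedAddCommGroup_le _
    (by have := SN_nonneg n ψ; positivity) _

theorem SN_le_norm_jet (n : ℕ) (ψ : 𝓢(RD d, ℂ)) : SN n ψ ≤ ‖jet n ψ‖ := by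
  refine SN_le (norm_nonneg _) fun l hl ξ => ?_
  have h1 := (jet n ψ).norm_coe_le_norm ξ
  refine le_trans ?_ h1
  have h2 := norm_le_pi_norm (jet n ψ ξ) ⟨l, by omega⟩
  rw [jet_apply, norm_smul, Real.norm_of_nonneg (by positivity)] at h2
  exact h2

/-- The weighted jet as a linear map. -/
def jetL (n : ℕ) : 𝓢(RD d, ℂ) →ₗ[ℂ] BoundedContinuousFunction (RD d) (Jet d n) where
  toFun := jet n
  map_add' f g := by
    ext1 ξ
    funext l
    rw [BoundedContinuousFunction.coe_add, Pi.add_apply, Pi.add_apply, jet_apply, jet_apply,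
      jet_apply]
    refine Eq.trans ?_ (smul_add _ _ _)
    congr 1
    exact iteratedFDeriv_add_apply ((f.smooth l).contDiffAt) ((g.smooth l).contDiffAt)
  map_smul' a f := by
    ext1 ξ
    funext l
    change jet n (a • f) ξ l = a • jet n f ξ l
    rw [jet_apply, jet_apply, smul_comm a]
    congr 1
    exact iteratedFDeriv_const_smul_apply ((f.smooth l).contDiffAt)

theorem jetL_injective (n : ℕ) : Function.Injective (jetL (d := d) n) := by
  rw [← LinearMap.ker_eq_bot, LinearMap.ker_eq_bot']
  intro ψ hψ
  have h1 : ‖jet n ψ‖ = 0 := by rw [show jet n ψ = jetL n ψ from rfl, hψ, norm_zero]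
  have h2 : SN n ψ ≤ 0 := (SN_le_norm_jet n ψ).trans h1.le
  ext ξ
  have h3 := pow_mul_le_SN (n := n) (k := 0) (l := 0) (Nat.zero_le _) (Nat.zero_le _) ψ ξ
  have h4 : ‖ψ ξ‖ ≤ 0 := by
    simp only [pow_zero, one_mul, norm_iteratedFDeriv_zero] at h3
    exact h3.trans (mul_nonpos_of_nonneg_of_nonpos (by positivity) h2)
  simpa using h4

/-- Every tempered distribution extends to a functional on weighted jets. -/
theorem exists_jet_extension (v : TD d) : ∃ (n : ℕ)
    (g : StrongDual ℂ (BoundedContinuousFunction (RD d) (Jet d n))), ∀ ψ, g (jet n ψ) = v ψ := by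
  obtain ⟨n, C, hC, hv⟩ := dist_le_SN v
  let eqv := LinearEquiv.ofInjective (jetL (d := d) n) (jetL_injective n)
  let f₀ : LinearMap.range (jetL (d := d) n) →ₗ[ℂ] ℂ := v.toLinearMap ∘ₗ eqv.symm.toLinearMap
  have hval : ∀ ψ, f₀ (eqv ψ) = v ψ := fun ψ => by simp [f₀]
  let f : StrongDual ℂ (LinearMap.range (jetL (d := d) n)) := f₀.mkContinuous C (by
    intro x
    obtain ⟨ψ, rfl⟩ := eqv.surjective x
    rw [hval]
    exact (hv ψ).trans (mul_le_mul_of_nonneg_left (SN_le_norm_jet n ψ) hC))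
  obtain ⟨g, hg, -⟩ := exists_extension_norm_eq (LinearMap.range (jetL (d := d) n)) f
  refine ⟨n, g, fun ψ => ?_⟩
  have := hg (eqv ψ)
  rw [show f (eqv ψ) = v ψ from hval ψ] at this
  exact this

/-- A family of Schwartz functions that is continuous and of polynomial growth. -/
structure PolyFam (h : RD d → 𝓢(RD d, ℂ)) : Prop where
  cont : Continuous h
  growth : ∀ n, ∃ (C : ℝ) (M : ℕ), 0 ≤ C ∧ ∀ y, SN n (h y) ≤ C * (1 + ‖y‖) ^ M

theorem Reg.polyFam_cut {c : RD d → RD d → ℂ} (h : Reg c) (κ : 𝓢(RD d, ℂ)) :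
    PolyFam (h.cut κ) := by
  refine ⟨h.continuous_cut κ, fun n => ?_⟩
  obtain ⟨C, M, n', hC, hb⟩ := h.SN_cut_le n
  exact ⟨C * SN n' κ, M, by have := SN_nonneg n' κ; positivity, fun y => hb κ y⟩

theorem continuous_jet (n : ℕ) : Continuous (jet (d := d) n) := by
  have h1 := WithSeminorms.continuous_of_isBounded
    (schwartz_withSeminorms ℂ (RD d) ℂ) (norm_withSeminorms ℂ _) (jetL (d := d) n) (fun _ => ?_)
  · exact h1
  · refine ⟨Finset.Iic (n, n), 2 ^ n, fun ψ => ?_⟩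
    change ‖jet n ψ‖ ≤ ((2 ^ n : ℝ≥0) : ℝ) *
      ((Finset.Iic (n, n)).sup (schwartzSeminormFamily ℂ (RD d) ℂ)) ψ
    simpa [SN] using norm_jet_le n ψ

theorem PolyFam.iteratedFDeriv_cont {h : RD d → 𝓢(RD d, ℂ)} (hh : PolyFam h) (l : ℕ) (ξ : RD d) :
    Continuous (fun y => iteratedFDeriv ℝ l (h y) ξ) := by
  have h1 : Continuous fun y => jet l (h y) ξ (Fin.last l) :=
    (continuous_apply (Fin.last l)).comp
      ((BoundedContinuousFunction.evalCLM ℝ ξ).continuous.comp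
        ((continuous_jet l).comp hh.cont))
  have h2 : ∀ y, iteratedFDeriv ℝ l (h y) ξ
      = ((1 + ‖ξ‖) ^ l)⁻¹ • jet l (h y) ξ (Fin.last l) := by
    intro y
    rw [jet_apply, smul_smul, inv_mul_cancel₀ (by positivity), one_smul]
    rfl
  simp_rw [h2]
  exact Continuous.const_smul h1 (((1 + ‖ξ‖) ^ l)⁻¹ : ℝ)

theorem PolyFam.integrable_dist {h : RD d → 𝓢(RD d, ℂ)} (hh : PolyFam h) (v : TD d)
    (w : 𝓢(RD d, ℂ)) : Integrable (fun y => v (h y) * w y) := by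
  obtain ⟨n, C, hC, hv⟩ := dist_le_SN v
  obtain ⟨C', M, hC', hM⟩ := hh.growth n
  refine ((integrable_pow_mul_schwartz M w).const_mul (C * C')).mono'
    (((v.continuous.comp hh.cont).mul w.continuous).aestronglyMeasurable)
    (Eventually.of_forall fun y => ?_)
  rw [norm_mul]
  calc ‖v (h y)‖ * ‖w y‖ ≤ (C * (C' * (1 + ‖y‖) ^ M)) * ‖w y‖ := by
        gcongr
        exact (hv _).trans (mul_le_mul_of_nonneg_left (hM y) hC)
    _ = _ := by ring

/-- Integrals of polynomially growing families of Schwartz functions against Schwartz weights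
are Schwartz functions, and tempered distributions commute with such integrals. -/
theorem PolyFam.exists_integral {h : RD d → 𝓢(RD d, ℂ)} (hh : PolyFam h) (w : 𝓢(RD d, ℂ)) :
    ∃ Ψ : 𝓢(RD d, ℂ), (∀ ξ, Ψ ξ = ∫ y, h y ξ * w y) ∧ ∀ v : TD d, v Ψ = ∫ y, v (h y) * w y := by
  set F : RD d → RD d → ℂ := fun y ξ => h y ξ * w y with hF
  have hFd : ∀ l y ξ, iteratedFDeriv ℝ l (F y) ξ = w y • iteratedFDeriv ℝ l (h y) ξ := by
    intro l y ξ
    have : F y = (w y) • (h y : RD d → ℂ) := by ext ξ; simp [hF, mul_comm]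
    rw [this]
    exact iteratedFDeriv_const_smul_apply ((h y).smooth l).contDiffAt
  have hmeas : ∀ l ξ, Continuous (fun y => iteratedFDeriv ℝ l (F y) ξ) := by
    intro l ξ
    simp_rw [hFd]
    exact w.continuous.smul (hh.iteratedFDeriv_cont l ξ)
  have hbd : ∀ k l : ℕ, ∃ g : RD d → ℝ, Integrable g ∧ ∀ y ξ,
      (1 + ‖ξ‖) ^ k * ‖iteratedFDeriv ℝ l (F y) ξ‖ ≤ g y := by
    intro k l
    obtain ⟨C, M, hC, hM⟩ := hh.growth (k + l)
    refine ⟨fun y => 2 ^ (k + l) * C * ((1 + ‖y‖) ^ M * ‖w y‖),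
      (integrable_pow_mul_schwartz M w).const_mul _, fun y ξ => ?_⟩
    rw [hFd, norm_smul]
    have h1 := pow_mul_le_SN (n := k + l) (k := k) (l := l) (by omega) (by omega) (h y) ξ
    calc (1 + ‖ξ‖) ^ k * (‖w y‖ * ‖iteratedFDeriv ℝ l (h y) ξ‖)
        = ((1 + ‖ξ‖) ^ k * ‖iteratedFDeriv ℝ l (h y) ξ‖) * ‖w y‖ := by ring
      _ ≤ (2 ^ (k + l) * (C * (1 + ‖y‖) ^ M)) * ‖w y‖ := by
        refine mul_le_mul_of_nonneg_right ?_ (norm_nonneg _)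
        exact h1.trans (mul_le_mul_of_nonneg_left (hM y) (by positivity))
      _ = _ := by ring
  obtain ⟨hsm, hder⟩ := iteratedFDeriv_integral_of_dominated (μ := volume) (F := F)
    (fun y => ((h y).smooth ⊤).mul contDiff_const)
    (fun l ξ => (hmeas l ξ).aestronglyMeasurable)
    (fun l => by
      obtain ⟨g, hg, hgb⟩ := hbd 0 l
      exact ⟨g, hg, 0, fun y ξ => by simpa using hgb y ξ⟩)
  have hIntF : ∀ l ξ, Integrable (fun y => iteratedFDeriv ℝ l (F y) ξ) := by
    intro l ξ
    obtain ⟨g, hg, hgb⟩ := hbd 0 l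
    exact hg.mono' (hmeas l ξ).aestronglyMeasurable
      (Eventually.of_forall fun y => by simpa using hgb y ξ)
  let Ψ : 𝓢(RD d, ℂ) :=
    { toFun := fun ξ => ∫ y, F y ξ
      smooth' := hsm
      decay' := by
        intro k l
        obtain ⟨g, hg, hgb⟩ := hbd k l
        refine ⟨∫ y, g y, fun ξ => ?_⟩
        rw [hder]
        calc ‖ξ‖ ^ k * ‖∫ y, iteratedFDeriv ℝ l (F y) ξ‖
            ≤ (1 + ‖ξ‖) ^ k * ∫ y, ‖iteratedFDeriv ℝ l (F y) ξ‖ := by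
              gcongr
              · linarith
              · exact norm_integral_le_integral_norm _
          _ = ∫ y, (1 + ‖ξ‖) ^ k * ‖iteratedFDeriv ℝ l (F y) ξ‖ := by
              rw [integral_const_mul]
          _ ≤ ∫ y, g y := integral_mono ((hIntF l ξ).norm.const_mul _) hg (fun y => hgb y ξ) }
  refine ⟨Ψ, fun ξ => rfl, fun v => ?_⟩
  obtain ⟨n, g, hg⟩ := exists_jet_extension v
  have hI : Integrable (fun y => w y • jet n (h y)) := by
    obtain ⟨C, M, hC, hM⟩ := hh.growth n
    refine ((integrable_pow_mul_schwartz M w).const_mul (2 ^ n * C)).mono'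
      ((w.continuous.smul ((continuous_jet n).comp hh.cont)).aestronglyMeasurable)
      (Eventually.of_forall fun y => ?_)
    rw [norm_smul]
    calc ‖w y‖ * ‖jet n (h y)‖ ≤ ‖w y‖ * (2 ^ n * (C * (1 + ‖y‖) ^ M)) := by
          gcongr
          exact (norm_jet_le n _).trans (mul_le_mul_of_nonneg_left (hM y) (by positivity))
      _ = _ := by ring
  have hJ : jet n Ψ = ∫ y, w y • jet n (h y) := by
    ext1 ξ
    funext l
    let ev : BoundedContinuousFunction (RD d) (Jet d n) →L[ℝ] (RD d [×(l : ℕ)]→L[ℝ] ℂ) :=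
      (ContinuousLinearMap.proj (R := ℝ) (φ := fun l : Fin (n + 1) => RD d [×(l : ℕ)]→L[ℝ] ℂ) l).comp
        (BoundedContinuousFunction.evalCLM ℝ ξ)
    change _ = ev (∫ y, w y • jet n (h y))
    rw [← ev.integral_comp_comm hI, jet_apply]
    have : ∀ y, ev (w y • jet n (h y)) = (1 + ‖ξ‖) ^ n • iteratedFDeriv ℝ l (F y) ξ := by
      intro y
      rw [hFd, smul_comm]
      rfl
    simp_rw [this]
    rw [integral_smul, ← hder]
    rfl
  rw [← hg, hJ, ← g.integral_comp_comm hI]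
  refine integral_congr_ae (Eventually.of_forall fun y => ?_)
  simp [hg, mul_comm]

end JetSpace

/-! ### Fourier inversion and Littlewood–Paley pieces -/

/-- The inverse Fourier transform of a Schwartz function. -/
def invS (f : 𝓢(RD d, ℂ)) : 𝓢(RD d, ℂ) := FourierTransform.fourierInvCLM ℂ 𝓢(RD d, ℂ) f

theorem fourierS_invS (f : 𝓢(RD d, ℂ)) : fourierS (invS f) = f := by
  change 𝓕 (𝓕⁻ f) = f
  exact FourierTransform.fourier_fourierInv_eq f

theorem invS_fourierS (f : 𝓢(RD d, ℂ)) : invS (fourierS f) = f := by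
  change 𝓕⁻ (𝓕 f) = f
  exact FourierTransform.fourierInv_fourier_eq f

theorem fourierS_apply (f : 𝓢(RD d, ℂ)) (y : RD d) : fourierS f y = ∫ ξ, f ξ * ee (-y) ξ := by
  change 𝓕 (f : RD d → ℂ) y = _
  rw [Real.fourier_eq']
  refine integral_congr_ae (Eventually.of_forall fun ξ => ?_)
  simp only [smul_eq_mul, ee, inner_neg_left]
  rw [mul_comm, real_inner_comm]
  congr 2
  push_cast
  ring

theorem invS_apply (f : 𝓢(RD d, ℂ)) (y : RD d) : invS f y = ∫ ξ, f ξ * ee y ξ := by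
  change (𝓕⁻ f) y = _
  rw [SchwartzMap.fourierInv_coe, Real.fourierInv_eq']
  refine integral_congr_ae (Eventually.of_forall fun ξ => ?_)
  simp only [smul_eq_mul, ee]
  rw [mul_comm, real_inner_comm]
  congr 2
  push_cast
  ring

theorem fourierS_cut_ee (g : 𝓢(RD d, ℂ)) (x y : RD d) :
    fourierS (reg_ee.cut g x) y = invS g (x - y) := by
  rw [fourierS_apply, invS_apply]
  refine integral_congr_ae (Eventually.of_forall fun ξ => ?_)
  simp only [Reg.cut_apply]
  rw [sub_eq_add_neg, ee_add]
  ring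

/-- Dilation `ψ(r ·)` of a Schwartz function. -/
def dil (r : ℝ) (hr : r ≠ 0) : 𝓢(RD d, ℂ) →L[ℂ] 𝓢(RD d, ℂ) :=
  SchwartzMap.compCLMOfContinuousLinearEquiv ℂ
    (ContinuousLinearEquiv.smulLeft (M₁ := RD d) (R₁ := ℝ) (Units.mk0 r hr))

theorem dil_apply (r : ℝ) (hr : r ≠ 0) (ψ : 𝓢(RD d, ℂ)) (ξ : RD d) :
    dil r hr ψ ξ = ψ (r • ξ) := rfl

theorem invS_dil {r : ℝ} (hr : 0 < r) (ψ : 𝓢(RD d, ℂ)) (y : RD d) :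
    invS (dil r⁻¹ (inv_ne_zero hr.ne') ψ) y = ((r ^ d : ℝ) : ℂ) * invS ψ (r • y) := by
  rw [invS_apply, invS_apply]
  have h := Measure.integral_comp_smul (volume : Measure (RD d))
    (fun ξ => ψ ξ * ee (r • y) ξ) r⁻¹
  have h1 : ∀ ξ, (fun ξ => ψ ξ * ee (r • y) ξ) (r⁻¹ • ξ)
      = dil r⁻¹ (inv_ne_zero hr.ne') ψ ξ * ee y ξ := by
    intro ξ
    simp only [dil_apply, ee, real_inner_smul_left, real_inner_smul_right]
    rw [inv_mul_cancel_left₀ hr.ne']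
  simp_rw [h1] at h
  rw [h]
  simp [abs_of_pos hr]

theorem two_pow_inv_ne (k : ℕ) : ((2 : ℝ) ^ k)⁻¹ ≠ 0 := by positivity

/-- `φ̂_k` as a Schwartz function. -/
def LPhatS (D : LPData d) : ℕ → 𝓢(RD d, ℂ)
  | 0 => fourierS D.Φ
  | (k+1) => dil ((2 : ℝ) ^ (k+1))⁻¹ (two_pow_inv_ne (k+1)) (fourierS D.φ)

theorem LPhatS_apply (D : LPData d) (k : ℕ) (ξ : RD d) : LPhatS D k ξ = LPhat D k ξ := by
  cases k <;> rfl

theorem invS_LPhatS (D : LPData d) (k : ℕ) (y : RD d) : invS (LPhatS D k) y = LPkernel D k y := by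
  cases k with
  | zero => rw [LPhatS, invS_fourierS]; rfl
  | succ k =>
    rw [LPhatS, invS_dil (by positivity), invS_fourierS, LPkernel, ← pow_mul]

theorem pairing_coe (u : TD d) (ψ : 𝓢(RD d, ℂ)) {g : RD d → ℂ} (h : ⇑ψ = g) :
    _root_.pairing u g = u ψ := by
  have hex : ∃ ψ : 𝓢(RD d, ℂ), ⇑ψ = g := ⟨ψ, h⟩
  unfold _root_.pairing
  rw [dif_pos hex]
  congr 1
  exact DFunLike.coe_injective (hex.choose_spec.trans h.symm)

theorem fourierTD_apply (u : TD d) (ψ : 𝓢(RD d, ℂ)) : fourierTD u ψ = u (fourierS ψ) := rfl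

theorem LPdist_eq (D : LPData d) (k : ℕ) (u : TD d) (x : RD d) :
    LPdist D k u x = fourierTD u (reg_ee.cut (LPhatS D k) x) := by
  rw [fourierTD_apply]
  refine pairing_coe u _ (funext fun y => ?_)
  rw [fourierS_cut_ee, invS_LPhatS]

theorem fourierS_φ_eq_zero (D : LPData d) {ξ : RD d} (h : ‖ξ‖ < 1 / 2 ∨ 2 < ‖ξ‖) :
    fourierS D.φ ξ = 0 := by
  by_contra hne
  have := D.supp_φ ξ hne
  rcases h with h | h <;> linarith

theorem norm_two_pow_inv_smul (k : ℕ) (ξ : RD d) :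
    ‖((2 : ℝ) ^ k)⁻¹ • ξ‖ = ‖ξ‖ / 2 ^ k := by
  rw [norm_smul, norm_inv, norm_pow]
  simp [div_eq_inv_mul]

/-- The low-frequency cutoff `Φ̂`. -/
def Θ (D : LPData d) : 𝓢(RD d, ℂ) := fourierS D.Φ

theorem Θ_eq_one (D : LPData d) {ξ : RD d} (h : ‖ξ‖ < 1) : Θ D ξ = 1 := by
  rw [Θ, D.Φ_def]
  have : ∀ k : ℕ, fourierS D.φ (((2:ℝ)^(k+1))⁻¹ • ξ) = 0 := by
    intro k
    refine fourierS_φ_eq_zero D (Or.inl ?_)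
    rw [norm_two_pow_inv_smul, div_lt_iff₀ (by positivity), pow_succ]
    have : (1 : ℝ) ≤ 2 ^ k := one_le_pow₀ (by norm_num)
    linarith
  simp [this]

theorem Θ_eq_zero (D : LPData d) {ξ : RD d} (h : 2 < ‖ξ‖) : Θ D ξ = 0 := by
  rw [Θ, D.Φ_def]
  have hξ : ξ ≠ 0 := by rintro rfl; simp at h; linarith
  have h1 := D.sum_φ ξ hξ
  have hinj : Function.Injective (fun k : ℕ => ((k + 1 : ℕ) : ℤ)) := by
    intro a b hab; simpa using hab
  have h2 : HasSum (fun k : ℕ => fourierS D.φ ((2:ℝ)^(-((k + 1 : ℕ) : ℤ)) • ξ)) 1 := by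
    refine (hinj.hasSum_iff (f := fun k : ℤ => fourierS D.φ ((2:ℝ)^(-k) • ξ)) ?_).2 h1
    intro k hk
    have hk0 : k ≤ 0 := by
      by_contra hpos
      push Not at hpos
      exact hk ⟨(k - 1).toNat, by simp; omega⟩
    refine fourierS_φ_eq_zero D (Or.inr ?_)
    rw [norm_smul, Real.norm_of_nonneg (by positivity)]
    have : (1 : ℝ) ≤ 2 ^ (-k) := one_le_zpow₀ (by norm_num) (by omega)
    nlinarith [norm_nonneg ξ]
  have h3 : ∀ k : ℕ, fourierS D.φ (((2:ℝ)^(k+1))⁻¹ • ξ)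
      = fourierS D.φ ((2:ℝ)^(-((k + 1 : ℕ) : ℤ)) • ξ) := by
    intro k; rw [zpow_neg, zpow_natCast]
  simp_rw [h3]
  rw [h2.tsum_eq, sub_self]

theorem summable_φ (D : LPData d) (ξ : RD d) :
    Summable (fun k : ℕ => fourierS D.φ (((2:ℝ)^(k+1))⁻¹ • ξ)) := by
  obtain ⟨N, hN⟩ := pow_unbounded_of_one_lt ‖ξ‖ (by norm_num : (1:ℝ) < 2)
  refine summable_of_ne_finset_zero (s := Finset.range N) fun k hk => ?_
  refine fourierS_φ_eq_zero D (Or.inl ?_)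
  rw [norm_two_pow_inv_smul, div_lt_iff₀ (by positivity), pow_succ]
  have : (2:ℝ) ^ N ≤ 2 ^ k := pow_le_pow_right₀ (by norm_num) (by simpa using hk)
  linarith

theorem sum_LPhat (D : LPData d) (N : ℕ) (ξ : RD d) :
    ∑ k ∈ Finset.range (N + 1), LPhat D k ξ = Θ D (((2:ℝ)^N)⁻¹ • ξ) := by
  induction N with
  | zero => simp [LPhat, Θ]
  | succ N ih =>
    rw [Finset.sum_range_succ, ih, Θ, D.Φ_def, D.Φ_def, LPhat]
    have h := (summable_φ D (((2:ℝ)^N)⁻¹ • ξ)).tsum_eq_zero_add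
    rw [h]
    have e1 : ∀ k : ℕ, ((2:ℝ)^(k+1+1))⁻¹ • ((2:ℝ)^N)⁻¹ • ξ
        = ((2:ℝ)^(k+1))⁻¹ • ((2:ℝ)^(N+1))⁻¹ • ξ := by
      intro k
      rw [smul_smul, smul_smul]
      congr 1
      rw [← mul_inv, ← mul_inv]
      ring
    have e2 : ((2:ℝ)^(0+1))⁻¹ • ((2:ℝ)^N)⁻¹ • ξ = ((2:ℝ)^(N+1))⁻¹ • ξ := by
      rw [smul_smul, ← mul_inv]
      congr 2
      ring
    simp_rw [e1, e2]
    ring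

/-- The dilated cutoff `Φ̂(·/r)`. -/
def cutΘ (D : LPData d) (r : ℝ) (hr : r⁻¹ ≠ 0) : 𝓢(RD d, ℂ) := dil r⁻¹ hr (Θ D)

theorem LPhat_support (D : LPData d) (k : ℕ) {ξ : RD d} (h : LPhat D k ξ ≠ 0) :
    ‖ξ‖ ≤ 2 ^ (k + 1) ∧ (1 ≤ k → 2 ^ k / 2 ≤ ‖ξ‖) := by
  cases k with
  | zero =>
    refine ⟨?_, fun h => absurd h (by norm_num)⟩
    by_contra hlt
    push Not at hlt
    exact h (Θ_eq_zero D (by simpa using hlt))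
  | succ k =>
    have := D.supp_φ _ h
    rw [norm_two_pow_inv_smul, le_div_iff₀ (by positivity), div_le_iff₀ (by positivity)] at this
    refine ⟨?_, fun _ => ?_⟩
    · rw [pow_succ _ (k + 1)]; linarith
    · linarith

/-- `∫ c(y,ξ) ψ(y) dy` as a function of `ξ`. -/
def amp (c : RD d → RD d → ℂ) (ψ : 𝓢(RD d, ℂ)) (ξ : RD d) : ℂ := ∫ y, c y ξ * ψ y

theorem Reg.amp_deriv {c : RD d → RD d → ℂ} (h : Reg c) (ψ : 𝓢(RD d, ℂ)) :
    ContDiff ℝ ∞ (amp c ψ) ∧ ∀ l ξ, iteratedFDeriv ℝ l (amp c ψ) ξ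
      = ∫ y, ψ y • iteratedFDeriv ℝ l (c y) ξ := by
  have hFd : ∀ l y ξ, iteratedFDeriv ℝ l (fun ξ => c y ξ * ψ y) ξ
      = ψ y • iteratedFDeriv ℝ l (c y) ξ := by
    intro l y ξ
    have : (fun ξ => c y ξ * ψ y) = (ψ y) • (c y) := by ext ξ; simp [mul_comm]
    rw [this]
    exact iteratedFDeriv_const_smul_apply ((h.smooth_right y).of_le
      (by exact_mod_cast le_top)).contDiffAt
  have key := iteratedFDeriv_integral_of_dominated (μ := (volume : Measure (RD d)))
    (F := fun y ξ => c y ξ * ψ y) (fun y => (h.smooth_right y).mul contDiff_const)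
    (fun l ξ => ?_) (fun l => ?_)
  · refine ⟨key.1, fun l ξ => ?_⟩
    simp_rw [← hFd]
    exact key.2 l ξ
  · simp_rw [hFd]
    refine Continuous.aestronglyMeasurable ?_
    exact ψ.continuous.smul ((continuous_iteratedFDeriv_right h.smooth l).comp
      (by fun_prop : Continuous fun y : RD d => (y, ξ)))
  · obtain ⟨C, M, hC, hb⟩ := h.bound l
    refine ⟨fun y => C * ((1 + ‖y‖) ^ M * ‖ψ y‖),
      (integrable_pow_mul_schwartz M ψ).const_mul C, M, fun y ξ => ?_⟩
    rw [hFd, norm_smul]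
    calc ‖ψ y‖ * ‖iteratedFDeriv ℝ l (c y) ξ‖
        ≤ ‖ψ y‖ * (C * (1 + ‖y‖) ^ M * (1 + ‖ξ‖) ^ M) := by gcongr; exact hb y ξ
      _ = _ := by ring

theorem Reg.norm_amp_deriv_le {c : RD d → RD d → ℂ} (h : Reg c) (ψ : 𝓢(RD d, ℂ)) (l : ℕ)
    (ξ : RD d) : ‖iteratedFDeriv ℝ l (amp c ψ) ξ‖
      ≤ ∫ y, ‖ψ y‖ * ‖iteratedFDeriv ℝ l (c y) ξ‖ := by
  rw [(h.amp_deriv ψ).2 l ξ]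
  refine (norm_integral_le_integral_norm _).trans_eq ?_
  simp_rw [norm_smul]

theorem Reg.integrable_mul {c : RD d → RD d → ℂ} (h : Reg c) (ψ : 𝓢(RD d, ℂ)) (ξ : RD d) :
    Integrable (fun y => c y ξ * ψ y) := by
  obtain ⟨C, M, hC, hb⟩ := h.bound 0
  refine ((integrable_pow_mul_schwartz M ψ).const_mul (C * (1 + ‖ξ‖) ^ M)).mono'
    ((h.smooth.continuous.comp (by fun_prop : Continuous fun y : RD d => (y, ξ))).mul
      ψ.continuous).aestronglyMeasurable (Eventually.of_forall fun y => ?_)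
  have := hb y ξ
  rw [norm_iteratedFDeriv_zero] at this
  rw [norm_mul]
  calc ‖c y ξ‖ * ‖ψ y‖ ≤ (C * (1 + ‖y‖) ^ M * (1 + ‖ξ‖) ^ M) * ‖ψ y‖ := by gcongr
    _ = _ := by ring

/-- The phase-shifted amplitude `b(y,ξ) e^{2πi⟨y-x,ξ⟩}`. -/
def phased (b : RD d → RD d → ℂ) (x y ξ : RD d) : ℂ := b y ξ * ee (y - x) ξ

theorem Reg.phased {b : RD d → RD d → ℂ} (h : Reg b) (x : RD d) : Reg (phased b x) :=
  h.mul (reg_ee.comp_sub x)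

theorem Reg.norm_deriv_phased_le {b : RD d → RD d → ℂ} (h : Reg b) {l : ℕ} {ξ : RD d}
    {B r : ℝ} (x y : RD d) (hb : ∀ j ≤ l, ‖iteratedFDeriv ℝ j (b y) ξ‖ ≤ B * r ^ j) :
    ‖iteratedFDeriv ℝ l (_root_.phased b x y) ξ‖ ≤ B * (r + 2 * Real.pi * ‖y - x‖) ^ l := by
  have h1 := norm_iteratedFDeriv_mul_le (𝕜 := ℝ) (N := ∞) (n := l) (f := b y) (g := ee (y - x))
    (h.smooth_right y) (contDiff_ee_right _) ξ (by exact_mod_cast le_top)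
  refine h1.trans ?_
  rw [add_pow, Finset.mul_sum]
  refine Finset.sum_le_sum fun j hj => ?_
  have hj' : j ≤ l := by rw [Finset.mem_range] at hj; omega
  have h2 := norm_iteratedFDeriv_ee_le (l - j) (y - x) ξ
  calc (l.choose j : ℝ) * ‖iteratedFDeriv ℝ j (b y) ξ‖ * ‖iteratedFDeriv ℝ (l - j) (ee (y - x)) ξ‖
      ≤ (l.choose j : ℝ) * (B * r ^ j) * (2 * Real.pi * ‖y - x‖) ^ (l - j) := by
        have := hb j hj'
        have h0 : 0 ≤ (l.choose j : ℝ) * (B * r ^ j) :=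
          mul_nonneg (by positivity) ((norm_nonneg _).trans this)
        gcongr
    _ = _ := by ring

theorem integrable_pow_sub_mul_schwartz (M : ℕ) (w : 𝓢(RD d, ℂ)) (x : RD d) {r t : ℝ}
    (hr : 0 ≤ r) (ht : 0 ≤ t) :
    Integrable (fun y => (r + t * ‖y - x‖) ^ M * ‖w y‖) := by
  refine ((integrable_pow_mul_schwartz M w).const_mul ((r + t + t * ‖x‖) ^ M)).mono'
    (by have := w.continuous; fun_prop) (Eventually.of_forall fun y => ?_)
  rw [Real.norm_of_nonneg (by positivity), ← mul_assoc, ← mul_pow]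
  gcongr
  have := norm_sub_le y x
  have h1 : t * ‖y - x‖ ≤ t * (‖y‖ + ‖x‖) := by gcongr
  have : 0 ≤ r * ‖y‖ + (t * ‖x‖) * ‖y‖ + t := by positivity
  nlinarith

/-- Pointwise bound for the derivatives of a phased amplitude integral. -/
theorem Reg.norm_deriv_amp_phased_le {b : RD d → RD d → ℂ} (h : Reg b) {l : ℕ} {ξ : RD d}
    {B r : ℝ} (hr : 0 ≤ r) (x : RD d)
    (hb : ∀ j ≤ l, ∀ y, ‖iteratedFDeriv ℝ j (b y) ξ‖ ≤ B * r ^ j) (ψ : 𝓢(RD d, ℂ)) :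
    ‖iteratedFDeriv ℝ l (amp (_root_.phased b x) ψ) ξ‖
      ≤ B * ∫ y, (r + 2 * Real.pi * ‖y - x‖) ^ l * ‖ψ y‖ := by
  refine ((h.phased x).norm_amp_deriv_le ψ l ξ).trans ?_
  rw [← integral_const_mul]
  refine integral_mono_of_nonneg (Eventually.of_forall fun y => by positivity)
    ((integrable_pow_sub_mul_schwartz l ψ x hr (by positivity)).const_mul B)
    (Eventually.of_forall fun y => ?_)
  have := h.norm_deriv_phased_le x y (fun j hj => hb j hj y)
  calc ‖ψ y‖ * ‖iteratedFDeriv ℝ l (_root_.phased b x y) ξ‖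
      ≤ ‖ψ y‖ * (B * (r + 2 * Real.pi * ‖y - x‖) ^ l) := by gcongr
    _ = _ := by ring

theorem integral_pow_mul_le_SN (d M : ℕ) : ∃ (C : ℝ), 0 ≤ C ∧ ∀ ψ : 𝓢(RD d, ℂ),
    ∫ y, (1 + ‖y‖) ^ M * ‖ψ y‖ ≤ C * SN (M + d + 1) ψ := by
  have hInt : Integrable (fun y : RD d => (1 + ‖y‖) ^ (-((d : ℝ) + 1))) :=
    integrable_one_add_norm (by simp)
  refine ⟨2 ^ (M + d + 1) * ∫ y : RD d, (1 + ‖y‖) ^ (-((d : ℝ) + 1)), ?_, fun ψ => ?_⟩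
  · have : 0 ≤ ∫ y : RD d, (1 + ‖y‖) ^ (-((d : ℝ) + 1)) := integral_nonneg fun y => by positivity
    positivity
  · rw [mul_assoc, mul_comm (∫ _, _), ← mul_assoc, ← integral_const_mul]
    refine integral_mono_of_nonneg (Eventually.of_forall fun y => by positivity)
      (hInt.const_mul _) (Eventually.of_forall fun y => ?_)
    have h1 := pow_mul_le_SN (n := M + d + 1) (k := M + d + 1) (l := 0) le_rfl (by omega) ψ y
    rw [norm_iteratedFDeriv_zero] at h1
    have hp : 0 < 1 + ‖y‖ := by positivity
    have h2 : (1 + ‖y‖) ^ (-((d : ℝ) + 1)) = ((1 + ‖y‖) ^ (d + 1))⁻¹ := by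
      rw [Real.rpow_neg hp.le, ← Real.rpow_natCast]; push_cast; rfl
    simp only [h2]
    rw [← div_eq_mul_inv, le_div_iff₀ (by positivity)]
    refine le_trans (le_of_eq ?_) h1
    ring

/-! ### The twisted diagonal condition -/

/-- Hörmander's twisted diagonal condition. -/
def TwistCond (C₀ : ℝ) (a : RD d → RD d → ℂ) : Prop :=
  ∀ ξ : RD d, ∀ ψ : 𝓢(RD d, ℂ),
      tsupport ⇑ψ ⊆ {η : RD d | C₀ * (‖η + ξ‖ + 1) ≤ ‖ξ‖} →
      ∫ x, a x ξ * fourierS ψ x = 0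

theorem invS_cut_ee (ψ : 𝓢(RD d, ℂ)) (ξ η : RD d) :
    invS (reg_ee.cut ψ ξ) η = fourierS ψ (-(η + ξ)) := by
  rw [fourierS_apply, invS_apply]
  refine integral_congr_ae (Eventually.of_forall fun y => ?_)
  simp only [Reg.cut_apply, neg_neg]
  rw [ee_add]
  ring

theorem TwistCond.amp_eq_zero {C₀ : ℝ} (hC₀ : 1 < C₀) {a : RD d → RD d → ℂ} (ha : TwistCond C₀ a)
    {ψ : 𝓢(RD d, ℂ)} {R : ℝ} (hψ : ∀ ζ, R < ‖ζ‖ → fourierS ψ ζ = 0) {ξ : RD d}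
    (hξ : C₀ * (R + 1) ≤ ‖ξ‖) (x : RD d) : amp (phased a x) ψ ξ = 0 := by
  have h := ha ξ (invS (reg_ee.cut ψ ξ)) ?_
  · rw [fourierS_invS] at h
    have : amp (phased a x) ψ ξ = ee (-x) ξ * ∫ y, a y ξ * (reg_ee.cut ψ ξ) y := by
      rw [amp, ← integral_const_mul]
      refine integral_congr_ae (Eventually.of_forall fun y => ?_)
      simp only [Reg.cut_apply, phased]
      rw [sub_eq_add_neg, ee_add, ee_comm ξ y]
      ring
    rw [this, h, mul_zero]
  · refine closure_minimal ?_ (isClosed_le (by fun_prop) (by fun_prop))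
    intro η hη
    rw [Function.mem_support, invS_cut_ee] at hη
    have : ‖η + ξ‖ ≤ R := by
      by_contra hlt
      push Not at hlt
      exact hη (hψ _ (by rwa [norm_neg]))
    refine le_trans ?_ hξ
    have : 0 ≤ C₀ := by linarith
    gcongr

/-- Pointwise product of Schwartz functions. -/
def mulS (g ψ : 𝓢(RD d, ℂ)) : 𝓢(RD d, ℂ) := SchwartzMap.smulLeftCLM ℂ g ψ

theorem mulS_apply (g ψ : 𝓢(RD d, ℂ)) (ξ : RD d) : mulS g ψ ξ = g ξ * ψ ξ := by
  rw [mulS, SchwartzMap.smulLeftCLM_apply_apply g.hasTemperateGrowth, smul_eq_mul]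

theorem pow_mul_deriv_mulS_le {n p l : ℕ} (hp : p ≤ n) (hl : l ≤ n) {g : 𝓢(RD d, ℂ)} {K : ℝ}
    {ξ : RD d} (hg : ∀ j ≤ l, ‖iteratedFDeriv ℝ j g ξ‖ ≤ K) (ψ : 𝓢(RD d, ℂ)) :
    (1 + ‖ξ‖) ^ p * ‖iteratedFDeriv ℝ l (mulS g ψ) ξ‖ ≤ 4 ^ n * K * SN n ψ := by
  have e : (mulS g ψ : RD d → ℂ) = fun ξ => g ξ * ψ ξ := funext (mulS_apply g ψ)
  have h1 := norm_iteratedFDeriv_mul_le (𝕜 := ℝ) (N := ∞) (n := l) (f := g) (g := ψ)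
    (g.smooth ⊤) (ψ.smooth ⊤) ξ (by exact_mod_cast le_top)
  have hK : 0 ≤ K := (norm_nonneg _).trans (hg 0 (Nat.zero_le _))
  have hS := SN_nonneg n ψ
  rw [e]
  calc _ ≤ (1 + ‖ξ‖) ^ p * ∑ i ∈ Finset.range (l + 1), (l.choose i : ℝ) *
        ‖iteratedFDeriv ℝ i g ξ‖ * ‖iteratedFDeriv ℝ (l - i) ψ ξ‖ := by gcongr
    _ ≤ ∑ i ∈ Finset.range (l + 1), (l.choose i : ℝ) * (K * (2 ^ n * SN n ψ)) := by
        rw [Finset.mul_sum]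
        refine Finset.sum_le_sum fun i hi => ?_
        rw [Finset.mem_range] at hi
        have a1 := hg i (by omega)
        have a2 := pow_mul_le_SN hp (by omega : l - i ≤ n) ψ ξ
        calc _ = (l.choose i : ℝ) * (‖iteratedFDeriv ℝ i g ξ‖ *
              ((1 + ‖ξ‖) ^ p * ‖iteratedFDeriv ℝ (l - i) ψ ξ‖)) := by ring
          _ ≤ _ := by gcongr
    _ = 2 ^ l * (K * (2 ^ n * SN n ψ)) := by
        rw [← Finset.sum_mul]
        congr 1
        exact_mod_cast Nat.sum_range_choose l
    _ ≤ 2 ^ n * (K * (2 ^ n * SN n ψ)) := by gcongr; norm_num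
    _ = _ := by
        rw [show (4:ℝ) ^ n = 2 ^ n * 2 ^ n by rw [← mul_pow]; norm_num]; ring

theorem norm_deriv_dil (r : ℝ) (hr : r ≠ 0) (ψ : 𝓢(RD d, ℂ)) (l : ℕ) (ξ : RD d) :
    ‖iteratedFDeriv ℝ l (dil r hr ψ) ξ‖ = |r| ^ l * ‖iteratedFDeriv ℝ l ψ (r • ξ)‖ := by
  have e : (dil r hr ψ : RD d → ℂ) = fun ξ => ψ (r • ξ) := rfl
  rw [e, iteratedFDeriv_comp_const_smul r (ψ.smooth l), norm_smul, norm_pow, Real.norm_eq_abs]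

theorem norm_deriv_dil_le {r : ℝ} (hr : r ≠ 0) (h1 : |r| ≤ 1) (ψ : 𝓢(RD d, ℂ)) {l n : ℕ}
    (hl : l ≤ n) (ξ : RD d) : ‖iteratedFDeriv ℝ l (dil r hr ψ) ξ‖ ≤ 2 ^ n * SN n ψ := by
  rw [norm_deriv_dil]
  have h2 := pow_mul_le_SN (k := 0) (Nat.zero_le n) hl ψ (r • ξ)
  rw [pow_zero, one_mul] at h2
  calc _ ≤ 1 * ‖iteratedFDeriv ℝ l ψ (r • ξ)‖ := by
        gcongr; exact pow_le_one₀ (abs_nonneg r) h1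
    _ ≤ _ := by rwa [one_mul]

theorem cutΘ_apply (D : LPData d) {R : ℝ} (hR : R⁻¹ ≠ 0) (ξ : RD d) :
    cutΘ D R hR ξ = Θ D (R⁻¹ • ξ) := rfl

theorem norm_inv_smul' {R : ℝ} (hR : 0 < R) (ξ : RD d) : ‖R⁻¹ • ξ‖ = ‖ξ‖ / R := by
  rw [norm_smul, norm_inv, Real.norm_of_nonneg hR.le, div_eq_inv_mul]

theorem cutΘ_eq_one (D : LPData d) {R : ℝ} (hR : 0 < R) (hR' : R⁻¹ ≠ 0) {ξ : RD d}
    (h : ‖ξ‖ < R) : cutΘ D R hR' ξ = 1 := by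
  rw [cutΘ_apply]
  refine Θ_eq_one D ?_
  rwa [norm_inv_smul' hR, div_lt_one hR]

theorem cutΘ_eq_zero (D : LPData d) {R : ℝ} (hR : 0 < R) (hR' : R⁻¹ ≠ 0) {ξ : RD d}
    (h : 2 * R < ‖ξ‖) : cutΘ D R hR' ξ = 0 := by
  rw [cutΘ_apply]
  refine Θ_eq_zero D ?_
  rwa [norm_inv_smul' hR, lt_div_iff₀ hR]

theorem iteratedFDeriv_eq_zero_of_eventually {F : RD d → ℂ} {ξ : RD d}
    (h : ∀ᶠ η in nhds ξ, F η = 0) (l : ℕ) : iteratedFDeriv ℝ l F ξ = 0 := by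
  have h1 : F =ᶠ[nhds ξ] (fun _ => (0 : ℂ)) := h
  have := (h1.iteratedFDeriv ℝ l).self_of_nhds
  rw [this]
  have := congrFun (iteratedFDeriv_fun_zero (𝕜 := ℝ) (E := RD d) (F := ℂ) (n := l)) ξ
  exact this

/-- Removing low frequencies gains decay in the cutoff radius. -/
theorem SN_tail (D : LPData d) (n L : ℕ) : ∃ C : ℝ, 0 ≤ C ∧ ∀ (R : ℝ) (_ : 1 ≤ R)
    (hR' : R⁻¹ ≠ 0) (ψ : 𝓢(RD d, ℂ)),
    SN n (ψ - mulS (cutΘ D R hR') ψ) ≤ C * (R ^ L)⁻¹ * SN (n + L) ψ := by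
  refine ⟨2 ^ (n + L) + 4 ^ (n + L) * (2 ^ n * SN n (Θ D)), ?_, fun R hR hR' ψ => ?_⟩
  · have := SN_nonneg n (Θ D); positivity
  have hS := SN_nonneg (n + L) ψ
  have hT := SN_nonneg n (Θ D)
  have hRpos : 0 < R := by linarith
  refine SN_le (by positivity) fun l hl ξ => ?_
  rcases lt_or_ge ‖ξ‖ R with hξ | hξ
  · rw [iteratedFDeriv_eq_zero_of_eventually]
    · simp only [norm_zero, mul_zero]; positivity
    · filter_upwards [(isOpen_lt continuous_norm continuous_const).mem_nhds hξ] with η hη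
      rw [sub_apply, mulS_apply, cutΘ_eq_one D hRpos hR' hη]
      ring
  · have e : iteratedFDeriv ℝ l (ψ - mulS (cutΘ D R hR') ψ : 𝓢(RD d, ℂ)) ξ
        = iteratedFDeriv ℝ l ψ ξ - iteratedFDeriv ℝ l (mulS (cutΘ D R hR') ψ) ξ := by
      have := iteratedFDeriv_sub_apply (𝕜 := ℝ) (i := l) (x := ξ) (f := (ψ : RD d → ℂ))
        (g := mulS (cutΘ D R hR') ψ) (ψ.smooth l).contDiffAt
        ((mulS (cutΘ D R hR') ψ).smooth l).contDiffAt
      exact this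
    have a1 := pow_mul_le_SN (n := n + L) (k := n + L) le_rfl (by omega : l ≤ n + L) ψ ξ
    have a2 := pow_mul_deriv_mulS_le (n := n + L) (p := n + L) le_rfl (by omega : l ≤ n + L)
      (g := cutΘ D R hR') (K := 2 ^ n * SN n (Θ D)) (ξ := ξ)
      (fun j hj => norm_deriv_dil_le hR' (by
        rw [abs_of_pos (by positivity)]; exact inv_le_one_of_one_le₀ hR) (Θ D) (by omega) ξ) ψ
    have a3 : (R : ℝ) ^ L ≤ (1 + ‖ξ‖) ^ L := by gcongr; linarith
    rw [e]
    have a4 : (1 + ‖ξ‖) ^ n ≤ (R ^ L)⁻¹ * (1 + ‖ξ‖) ^ (n + L) := by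
      rw [← div_eq_inv_mul, le_div_iff₀ (by positivity), pow_add]
      gcongr
    calc _ ≤ ((R ^ L)⁻¹ * (1 + ‖ξ‖) ^ (n + L)) * (‖iteratedFDeriv ℝ l ψ ξ‖
          + ‖iteratedFDeriv ℝ l (mulS (cutΘ D R hR') ψ) ξ‖) := by
          gcongr; exact norm_sub_le _ _
      _ = (R ^ L)⁻¹ * ((1 + ‖ξ‖) ^ (n + L) * ‖iteratedFDeriv ℝ l ψ ξ‖
          + (1 + ‖ξ‖) ^ (n + L) * ‖iteratedFDeriv ℝ l (mulS (cutΘ D R hR') ψ) ξ‖) := by ring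
      _ ≤ (R ^ L)⁻¹ * (2 ^ (n + L) * SN (n + L) ψ
          + 4 ^ (n + L) * (2 ^ n * SN n (Θ D)) * SN (n + L) ψ) := by gcongr
      _ = _ := by ring

/-- The inverse Fourier transform as a continuous linear map. -/
def invL : 𝓢(RD d, ℂ) →L[ℂ] 𝓢(RD d, ℂ) := FourierTransform.fourierInvCLM ℂ 𝓢(RD d, ℂ)

/-- The Fourier transform as a continuous linear map. -/
def fouL : 𝓢(RD d, ℂ) →L[ℂ] 𝓢(RD d, ℂ) := SchwartzMap.fourierTransformCLM ℂ

theorem invL_apply (ψ : 𝓢(RD d, ℂ)) : invL ψ = invS ψ := rfl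
theorem fouL_apply (ψ : 𝓢(RD d, ℂ)) : fouL ψ = fourierS ψ := rfl

/-- The low-frequency part of a Schwartz function. -/
def lowS (D : LPData d) (R : ℝ) (hR : R⁻¹ ≠ 0) (ψ : 𝓢(RD d, ℂ)) : 𝓢(RD d, ℂ) :=
  invS (mulS (cutΘ D R hR) (fourierS ψ))

theorem SN_sub_lowS (D : LPData d) (n L : ℕ) : ∃ (n' : ℕ) (C : ℝ), 0 ≤ C ∧
    ∀ (R : ℝ) (_ : 1 ≤ R) (hR' : R⁻¹ ≠ 0) (ψ : 𝓢(RD d, ℂ)),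
    SN n (ψ - lowS D R hR' ψ) ≤ C * (R ^ L)⁻¹ * SN n' ψ := by
  obtain ⟨n1, C1, hC1, h1⟩ := clm_SN_le (d := d) invL n
  obtain ⟨C2, hC2, h2⟩ := SN_tail D n1 L
  obtain ⟨n3, C3, hC3, h3⟩ := clm_SN_le (d := d) fouL (n1 + L)
  refine ⟨n3, C1 * C2 * C3, by positivity, fun R hR hR' ψ => ?_⟩
  have e : ψ - lowS D R hR' ψ = invL (fourierS ψ - mulS (cutΘ D R hR') (fourierS ψ)) := by
    rw [map_sub, invL_apply, invL_apply, invS_fourierS, lowS]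
  have hRpos : 0 < R := by linarith
  rw [e]
  calc _ ≤ C1 * SN n1 (fourierS ψ - mulS (cutΘ D R hR') (fourierS ψ)) := h1 _
    _ ≤ C1 * (C2 * (R ^ L)⁻¹ * SN (n1 + L) (fourierS ψ)) := by
        gcongr; exact h2 R hR hR' _
    _ ≤ C1 * (C2 * (R ^ L)⁻¹ * (C3 * SN n3 ψ)) := by
        gcongr; exact h3 ψ
    _ = _ := by ring

/-- Uniform-in-`y` polynomial bounds on the `ξ`-derivatives of an amplitude. -/
structure UReg (a : RD d → RD d → ℂ) : Prop where
  smooth : ContDiff ℝ ∞ (fun p : RD d × RD d => a p.1 p.2)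
  bound : ∃ M : ℕ, ∀ l : ℕ, ∃ C : ℝ, 0 ≤ C ∧ ∀ y ξ,
    ‖iteratedFDeriv ℝ l (a y) ξ‖ ≤ C * (1 + ‖ξ‖) ^ M

theorem UReg.reg {a : RD d → RD d → ℂ} (h : UReg a) : Reg a := by
  refine ⟨h.smooth, fun l => ?_⟩
  obtain ⟨M, hM⟩ := h.bound
  obtain ⟨C, hC, hb⟩ := hM l
  refine ⟨C, M, hC, fun y ξ => (hb y ξ).trans ?_⟩
  have : 1 ≤ (1 + ‖y‖) ^ M := one_le_pow₀ (one_le_one_add_norm y)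
  calc C * (1 + ‖ξ‖) ^ M = C * 1 * (1 + ‖ξ‖) ^ M := by ring
    _ ≤ _ := by gcongr

/-- The transposed amplitude transform `ψ ↦ ∫ a(y,ξ) e^{2πi⟨y,ξ⟩} ψ(y) dy`. -/
def Gf (a : RD d → RD d → ℂ) (ψ : 𝓢(RD d, ℂ)) : RD d → ℂ := amp (phased a 0) ψ

theorem UReg.deriv_Gf_le {a : RD d → RD d → ℂ} (h : UReg a) (l : ℕ) : ∃ (M n : ℕ) (C : ℝ), 0 ≤ C ∧
    ∀ (ψ : 𝓢(RD d, ℂ)) ξ, ‖iteratedFDeriv ℝ l (Gf a ψ) ξ‖ ≤ C * (1 + ‖ξ‖) ^ M * SN n ψ := by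
  obtain ⟨M, hM⟩ := h.bound
  choose Ca hCa hba using hM
  obtain ⟨C1, hC1, h1⟩ := integral_pow_mul_le_SN d l
  set S := ∑ j ∈ Finset.range (l + 1), Ca j with hS
  have hS0 : 0 ≤ S := Finset.sum_nonneg fun j _ => hCa j
  refine ⟨M, l + d + 1, S * ((2 * Real.pi) ^ l * C1), by positivity, fun ψ ξ => ?_⟩
  have h2 := h.reg.norm_deriv_amp_phased_le (l := l) (ξ := ξ) (B := S * (1 + ‖ξ‖) ^ M) (r := 1)
    zero_le_one 0 (fun j hj y => by
      rw [one_pow, mul_one]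
      refine (hba j y ξ).trans ?_
      have : Ca j ≤ S := Finset.single_le_sum (f := Ca) (fun j _ => hCa j)
        (Finset.mem_range.2 (by omega))
      gcongr) ψ
  refine h2.trans ?_
  have h3 : ∫ y, (1 + 2 * Real.pi * ‖y - 0‖) ^ l * ‖ψ y‖
      ≤ (2 * Real.pi) ^ l * ∫ y, (1 + ‖y‖) ^ l * ‖ψ y‖ := by
    rw [← integral_const_mul]
    refine integral_mono_of_nonneg (Eventually.of_forall fun y => by positivity)
      ((integrable_pow_mul_schwartz l ψ).const_mul _) (Eventually.of_forall fun y => ?_)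
    simp only [sub_zero]
    rw [← mul_assoc, ← mul_pow]
    have := Real.pi_gt_three
    gcongr
    nlinarith
  calc _ ≤ S * (1 + ‖ξ‖) ^ M * ((2 * Real.pi) ^ l * (C1 * SN (l + d + 1) ψ)) := by
        gcongr
        refine h3.trans ?_
        gcongr
        exact h1 ψ
    _ = _ := by ring

theorem Gf_sub {a : RD d → RD d → ℂ} (h : UReg a) (ψ χ : 𝓢(RD d, ℂ)) (ξ : RD d) :
    Gf a (ψ - χ) ξ = Gf a ψ ξ - Gf a χ ξ := by
  have i1 := (h.reg.phased 0).integrable_mul ψ ξ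
  have i2 := (h.reg.phased 0).integrable_mul χ ξ
  rw [Gf, Gf, Gf, amp, amp, amp, ← integral_sub i1 i2]
  simp only [sub_apply, mul_sub]

theorem TwistCond.Gf_sub_lowS_eventually {C₀ : ℝ} (hC₀ : 1 < C₀) {a : RD d → RD d → ℂ}
    (ht : TwistCond C₀ a) (h : UReg a) (D : LPData d) {R : ℝ} (hR : 1 ≤ R) (hR' : R⁻¹ ≠ 0)
    {ξ : RD d} (hξ : 4 * C₀ * R ≤ ‖ξ‖) (ψ : 𝓢(RD d, ℂ)) :
    Gf a ψ =ᶠ[nhds ξ] Gf a (ψ - lowS D R hR' ψ) := by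
  have hlt : C₀ * (2 * R + 1) < ‖ξ‖ := by nlinarith
  filter_upwards [(isOpen_lt continuous_const continuous_norm).mem_nhds hlt] with η hη
  rw [Gf_sub h]
  have : Gf a (lowS D R hR' ψ) η = 0 := by
    refine ht.amp_eq_zero hC₀ (R := 2 * R) (fun ζ hζ => ?_) (le_of_lt hη) 0
    rw [lowS, fourierS_invS, mulS_apply, cutΘ_eq_zero D (by linarith) hR' hζ, zero_mul]
  rw [this, sub_zero]

theorem TwistCond.pow_mul_deriv_Gf_le {C₀ : ℝ} (hC₀ : 1 < C₀) {a : RD d → RD d → ℂ}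
    (ht : TwistCond C₀ a) (h : UReg a) (D : LPData d) (p l : ℕ) : ∃ (n : ℕ) (C : ℝ), 0 ≤ C ∧
    ∀ (ψ : 𝓢(RD d, ℂ)) ξ,
      (1 + ‖ξ‖) ^ p * ‖iteratedFDeriv ℝ l (Gf a ψ) ξ‖ ≤ C * SN n ψ := by
  obtain ⟨M, n1, C1, hC1, h1⟩ := h.deriv_Gf_le l
  obtain ⟨n2, C2, hC2, h2⟩ := SN_sub_lowS D n1 (p + M)
  refine ⟨n1 + n2, C1 * (1 + 4 * C₀) ^ (p + M) + C1 * C2 * (8 * C₀) ^ (p + M), by positivity,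
    fun ψ ξ => ?_⟩
  have s1 := SN_mono (by omega : n1 ≤ n1 + n2) ψ
  have s2 := SN_mono (by omega : n2 ≤ n1 + n2) ψ
  have s10 := SN_nonneg n1 ψ
  have s20 := SN_nonneg n2 ψ
  have s30 := SN_nonneg (n1 + n2) ψ
  rw [add_mul]
  rcases le_or_gt ‖ξ‖ (4 * C₀) with hξ | hξ
  · refine le_add_of_le_of_nonneg ?_ (by positivity)
    calc _ ≤ (1 + ‖ξ‖) ^ p * (C1 * (1 + ‖ξ‖) ^ M * SN n1 ψ) := by gcongr; exact h1 ψ ξ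
      _ = C1 * (1 + ‖ξ‖) ^ (p + M) * SN n1 ψ := by ring
      _ ≤ _ := by gcongr
  · refine le_add_of_nonneg_of_le (by positivity) ?_
    set R := ‖ξ‖ / (4 * C₀) with hRdef
    have hR : 1 ≤ R := by rw [hRdef, le_div_iff₀ (by positivity)]; linarith
    have hR' : R⁻¹ ≠ 0 := by positivity
    have hRξ : 4 * C₀ * R = ‖ξ‖ := by rw [hRdef]; field_simp
    have ev := ht.Gf_sub_lowS_eventually hC₀ h D hR hR' hRξ.le ψ
    rw [(ev.iteratedFDeriv ℝ l).self_of_nhds]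
    have hle : 1 + ‖ξ‖ ≤ 8 * C₀ * R := by nlinarith
    calc _ ≤ (1 + ‖ξ‖) ^ p * (C1 * (1 + ‖ξ‖) ^ M * (C2 * (R ^ (p + M))⁻¹ * SN n2 ψ)) := by
          gcongr
          refine (h1 _ ξ).trans ?_
          gcongr
          exact h2 R hR hR' ψ
      _ = C1 * C2 * ((1 + ‖ξ‖) ^ (p + M) * (R ^ (p + M))⁻¹) * SN n2 ψ := by ring
      _ ≤ C1 * C2 * (8 * C₀) ^ (p + M) * SN (n1 + n2) ψ := by
          gcongr
          rw [← div_eq_mul_inv, div_le_iff₀ (by positivity), ← mul_pow]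
          gcongr

/-- The amplitude transform as a continuous linear map on Schwartz functions. -/
theorem TwistCond.exists_GL {C₀ : ℝ} (hC₀ : 1 < C₀) {a : RD d → RD d → ℂ}
    (ht : TwistCond C₀ a) (h : UReg a) (D : LPData d) :
    ∃ G : 𝓢(RD d, ℂ) →L[ℂ] 𝓢(RD d, ℂ), ∀ ψ ξ, G ψ ξ = Gf a ψ ξ := by
  refine ⟨SchwartzMap.mkCLM (Gf a) (fun ψ χ ξ => ?_) (fun c ψ ξ => ?_)
    (fun ψ => ((h.reg.phased 0).amp_deriv ψ).1) (fun n => ?_), fun ψ ξ => rfl⟩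
  · have i1 := (h.reg.phased 0).integrable_mul ψ ξ
    have i2 := (h.reg.phased 0).integrable_mul χ ξ
    rw [Gf, Gf, Gf, amp, amp, amp, ← integral_add i1 i2]
    simp only [add_apply, mul_add]
  · rw [Gf, Gf, amp, amp, ← integral_smul]
    refine integral_congr_ae (Eventually.of_forall fun y => ?_)
    simp only [smul_apply, smul_eq_mul, RingHom.id_apply]
    ring
  · obtain ⟨k, C, hC, hb⟩ := ht.pow_mul_deriv_Gf_le hC₀ h D n.1 n.2
    refine ⟨Finset.Iic (k, k), C, hC, fun ψ ξ => le_trans ?_ (hb ψ ξ)⟩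
    gcongr
    linarith

theorem continuous_SN (n : ℕ) : Continuous (SN (d := d) n) :=
  (schwartz_withSeminorms ℂ (RD d) ℂ).finset_sups.continuous_seminorm (Finset.Iic (n, n))

theorem SN_zero (n : ℕ) : SN n (0 : 𝓢(RD d, ℂ)) = 0 := map_zero _

theorem Reg.cut_sub {c : RD d → RD d → ℂ} (h : Reg c) (κ κ' : 𝓢(RD d, ℂ)) (y : RD d) :
    h.cut (κ - κ') y = h.cut κ y - h.cut κ' y := map_sub _ _ _

theorem Reg.tendsto_cut_zero {ι : Type*} {f : Filter ι} {c : RD d → RD d → ℂ} (h : Reg c)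
    {g : ι → 𝓢(RD d, ℂ)} {z : ι → RD d} {z₀ : RD d} (hz : Tendsto z f (nhds z₀))
    (hg : ∀ n, Tendsto (fun i => SN n (g i)) f (nhds 0)) :
    Tendsto (fun i => h.cut (g i) (z i)) f (nhds 0) := by
  refine tendsto_schwartz_of_SN fun n => ?_
  simp only [sub_zero]
  obtain ⟨C, M, n', hC, hb⟩ := h.SN_cut_le n
  refine squeeze_zero (fun i => SN_nonneg n _) (fun i => hb (g i) (z i)) ?_
  have h1 : Tendsto (fun i => C * SN n' (g i) * (1 + ‖z i‖) ^ M) f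
      (nhds (C * 0 * (1 + ‖z₀‖) ^ M)) :=
    ((hg n').const_mul C).mul ((hz.norm.const_add 1).pow M)
  simpa using h1

theorem Reg.tendsto_cut {ι : Type*} {f : Filter ι} {c : RD d → RD d → ℂ} (h : Reg c)
    {g : ι → 𝓢(RD d, ℂ)} {g₀ : 𝓢(RD d, ℂ)} {z : ι → RD d} {z₀ : RD d}
    (hz : Tendsto z f (nhds z₀)) (hg : Tendsto g f (nhds g₀)) :
    Tendsto (fun i => h.cut (g i) (z i)) f (nhds (h.cut g₀ z₀)) := by
  have h1 : Tendsto (fun i => h.cut (g i - g₀) (z i)) f (nhds 0) := by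
    refine h.tendsto_cut_zero hz fun n => ?_
    have h2 : Tendsto (fun i => g i - g₀) f (nhds 0) := by
      simpa using hg.sub_const g₀
    have h4 := ((continuous_SN n).tendsto 0).comp h2
    rw [SN_zero] at h4
    exact h4
  have h3 := h1.add (((h.continuous_cut g₀).tendsto z₀).comp hz)
  rw [zero_add] at h3
  refine h3.congr fun i => ?_
  simp [Reg.cut_sub]

theorem PolyFam.cut {c : RD d → RD d → ℂ} (h : Reg c) {g : RD d → 𝓢(RD d, ℂ)} (hg : PolyFam g) :
    PolyFam (fun z => h.cut (g z) z) := by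
  refine ⟨continuous_iff_continuousAt.2 fun z₀ =>
    h.tendsto_cut tendsto_id hg.cont.continuousAt, fun n => ?_⟩
  obtain ⟨C, M, n', hC, hb⟩ := h.SN_cut_le n
  obtain ⟨C', M', hC', hb'⟩ := hg.growth n'
  refine ⟨C * C', M' + M, by positivity, fun z => (hb _ z).trans ?_⟩
  calc C * SN n' (g z) * (1 + ‖z‖) ^ M ≤ C * (C' * (1 + ‖z‖) ^ M') * (1 + ‖z‖) ^ M := by
        gcongr; exact hb' z
    _ = _ := by ring

theorem PolyFam.clm (T : 𝓢(RD d, ℂ) →L[ℂ] 𝓢(RD d, ℂ)) {g : RD d → 𝓢(RD d, ℂ)} (hg : PolyFam g) :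
    PolyFam (fun z => T (g z)) := by
  refine ⟨T.continuous.comp hg.cont, fun n => ?_⟩
  obtain ⟨n', C, hC, hb⟩ := clm_SN_le T n
  obtain ⟨C', M', hC', hb'⟩ := hg.growth n'
  refine ⟨C * C', M', by positivity, fun z => (hb _).trans ?_⟩
  rw [mul_assoc]
  gcongr
  exact hb' z

/-- Translation `ψ(· + z)`. -/
def trS (ψ : 𝓢(RD d, ℂ)) (z : RD d) : 𝓢(RD d, ℂ) := invL (reg_ee.cut (fourierS ψ) z)

theorem trS_apply (ψ : 𝓢(RD d, ℂ)) (z y : RD d) : trS ψ z y = ψ (y + z) := by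
  rw [trS, invL_apply, invS_apply]
  conv_rhs => rw [← invS_fourierS ψ, invS_apply]
  refine integral_congr_ae (Eventually.of_forall fun ξ => ?_)
  simp only [Reg.cut_apply]
  rw [ee_add]
  ring

theorem trS_zero (ψ : 𝓢(RD d, ℂ)) : trS ψ 0 = ψ := by
  ext y; rw [trS_apply, add_zero]

theorem polyFam_trS (ψ : 𝓢(RD d, ℂ)) : PolyFam (trS ψ) := (reg_ee.polyFam_cut (fourierS ψ)).clm invL

/-- `ξ ↦ a(x-z,ξ) e^{2πi⟨x,ξ⟩} κ(ξ)`. -/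
def Reg.cut2 {a : RD d → RD d → ℂ} (h : Reg a) (κ : 𝓢(RD d, ℂ)) (x z : RD d) : 𝓢(RD d, ℂ) :=
  h.cut (reg_ee.cut κ x) (x - z)

theorem Reg.cut2_apply {a : RD d → RD d → ℂ} (h : Reg a) (κ : 𝓢(RD d, ℂ)) (x z ξ : RD d) :
    h.cut2 κ x z ξ = a (x - z) ξ * (ee x ξ * κ ξ) := by
  rw [Reg.cut2, Reg.cut_apply, Reg.cut_apply]

theorem Reg.cut2_sum {a : RD d → RD d → ℂ} (h : Reg a) {ι : Type*} (s : Finset ι)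
    (κ : ι → 𝓢(RD d, ℂ)) (x z : RD d) :
    h.cut2 (∑ i ∈ s, κ i) x z = ∑ i ∈ s, h.cut2 (κ i) x z := by
  simp only [Reg.cut2, Reg.cut, map_sum]

theorem Reg.polyFam_cut2_right {a : RD d → RD d → ℂ} (h : Reg a) (κ : 𝓢(RD d, ℂ)) (x : RD d) :
    PolyFam (h.cut2 κ x) :=
  (h.comp_neg_sub x).polyFam_cut (reg_ee.cut κ x)

theorem Reg.polyFam_cut2_left {a : RD d → RD d → ℂ} (h : Reg a) (κ : 𝓢(RD d, ℂ)) (z : RD d) :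
    PolyFam (fun x => h.cut2 κ x z) :=
  (reg_ee.polyFam_cut κ).cut (h.comp_sub z)

theorem Reg.dist_cut2_le {a : RD d → RD d → ℂ} (h : Reg a) (κ : 𝓢(RD d, ℂ)) (v : TD d) :
    ∃ (C : ℝ) (M : ℕ), 0 ≤ C ∧ ∀ x z,
      ‖v (h.cut2 κ x z)‖ ≤ C * (1 + ‖x‖) ^ M * (1 + ‖z‖) ^ M := by
  obtain ⟨n, C, hC, hv⟩ := dist_le_SN v
  obtain ⟨C1, M1, n1, hC1, h1⟩ := h.SN_cut_le n
  obtain ⟨C2, M2, n2, hC2, h2⟩ := (reg_ee (d := d)).SN_cut_le n1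
  have hS := SN_nonneg n2 κ
  refine ⟨C * C1 * C2 * SN n2 κ, M1 + M2, by positivity, fun x z => (hv _).trans ?_⟩
  have hx := one_le_one_add_norm x
  have hz := one_le_one_add_norm z
  have hxz : 1 + ‖x - z‖ ≤ (1 + ‖x‖) * (1 + ‖z‖) := by
    have := norm_sub_le x z
    nlinarith [norm_nonneg x, norm_nonneg z]
  calc _ ≤ C * (C1 * (C2 * SN n2 κ * (1 + ‖x‖) ^ M2) * (1 + ‖x - z‖) ^ M1) := by
        gcongr
        refine (h1 _ _).trans ?_
        gcongr
        exact h2 κ x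
    _ ≤ C * (C1 * (C2 * SN n2 κ * (1 + ‖x‖) ^ M2) * ((1 + ‖x‖) * (1 + ‖z‖)) ^ M1) := by gcongr
    _ = C * C1 * C2 * SN n2 κ * (1 + ‖x‖) ^ (M1 + M2) * (1 + ‖z‖) ^ M1 := by
        rw [mul_pow]; ring
    _ ≤ _ := by gcongr; omega

theorem Reg.integrable_cut2 {a : RD d → RD d → ℂ} (h : Reg a) (κ : 𝓢(RD d, ℂ)) (v : TD d)
    (w ψ : 𝓢(RD d, ℂ)) : Integrable (Function.uncurry fun x z =>
      v (h.cut2 κ x z) * w z * ψ x) ((volume : Measure (RD d)).prod volume) := by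
  obtain ⟨C, M, hC, hb⟩ := h.dist_cut2_le κ v
  have hmeas : StronglyMeasurable (Function.uncurry fun x z => v (h.cut2 κ x z)) :=
    stronglyMeasurable_uncurry_of_continuous_of_stronglyMeasurable
      (fun z => v.continuous.comp (h.polyFam_cut2_left κ z).cont)
      (fun x => (v.continuous.comp (h.polyFam_cut2_right κ x).cont).stronglyMeasurable)
  have hi := ((integrable_pow_mul_schwartz M ψ).mul_prod (integrable_pow_mul_schwartz M w)).const_mul C
  refine hi.mono' ?_ (Eventually.of_forall ?_)
  · have hw : Continuous fun p : RD d × RD d => w p.2 := w.continuous.comp continuous_snd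
    have hψ : Continuous fun p : RD d × RD d => ψ p.1 := ψ.continuous.comp continuous_fst
    exact ((hmeas.mul hw.stronglyMeasurable).mul hψ.stronglyMeasurable).aestronglyMeasurable
  · rintro ⟨x, z⟩
    simp only [Function.uncurry, norm_mul]
    calc _ ≤ (C * (1 + ‖x‖) ^ M * (1 + ‖z‖) ^ M) * ‖w z‖ * ‖ψ x‖ := by gcongr; exact hb x z
      _ = _ := by ring

theorem Reg.pdoPieceD_eq {a : RD d → RD d → ℂ} (h : Reg a) (D : LPData d) (u : TD d) (j k : ℕ)
    (x : RD d) : pdoPieceD D a j k u x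
      = ∫ z, fourierTD u (h.cut2 (LPhatS D k) x z) * invS (LPhatS D j) z := by
  obtain ⟨Ψ, h1, h2⟩ := (h.polyFam_cut2_right (LPhatS D k) x).exists_integral (invS (LPhatS D j))
  rw [← h2]
  refine pairing_coe _ Ψ (funext fun ξ => ?_)
  rw [h1, symbolPiece, ← integral_mul_const, ← integral_mul_const]
  refine integral_congr_ae (Eventually.of_forall fun z => ?_)
  simp only [Reg.cut2_apply, invS_LPhatS, LPhatS_apply, ee]
  ring

theorem sum_LPhatS (D : LPData d) (N : ℕ) : ∑ k ∈ Finset.range (N + 1), LPhatS D k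
    = cutΘ D (2 ^ N) (two_pow_inv_ne N) := by
  ext ξ
  rw [cutΘ_apply, ← sum_LPhat, sum_apply]
  exact Finset.sum_congr rfl fun k _ => LPhatS_apply D k ξ

theorem Reg.pdoPartial_eq {a : RD d → RD d → ℂ} (h : Reg a) (D : LPData d) (u : TD d) (N : ℕ)
    (x : RD d) : pdoPartial D a N u x
      = ∫ z, fourierTD u (h.cut2 (cutΘ D (2 ^ N) (two_pow_inv_ne N)) x z)
        * invS (cutΘ D (2 ^ N) (two_pow_inv_ne N)) z := by
  have hi : ∀ j k, Integrable fun z =>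
      fourierTD u (h.cut2 (LPhatS D k) x z) * invS (LPhatS D j) z := fun j k =>
    (h.polyFam_cut2_right _ x).integrable_dist _ _
  rw [pdoPartial]
  simp_rw [h.pdoPieceD_eq D u]
  rw [← sum_LPhatS]
  simp_rw [h.cut2_sum, map_sum]
  have e : invS (∑ k ∈ Finset.range (N + 1), LPhatS D k)
      = ∑ k ∈ Finset.range (N + 1), invS (LPhatS D k) := map_sum invL _ _
  simp_rw [e, sum_apply, Finset.sum_mul_sum]
  rw [integral_finsetSum]
  · rw [Finset.sum_comm]
    refine Finset.sum_congr rfl fun k _ => ?_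
    rw [integral_finsetSum _ fun j _ => hi j k]
  · exact fun k _ => integrable_finsetSum _ fun j _ => hi j k

theorem Reg.integral_pdoPartial {a : RD d → RD d → ℂ} (h : Reg a) (D : LPData d) (u : TD d) (N : ℕ)
    (G : 𝓢(RD d, ℂ) →L[ℂ] 𝓢(RD d, ℂ)) (hG : ∀ ψ ξ, G ψ ξ = Gf a ψ ξ) (ψ : 𝓢(RD d, ℂ)) :
    ∫ x, pdoPartial D a N u x * ψ x
      = ∫ w, fourierTD u (reg_ee.cut (mulS (cutΘ D (2 ^ N) (two_pow_inv_ne N))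
          (G (trS ψ (((2:ℝ) ^ N)⁻¹ • w)))) (((2:ℝ) ^ N)⁻¹ • w)) * D.Φ w := by
  set κ := cutΘ D (2 ^ N) (two_pow_inv_ne N) with hκ
  set v := fourierTD u with hv
  have inner : ∀ z, ∫ x, v (h.cut2 κ x z) * ψ x = v (reg_ee.cut (mulS κ (G (trS ψ z))) z) := by
    intro z
    obtain ⟨Ψ, h1, h2⟩ := (h.polyFam_cut2_left κ z).exists_integral ψ
    rw [← h2]
    congr 1
    ext ξ
    rw [h1, Reg.cut_apply, mulS_apply, hG, Gf, amp, ← mul_assoc, ← integral_const_mul]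
    rw [← integral_add_right_eq_self _ z]
    refine integral_congr_ae (Eventually.of_forall fun y => ?_)
    simp only [Reg.cut2_apply, trS_apply, _root_.phased, add_sub_cancel_right, sub_zero]
    rw [ee_add]
    ring
  have e1 : ∀ x, pdoPartial D a N u x * ψ x = ∫ z, v (h.cut2 κ x z) * invS κ z * ψ x := by
    intro x; rw [h.pdoPartial_eq D u N x, ← integral_mul_const]
  simp_rw [e1]
  rw [integral_integral_swap (h.integrable_cut2 κ v (invS κ) ψ)]
  have e2 : ∀ z, ∫ x, v (h.cut2 κ x z) * invS κ z * ψ x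
      = v (reg_ee.cut (mulS κ (G (trS ψ z))) z) * invS κ z := by
    intro z
    rw [← inner z, ← integral_mul_const]
    refine integral_congr_ae (Eventually.of_forall fun x => ?_)
    simp only []
    ring
  simp_rw [e2]
  have e3 : ∀ z, invS κ z = (((2 ^ N : ℝ) ^ d : ℝ) : ℂ) * D.Φ ((2 ^ N : ℝ) • z) := by
    intro z
    rw [hκ, cutΘ, invS_dil (by positivity), Θ, invS_fourierS]
  have h4 := Measure.integral_comp_smul (volume : Measure (RD d))
    (fun w => v (reg_ee.cut (mulS κ (G (trS ψ (((2:ℝ) ^ N)⁻¹ • w)))) (((2:ℝ) ^ N)⁻¹ • w)) * D.Φ w)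
    ((2:ℝ) ^ N)
  have hne : ((2:ℝ) ^ N) ≠ 0 := by positivity
  simp only [smul_smul, inv_mul_cancel₀ hne, one_smul, finrank_euclideanSpace, Fintype.card_fin]
    at h4
  have e4 : ∀ z, v (reg_ee.cut (mulS κ (G (trS ψ z))) z) * invS κ z
      = (((2 ^ N : ℝ) ^ d : ℝ) : ℂ) *
        (v (reg_ee.cut (mulS κ (G (trS ψ z))) z) * D.Φ ((2 ^ N : ℝ) • z)) := by
    intro z; rw [e3]; ring
  simp_rw [e4]
  rw [integral_const_mul, h4, abs_of_pos (by positivity), Complex.real_smul, ← mul_assoc,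
    ← Complex.ofReal_mul, mul_inv_cancel₀ (by positivity), Complex.ofReal_one, one_mul]

theorem integral_Φ (D : LPData d) : ∫ w, D.Φ w = 1 := by
  have h := fourierS_apply D.Φ 0
  simp only [neg_zero, ee_zero, mul_one] at h
  rw [← h]
  exact Θ_eq_one D (by simp)

/-- Weak convergence of the partial sums to the transpose of the amplitude transform. -/
theorem Reg.convergesInSPrime {a : RD d → RD d → ℂ} (h : Reg a) (D : LPData d) (u : TD d)
    (G : 𝓢(RD d, ℂ) →L[ℂ] 𝓢(RD d, ℂ)) (hG : ∀ ψ ξ, G ψ ξ = Gf a ψ ξ) :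
    ConvergesInSPrime D a u ((fourierTD u).comp G) := by
  intro ψ
  simp_rw [h.integral_pdoPartial D u _ G hG]
  set v := fourierTD u with hv
  set g : RD d → 𝓢(RD d, ℂ) := fun z => G (trS ψ z) with hg
  have hgP : PolyFam g := (polyFam_trS ψ).clm G
  have hg0 : g 0 = G ψ := by simp only [hg, trS_zero]
  have hlim : (v.comp G) ψ = ∫ w, v (g 0) * D.Φ w := by
    rw [integral_const_mul, integral_Φ, mul_one, hg0]; rfl
  rw [hlim]
  obtain ⟨n, Cv, hCv, hvb⟩ := dist_le_SN v
  obtain ⟨C1, M1, n1, hC1, h1⟩ := (reg_ee (d := d)).SN_cut_le n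
  obtain ⟨C2, M2, hC2, h2⟩ := hgP.growth n1
  set K := 2 ^ n1 * SN n1 (Θ D) with hK
  have hK0 : 0 ≤ K := by have := SN_nonneg n1 (Θ D); positivity
  have hpow : ∀ N : ℕ, (1 : ℝ) ≤ 2 ^ N := fun N => one_le_pow₀ (by norm_num)
  have hmul : ∀ N : ℕ, ∀ χ : 𝓢(RD d, ℂ), SN n1 (mulS (cutΘ D (2 ^ N) (two_pow_inv_ne N)) χ)
      ≤ 4 ^ n1 * K * SN n1 χ := by
    intro N χ
    have := SN_nonneg n1 χ
    refine SN_le (by positivity) fun l hl ξ => ?_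
    refine pow_mul_deriv_mulS_le le_rfl hl (fun j hj => ?_) χ
    refine norm_deriv_dil_le _ ?_ (Θ D) (by omega) ξ
    rw [abs_of_pos (by positivity)]
    exact inv_le_one_of_one_le₀ (hpow N)
  refine tendsto_integral_of_dominated_convergence
    (fun w => Cv * C1 * (4 ^ n1 * K) * C2 * ((1 + ‖w‖) ^ (M2 + M1) * ‖D.Φ w‖)) ?_ ?_ ?_ ?_
  · intro N
    have hP : PolyFam fun z => reg_ee.cut (mulS (cutΘ D (2 ^ N) (two_pow_inv_ne N)) (g z)) z :=
      (hgP.clm (SchwartzMap.smulLeftCLM ℂ (cutΘ D (2 ^ N) (two_pow_inv_ne N)))).cut reg_ee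
    have hc := v.continuous.comp (hP.cont.comp (continuous_const_smul (((2:ℝ) ^ N)⁻¹)))
    exact (hc.mul D.Φ.continuous).aestronglyMeasurable
  · exact (integrable_pow_mul_schwartz _ D.Φ).const_mul _
  · intro N
    refine Eventually.of_forall fun w => ?_
    set z := ((2:ℝ) ^ N)⁻¹ • w with hz
    have hzw : ‖z‖ ≤ ‖w‖ := by
      rw [hz, norm_two_pow_inv_smul]
      exact div_le_self (norm_nonneg w) (hpow N)
    rw [norm_mul]
    calc _ ≤ (Cv * (C1 * (4 ^ n1 * K * (C2 * (1 + ‖z‖) ^ M2)) * (1 + ‖z‖) ^ M1)) * ‖D.Φ w‖ := by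
          gcongr
          refine (hvb _).trans ?_
          gcongr
          refine (h1 _ _).trans ?_
          gcongr
          refine (hmul N _).trans ?_
          gcongr
          exact h2 z
      _ ≤ (Cv * (C1 * (4 ^ n1 * K * (C2 * (1 + ‖w‖) ^ M2)) * (1 + ‖w‖) ^ M1)) * ‖D.Φ w‖ := by
          gcongr
      _ = _ := by ring
  · refine Eventually.of_forall fun w => ?_
    refine Tendsto.mul_const _ ?_
    have hz : Tendsto (fun N : ℕ => ((2:ℝ) ^ N)⁻¹ • w) atTop (nhds 0) := by
      have : Tendsto (fun N : ℕ => ((2:ℝ) ^ N)⁻¹) atTop (nhds 0) :=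
        (tendsto_pow_atTop_atTop_of_one_lt (by norm_num : (1:ℝ) < 2)).inv_tendsto_atTop
      simpa using this.smul_const w
    have hgz := (hgP.cont.tendsto 0).comp hz
    have t1 := (reg_ee (d := d)).tendsto_cut hz hgz
    have t2 : Tendsto (fun N : ℕ => (reg_ee (d := d)).cut (g (((2:ℝ) ^ N)⁻¹ • w)
        - mulS (cutΘ D (2 ^ N) (two_pow_inv_ne N)) (g (((2:ℝ) ^ N)⁻¹ • w)))
        (((2:ℝ) ^ N)⁻¹ • w)) atTop (nhds 0) := by
      refine (reg_ee (d := d)).tendsto_cut_zero hz fun n => ?_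
      obtain ⟨C, hC, hb⟩ := SN_tail D n 1
      refine squeeze_zero (fun _ => SN_nonneg _ _) (fun N => hb (2 ^ N) (hpow N) _ _) ?_
      have a1 := ((continuous_SN (n + 1)).tendsto (g 0)).comp hgz
      have a2 : Tendsto (fun N : ℕ => (((2:ℝ) ^ N) ^ 1)⁻¹) atTop (nhds 0) := by
        simp only [pow_one]
        exact (tendsto_pow_atTop_atTop_of_one_lt (by norm_num : (1:ℝ) < 2)).inv_tendsto_atTop
      simpa using (a2.const_mul C).mul a1
    have t3 := t1.sub t2
    rw [sub_zero] at t3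
    have e0 : (reg_ee (d := d)).cut (g 0) 0 = g 0 := by
      ext ξ; rw [Reg.cut_apply, ee_zero, one_mul]
    rw [e0] at t3
    refine (v.continuous.tendsto _ |>.comp t3).congr fun N => ?_
    simp only [Function.comp, Reg.cut_sub, sub_sub_cancel, hg]

/-! ### Symbol classes with finitely many derivatives in the space variable -/

/-- Directional derivative in the space variable. -/
def Dx (e : RD d) (b : RD d → RD d → ℂ) (x ξ : RD d) : ℂ := fderiv ℝ (fun x' => b x' ξ) x e

theorem contDiff_left_of_prod {F : Type*} [NormedAddCommGroup F] [NormedSpace ℝ F]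
    {b : RD d → RD d → F}
    (h : ContDiff ℝ ∞ (fun p : RD d × RD d => b p.1 p.2)) (ξ : RD d) :
    ContDiff ℝ ∞ (fun x => b x ξ) :=
  h.comp (contDiff_prodMk_left ξ)

theorem contDiff_fderiv_left {F : Type*} [NormedAddCommGroup F] [NormedSpace ℝ F]
    {b : RD d → RD d → F} (h : ContDiff ℝ ∞ (fun p : RD d × RD d => b p.1 p.2)) :
    ContDiff ℝ ∞ (fun p : RD d × RD d => fderiv ℝ (fun x' => b x' p.2) p.1) := by
  refine ContDiff.fderiv (m := ∞) (n := ∞) (f := fun (p : RD d × RD d) x' => b x' p.2)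
    (g := Prod.fst) ?_ contDiff_fst (by simp)
  exact h.comp (contDiff_snd.prodMk (contDiff_snd.comp contDiff_fst))

theorem contDiff_iteratedFDeriv_left {b : RD d → RD d → ℂ}
    (h : ContDiff ℝ ∞ (fun p : RD d × RD d => b p.1 p.2)) (β : ℕ) :
    ContDiff ℝ ∞ (fun p : RD d × RD d => iteratedFDeriv ℝ β (fun x' => b x' p.2) p.1) := by
  induction β with
  | zero =>
    simp only [iteratedFDeriv_zero_eq_comp, Function.comp_apply]
    exact (continuousMultilinearCurryFin0 ℝ (RD d) ℂ).symm.contDiff.comp h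
  | succ β ih =>
    simp only [iteratedFDeriv_succ_eq_comp_left, Function.comp_apply]
    exact ((continuousMultilinearCurryLeftEquiv ℝ (fun _ : Fin (β + 1) => RD d) ℂ).symm).contDiff.comp
      (contDiff_fderiv_left (b := fun x ξ => iteratedFDeriv ℝ β (fun x' => b x' ξ) x) ih)

/-- Symbols of order `m` with no control on derivatives in `x`. -/
structure Sym0 (m : ℝ) (b : RD d → RD d → ℂ) : Prop where
  smooth : ContDiff ℝ ∞ (fun p : RD d × RD d => b p.1 p.2)
  bound : ∀ l : ℕ, ∃ c : ℝ, 0 ≤ c ∧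
      ∀ x ξ, ‖iteratedFDeriv ℝ l (b x) ξ‖ ≤ c * (1 + ‖ξ‖) ^ (m - (l : ℝ))

/-- Symbols of order `m` and type `(1,1)` with control on `L` derivatives in `x`. -/
def SymB : ℕ → ℝ → (RD d → RD d → ℂ) → Prop
  | 0, m, b => Sym0 m b
  | (L+1), m, b => Sym0 m b ∧ ∀ e, SymB L (m + 1) (Dx e b)

theorem symB_succ {L : ℕ} {m : ℝ} {b : RD d → RD d → ℂ} :
    SymB (L + 1) m b ↔ Sym0 m b ∧ ∀ e, SymB L (m + 1) (Dx e b) := Iff.rfl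

theorem SymB.zero {L : ℕ} {m : ℝ} {b : RD d → RD d → ℂ} (h : SymB L m b) : Sym0 m b := by
  cases L with
  | zero => exact h
  | succ L => exact (symB_succ.1 h).1

theorem SymB.step {L : ℕ} {m : ℝ} {b : RD d → RD d → ℂ} (h : SymB (L + 1) m b) (e : RD d) :
    SymB L (m + 1) (Dx e b) := (symB_succ.1 h).2 e

theorem SymB.smooth {L : ℕ} {m : ℝ} {b : RD d → RD d → ℂ} (h : SymB L m b) :
    ContDiff ℝ ∞ (fun p : RD d × RD d => b p.1 p.2) := h.zero.smooth

theorem SymB.pred {L : ℕ} {m : ℝ} {b : RD d → RD d → ℂ} (h : SymB (L + 1) m b) : SymB L m b := by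
  induction L generalizing m b with
  | zero => exact h.zero
  | succ L ih => exact symB_succ.2 ⟨h.zero, fun e => ih (h.step e)⟩

theorem SymB.uReg {L : ℕ} {m : ℝ} {b : RD d → RD d → ℂ} (h : SymB L m b) : UReg b := by
  refine ⟨h.smooth, ⌈|m|⌉₊, fun l => ?_⟩
  obtain ⟨c, hc, hb⟩ := h.zero.bound l
  refine ⟨c, hc, fun x ξ => (hb x ξ).trans ?_⟩
  rw [← Real.rpow_natCast]
  gcongr
  · exact one_le_one_add_norm ξ
  · have := Nat.le_ceil |m|
    have := le_abs_self m
    have : (0:ℝ) ≤ l := by positivity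
    linarith

theorem SymB.left_diff {L : ℕ} {m : ℝ} {b : RD d → RD d → ℂ} (h : SymB L m b) (x ξ : RD d) :
    DifferentiableAt ℝ (fun x' => b x' ξ) x :=
  ((contDiff_left_of_prod h.smooth ξ).differentiable (by simp)).differentiableAt

theorem Sym0.right {m : ℝ} {b : RD d → RD d → ℂ} (h : Sym0 m b) (x : RD d) :
    ContDiff ℝ ∞ (b x) := contDiff_right_of_prod h.smooth x

theorem Sym0.add {m : ℝ} {b c : RD d → RD d → ℂ} (hb : Sym0 m b) (hc : Sym0 m c) :
    Sym0 m (fun x ξ => b x ξ + c x ξ) := by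
  refine ⟨hb.smooth.add hc.smooth, fun l => ?_⟩
  obtain ⟨c1, h1, hb1⟩ := hb.bound l
  obtain ⟨c2, h2, hb2⟩ := hc.bound l
  refine ⟨c1 + c2, by positivity, fun x ξ => ?_⟩
  have e : iteratedFDeriv ℝ l (fun ξ => b x ξ + c x ξ) ξ
      = iteratedFDeriv ℝ l (b x) ξ + iteratedFDeriv ℝ l (c x) ξ :=
    iteratedFDeriv_add_apply ((hb.right x).of_le (by exact_mod_cast le_top)).contDiffAt
      ((hc.right x).of_le (by exact_mod_cast le_top)).contDiffAt
  change ‖iteratedFDeriv ℝ l (fun ξ => b x ξ + c x ξ) ξ‖ ≤ _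
  rw [e, add_mul]
  exact (norm_add_le _ _).trans (add_le_add (hb1 x ξ) (hb2 x ξ))

theorem SymB.add {L : ℕ} {m : ℝ} {b c : RD d → RD d → ℂ} (hb : SymB L m b) (hc : SymB L m c) :
    SymB L m (fun x ξ => b x ξ + c x ξ) := by
  induction L generalizing m b c with
  | zero => exact hb.zero.add hc.zero
  | succ L ih =>
    refine symB_succ.2 ⟨hb.zero.add hc.zero, fun e => ?_⟩
    have := ih (hb.step e) (hc.step e)
    convert this using 3 with x ξ
    rw [Dx, fderiv_fun_add (hb.left_diff x ξ) (hc.left_diff x ξ)]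
    rfl

theorem norm_iteratedFDeriv_clm_le (T : RD d →L[ℝ] ℂ) (j : ℕ) (ξ : RD d) :
    ‖iteratedFDeriv ℝ j T ξ‖ ≤ ‖T‖ * (1 + ‖ξ‖) ^ (1 - (j : ℝ)) := by
  have hp : 0 < 1 + ‖ξ‖ := by positivity
  match j with
  | 0 =>
    simp only [norm_iteratedFDeriv_zero, Nat.cast_zero, sub_zero, Real.rpow_one]
    refine (T.le_opNorm ξ).trans ?_
    gcongr
    linarith
  | 1 =>
    rw [← zero_add 1, ← norm_iteratedFDeriv_fderiv, norm_iteratedFDeriv_zero, T.fderiv]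
    simp
  | (j + 2) =>
    have : iteratedFDeriv ℝ (j + 1) (fun _ : RD d => T) ξ = 0 := by
      rw [iteratedFDeriv_const_of_ne (by omega)]; rfl
    have e : fderiv ℝ (T : RD d → ℂ) = fun _ => T := funext fun x => T.fderiv
    rw [← norm_iteratedFDeriv_fderiv, e, this, norm_zero]
    positivity

theorem SymB.mul_clm {L : ℕ} {m : ℝ} {b : RD d → RD d → ℂ} (hb : SymB L m b) (T : RD d →L[ℝ] ℂ) :
    SymB L (m + 1) (fun x ξ => T ξ * b x ξ) := by
  have base : ∀ {m : ℝ} {b : RD d → RD d → ℂ}, Sym0 m b →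
      Sym0 (m + 1) (fun x ξ => T ξ * b x ξ) := by
    intro m b hb
    refine ⟨(T.contDiff.comp contDiff_snd).mul hb.smooth, fun l => ?_⟩
    choose c hc hbd using hb.bound
    refine ⟨∑ j ∈ Finset.range (l + 1), (l.choose j : ℝ) * ‖T‖ * c (l - j),
      Finset.sum_nonneg fun j _ => by have := hc (l - j); positivity, fun x ξ => ?_⟩
    refine (norm_iteratedFDeriv_mul_le (𝕜 := ℝ) (N := ∞) (n := l) (f := T) (g := b x)
      T.contDiff (hb.right x) ξ (by exact_mod_cast le_top)).trans ?_
    rw [Finset.sum_mul]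
    refine Finset.sum_le_sum fun j hj => ?_
    have hj' : j ≤ l := by rw [Finset.mem_range] at hj; omega
    have hp : 0 < 1 + ‖ξ‖ := by positivity
    calc (l.choose j : ℝ) * ‖iteratedFDeriv ℝ j T ξ‖ * ‖iteratedFDeriv ℝ (l - j) (b x) ξ‖
        ≤ (l.choose j : ℝ) * (‖T‖ * (1 + ‖ξ‖) ^ (1 - (j : ℝ))) *
          (c (l - j) * (1 + ‖ξ‖) ^ (m - ((l - j : ℕ) : ℝ))) := by
          gcongr
          · exact norm_iteratedFDeriv_clm_le T j ξ
          · exact hbd _ x ξ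
      _ = (l.choose j : ℝ) * ‖T‖ * c (l - j) *
          ((1 + ‖ξ‖) ^ (1 - (j : ℝ)) * (1 + ‖ξ‖) ^ (m - ((l - j : ℕ) : ℝ))) := by ring
      _ = _ := by
          rw [← Real.rpow_add hp, Nat.cast_sub hj']
          congr 2
          ring
  induction L generalizing m b with
  | zero => exact base hb
  | succ L ih =>
    refine symB_succ.2 ⟨base hb.zero, fun e => ?_⟩
    have := ih (hb.step e)
    convert this using 3 with x ξ
    rw [Dx, fderiv_const_mul (hb.left_diff x ξ)]
    rfl

theorem IsSymbolS11.symB_iterated {m : ℝ} {a : RD d → RD d → ℂ} (ha : IsSymbolS11 d m a)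
    (L β : ℕ) (w : Fin β → RD d) :
    SymB L (m + β) (fun x ξ => iteratedFDeriv ℝ β (fun x' => a x' ξ) x w) := by
  have hs := contDiff_iteratedFDeriv_left ha.1
  have base : ∀ (β : ℕ) (w : Fin β → RD d),
      Sym0 (m + β) (fun x ξ => iteratedFDeriv ℝ β (fun x' => a x' ξ) x w) := by
    intro β w
    set T := ContinuousMultilinearMap.apply ℝ (fun _ : Fin β => RD d) ℂ w with hT
    refine ⟨T.contDiff.comp (hs β), fun l => ?_⟩
    obtain ⟨c, hc⟩ := ha.2 l β
    refine ⟨‖T‖ * |c|, by positivity, fun x ξ => ?_⟩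
    have h1 : ContDiff ℝ ∞ (fun ξ' => iteratedFDeriv ℝ β (fun x' => a x' ξ') x) :=
      (hs β).comp (contDiff_prodMk_right x)
    have h2 := T.norm_iteratedFDeriv_comp_left (n := l) (N := ∞) (h1.contDiffAt (x := ξ))
      (by exact_mod_cast le_top)
    refine h2.trans ?_
    rw [mul_assoc]
    gcongr
    refine (hc x ξ).trans ?_
    rw [show m - (l:ℝ) + β = m + β - l by ring]
    gcongr
    exact le_abs_self c
  induction L generalizing β w with
  | zero => exact base β w
  | succ L ih =>
    refine symB_succ.2 ⟨base β w, fun e => ?_⟩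
    have := ih (β + 1) (Fin.cons e w)
    rw [Nat.cast_add, Nat.cast_one, ← add_assoc] at this
    convert this using 3 with x ξ
    rw [iteratedFDeriv_succ_apply_left, Fin.cons_zero, Fin.tail_cons]
    have hd : DifferentiableAt ℝ (iteratedFDeriv ℝ β (fun x' => a x' ξ)) x :=
      ((contDiff_left_of_prod (b := fun x ξ => iteratedFDeriv ℝ β (fun x' => a x' ξ) x)
        (hs β) ξ).differentiable (by simp)).differentiableAt
    have h3 := ((ContinuousMultilinearMap.apply ℝ (fun _ : Fin β => RD d) ℂ w).hasFDerivAt.comp x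
      hd.hasFDerivAt).fderiv
    exact congrArg (fun T => T e) h3

theorem IsSymbolS11.symB {m : ℝ} {a : RD d → RD d → ℂ} (ha : IsSymbolS11 d m a) (L : ℕ) :
    SymB L m a := by
  have := ha.symB_iterated L 0 Fin.elim0
  simpa using this

/-! ### Rescaled kernels and the gain from integration by parts -/

/-- The kernel `y ↦ 2^{nd} (𝓕⁻¹g)(2^n(x-y))`. -/
def kerS (g : 𝓢(RD d, ℂ)) (n : ℕ) (x : RD d) : 𝓢(RD d, ℂ) :=
  fourierS (reg_ee.cut (dil ((2 : ℝ) ^ n)⁻¹ (two_pow_inv_ne n) g) x)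

theorem kerS_apply (g : 𝓢(RD d, ℂ)) (n : ℕ) (x y : RD d) :
    kerS g n x y = ((((2 : ℝ) ^ n) ^ d : ℝ) : ℂ) * invS g ((2 : ℝ) ^ n • (x - y)) := by
  rw [kerS, fourierS_cut_ee, invS_dil (by positivity)]

theorem integral_comp_scale (n : ℕ) (x : RD d) (F : RD d → ℝ) :
    ∫ y, ((2 : ℝ) ^ n) ^ d * F ((2 : ℝ) ^ n • (x - y)) = ∫ z, F z := by
  rw [integral_const_mul, integral_sub_left_eq_self (fun y => F ((2 : ℝ) ^ n • y)) volume x,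
    Measure.integral_comp_smul]
  have : (0 : ℝ) < ((2 : ℝ) ^ n) ^ d := by positivity
  simp only [finrank_euclideanSpace, Fintype.card_fin, smul_eq_mul, abs_inv, abs_of_pos this]
  field_simp

theorem Sym0.reg {m : ℝ} {b : RD d → RD d → ℂ} (h : Sym0 m b) : Reg b :=
  (SymB.uReg (L := 0) h).reg

theorem Sym0.norm_deriv_amp_ker_le {m : ℝ} {b : RD d → RD d → ℂ} (h : Sym0 m b)
    (g : 𝓢(RD d, ℂ)) {K : ℝ} (hK : 0 ≤ K) (l : ℕ) : ∃ C : ℝ, 0 ≤ C ∧ ∀ (n : ℕ) (x ξ : RD d),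
    1 + ‖ξ‖ ≤ K * 2 ^ n → ‖iteratedFDeriv ℝ l (amp (phased b x) (kerS g n x)) ξ‖
      ≤ C * (1 + ‖ξ‖) ^ (m - (l : ℝ)) := by
  choose c hc hb using h.bound
  set S := ∑ j ∈ Finset.range (l + 1), c j with hS
  have hS0 : 0 ≤ S := Finset.sum_nonneg fun j _ => hc j
  set I := ∫ z, (1 + ‖z‖) ^ l * ‖invS g z‖ with hI
  have hI0 : 0 ≤ I := integral_nonneg fun z => by positivity
  refine ⟨S * ((1 + 2 * Real.pi * K) ^ l * I), by positivity, fun n x ξ hξ => ?_⟩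
  have hp : 0 < 1 + ‖ξ‖ := by positivity
  have h1 := h.reg.norm_deriv_amp_phased_le (l := l) (ξ := ξ) (B := S * (1 + ‖ξ‖) ^ m)
    (r := (1 + ‖ξ‖)⁻¹) (by positivity) x (fun j hj y => ?_) (kerS g n x)
  · refine h1.trans ?_
    have h2 : ∫ y, ((1 + ‖ξ‖)⁻¹ + 2 * Real.pi * ‖y - x‖) ^ l * ‖kerS g n x y‖
        ≤ ((1 + ‖ξ‖)⁻¹) ^ l * ((1 + 2 * Real.pi * K) ^ l * I) := by
      rw [hI, ← integral_comp_scale n x (fun z => (1 + ‖z‖) ^ l * ‖invS g z‖), ← integral_const_mul, ← integral_const_mul]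
      refine integral_mono_of_nonneg (Eventually.of_forall fun y => by positivity) ?_
        (Eventually.of_forall fun y => ?_)
      · have := integrable_pow_sub_mul_schwartz l (kerS g n x) x (r := 1) (t := 2 ^ n) zero_le_one
          (by positivity)
        refine ((this.const_mul ((1 + 2 * Real.pi * K) ^ l)).const_mul
          (((1 + ‖ξ‖)⁻¹) ^ l)).congr (Eventually.of_forall fun y => ?_)
        simp only [kerS_apply, norm_mul, norm_sub_rev y x]
        rw [Complex.norm_real]
        simp only [norm_pow, Real.norm_ofNat, norm_smul]
        ring
      · simp only [kerS_apply, norm_mul]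
        rw [Complex.norm_real, Real.norm_of_nonneg (by positivity)]
        have h3 : (1 + ‖ξ‖)⁻¹ + 2 * Real.pi * ‖y - x‖
            ≤ (1 + ‖ξ‖)⁻¹ * (1 + 2 * Real.pi * K) * (1 + ‖(2:ℝ) ^ n • (x - y)‖) := by
          rw [mul_assoc (1 + ‖ξ‖)⁻¹, inv_mul_eq_div, le_div_iff₀ hp, norm_smul, norm_sub_rev y x, add_mul,
            inv_mul_cancel₀ hp.ne', norm_pow, Real.norm_ofNat]
          have h4 : 2 * Real.pi * ‖x - y‖ * (1 + ‖ξ‖) ≤ 2 * Real.pi * ‖x - y‖ * (K * 2 ^ n) := by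
            gcongr
          have h5 : 0 ≤ 2 * Real.pi * K + 2 ^ n * ‖x - y‖ := by positivity
          nlinarith
        calc _ ≤ ((1 + ‖ξ‖)⁻¹ * (1 + 2 * Real.pi * K) * (1 + ‖(2:ℝ) ^ n • (x - y)‖)) ^ l
            * (((2:ℝ) ^ n) ^ d * ‖invS g ((2:ℝ) ^ n • (x - y))‖) := by gcongr
          _ = _ := by rw [mul_pow, mul_pow]; ring
    calc _ ≤ S * (1 + ‖ξ‖) ^ m * (((1 + ‖ξ‖)⁻¹) ^ l * ((1 + 2 * Real.pi * K) ^ l * I)) := by gcongr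
      _ = _ := by
        rw [Real.rpow_sub hp, Real.rpow_natCast, inv_pow]
        ring
  · refine (hb j y ξ).trans ?_
    rw [Real.rpow_sub hp, Real.rpow_natCast, inv_pow, ← div_eq_mul_inv, mul_div_assoc]
    gcongr
    exact Finset.single_le_sum (f := c) (fun j _ => hc j) (Finset.mem_range.2 (by omega))

/-- Multiplier `2πi⟨e,ξ⟩`. -/
def freq (e : RD d) : RD d →L[ℝ] ℂ :=
  (2 * Real.pi * Complex.I : ℂ) • (Complex.ofRealCLM.comp (innerSL ℝ e))

theorem freq_apply (e ξ : RD d) : freq e ξ = 2 * Real.pi * Complex.I * ((⟪e, ξ⟫ : ℝ) : ℂ) := rfl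

theorem hasFDerivAt_ee_left (x y ξ : RD d) :
    HasFDerivAt (fun y => ee (y - x) ξ) (ee (y - x) ξ • freq ξ) y := by
  have h1 : HasFDerivAt (fun y => freq ξ (y - x)) (freq ξ) y := by
    have := (freq ξ).hasFDerivAt (x := y - x)
    exact this.comp y ((hasFDerivAt_id y).sub_const x)
  have h2 := h1.cexp
  have e : (fun y => ee (y - x) ξ) = fun y => Complex.exp (freq ξ (y - x)) := by
    ext y; rw [freq_apply, ee, real_inner_comm]
  rw [show ee (y - x) ξ = Complex.exp (freq ξ (y - x)) by rw [freq_apply, ee, real_inner_comm], e]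
  exact h2

theorem fderiv_kerS {e : RD d} {g g' : 𝓢(RD d, ℂ)} (hg : ∀ ζ, g' ζ = freq e ζ * g ζ) (n : ℕ)
    (x y : RD d) : fderiv ℝ (kerS g n x) y e = -(2 : ℝ) ^ n * kerS g' n x y := by
  have h := SchwartzMap.lineDerivOp_fourier_eq
    (reg_ee.cut (dil ((2 : ℝ) ^ n)⁻¹ (two_pow_inv_ne n) g) x) e
  have h1 := congrArg (fun f : 𝓢(RD d, ℂ) => f y) h
  simp only [SchwartzMap.lineDerivOp_apply_eq_fderiv] at h1
  change fderiv ℝ (kerS g n x) y e = fourierS _ y at h1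
  rw [h1]
  have h2 : (-(2 * Real.pi * Complex.I) • smulLeftCLM ℂ (inner ℝ · e)
      (reg_ee.cut (dil ((2 : ℝ) ^ n)⁻¹ (two_pow_inv_ne n) g) x) : 𝓢(RD d, ℂ))
      = (-(2 : ℝ) ^ n : ℂ) • reg_ee.cut (dil ((2 : ℝ) ^ n)⁻¹ (two_pow_inv_ne n) g') x := by
    ext ζ
    have ht : (inner ℝ · e : RD d → ℝ).HasTemperateGrowth := by fun_prop
    simp only [smul_apply, SchwartzMap.smulLeftCLM_apply_apply ht, Reg.cut_apply, dil_apply, hg,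
      freq_apply, inner_smul_right, real_inner_comm e ζ, smul_eq_mul, Complex.real_smul]
    push_cast
    field_simp
  rw [h2]
  have h3 : fourierS ((-(2 : ℝ) ^ n : ℂ) • reg_ee.cut (dil ((2 : ℝ) ^ n)⁻¹ (two_pow_inv_ne n) g') x)
     = (-(2 : ℝ) ^ n : ℂ) • kerS g' n x := by
    rw [← fouL_apply, map_smul]; rfl
  rw [h3]
  simp

/-- The symbol produced by one integration by parts. -/
def ibpSym (e : RD d) (b : RD d → RD d → ℂ) (x ξ : RD d) : ℂ := Dx e b x ξ + freq e ξ * b x ξ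

theorem SymB.ibpSym {L : ℕ} {m : ℝ} {b : RD d → RD d → ℂ} (h : SymB (L + 1) m b) (e : RD d) :
    SymB L (m + 1) (ibpSym e b) :=
  (h.step e).add (h.pred.mul_clm (freq e))

theorem amp_ker_ibp {L : ℕ} {m : ℝ} {b : RD d → RD d → ℂ} (h : SymB (L + 1) m b) {e : RD d}
    {g g' : 𝓢(RD d, ℂ)} (hg : ∀ ζ, g' ζ = freq e ζ * g ζ) (n : ℕ) (x ξ : RD d) :
    amp (phased b x) (kerS g' n x) ξ
      = (((2 : ℝ) ^ n)⁻¹ : ℝ) * amp (phased (ibpSym e b) x) (kerS g n x) ξ := by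
  have hd : ∀ y, HasFDerivAt (fun y => phased b x y ξ)
      (b y ξ • (ee (y - x) ξ • freq ξ) + ee (y - x) ξ • fderiv ℝ (fun y => b y ξ) y) y := fun y =>
    (h.left_diff y ξ).hasFDerivAt.mul (hasFDerivAt_ee_left x y ξ)
  have hd2 : ∀ y, fderiv ℝ (fun y => phased b x y ξ) y e = phased (ibpSym e b) x y ξ := by
    intro y
    rw [(hd y).fderiv]
    simp only [add_apply, smul_apply, smul_eq_mul, phased, ibpSym, Dx,
      freq_apply, real_inner_comm e ξ]
    ring
  have hR := h.uReg.reg.phased x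
  have hR2 := (h.ibpSym e).uReg.reg.phased x
  have i1 := hR2.integrable_mul (kerS g n x) ξ
  have i2 := hR.integrable_mul (kerS g' n x) ξ
  have i3 := hR.integrable_mul (kerS g n x) ξ
  have hk := fderiv_kerS hg n x
  have := integral_mul_fderiv_eq_neg_fderiv_mul_of_integrable (μ := (volume : Measure (RD d)))
    (f := fun y => phased b x y ξ) (g := kerS g n x) (v := e) (by simpa only [hd2] using i1)
    (by
      simp only [hk]
      refine (i2.const_mul (-(2 : ℝ) ^ n : ℂ)).congr (Eventually.of_forall fun y => ?_)
      dsimp only; ring) i3 (fun y _ => (hd y).differentiableAt)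
    (fun y _ => (kerS g n x).differentiableAt)
  simp only [hd2, hk] at this
  have e2 : ∫ y, phased b x y ξ * (-(2 : ℝ) ^ n * kerS g' n x y)
      = (-(2 : ℝ) ^ n : ℂ) * amp (phased b x) (kerS g' n x) ξ := by
    rw [amp, ← integral_const_mul]
    congr 1; ext y; ring
  rw [e2] at this
  change _ = - amp (phased (ibpSym e b) x) (kerS g n x) ξ at this
  have h2 : ((2 : ℝ) ^ n : ℂ) ≠ 0 := by simp
  rw [Complex.ofReal_inv, Complex.ofReal_pow, eq_inv_mul_iff_mul_eq₀ h2]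
  linear_combination -this

/-- The annulus condition. -/
def AnnSupp (g : 𝓢(RD d, ℂ)) : Prop := ∀ ζ, ‖ζ‖ < 1 / 2 ∨ 2 < ‖ζ‖ → g ζ = 0

theorem AnnSupp.decomp {g : 𝓢(RD d, ℂ)} (hg : AnnSupp g) : ∃ h : Fin d → 𝓢(RD d, ℂ),
    (∀ i, AnnSupp (h i)) ∧ ∃ h' : Fin d → 𝓢(RD d, ℂ),
    (∀ i ζ, h' i ζ = freq (EuclideanSpace.single i 1) ζ * h i ζ) ∧ g = ∑ i, h' i := by
  have h2π : (2 * Real.pi * Complex.I : ℂ) ≠ 0 := by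
    simp [Real.pi_ne_zero]
  set F : Fin d → RD d → ℂ := fun i ζ =>
    g ζ * (((ζ i / ‖ζ‖ ^ 2 : ℝ) : ℂ) * (2 * Real.pi * Complex.I)⁻¹) with hF
  have hsupp : ∀ i ζ, ‖ζ‖ < 1 / 2 ∨ 2 < ‖ζ‖ → F i ζ = 0 := by
    intro i ζ hζ; simp [hF, hg ζ hζ]
  have hsm : ∀ i, ContDiff ℝ ∞ (F i) := by
    intro i
    rw [contDiff_iff_contDiffAt]
    intro ζ
    by_cases hζ : ζ = 0
    · have : F i =ᶠ[nhds ζ] fun _ => 0 := by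
        have hlt : ‖ζ‖ < 1 / 2 := by simp [hζ]
        filter_upwards [(isOpen_lt continuous_norm continuous_const).mem_nhds hlt] with η hη
        exact hsupp i η (Or.inl hη)
      exact contDiffAt_const.congr_of_eventuallyEq this
    · refine (g.smooth ⊤).contDiffAt.mul (ContDiffAt.mul ?_ contDiffAt_const)
      refine Complex.ofRealCLM.contDiff.contDiffAt.comp ζ ?_
      refine ContDiffAt.div ?_ (contDiff_norm_sq ℝ).contDiffAt (by simpa using hζ)
      exact (EuclideanSpace.proj (𝕜 := ℝ) i).contDiff.contDiffAt
  have hcs : ∀ i, HasCompactSupport (F i) := by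
    intro i
    refine HasCompactSupport.intro (isCompact_closedBall (0 : RD d) 2) fun ζ hζ => ?_
    refine hsupp i ζ (Or.inr ?_)
    simpa using hζ
  have hfr : ∀ i : Fin d, (fun ζ => freq (EuclideanSpace.single i (1:ℝ)) ζ).HasTemperateGrowth :=
    fun i => (freq (EuclideanSpace.single i (1:ℝ))).hasTemperateGrowth
  refine ⟨fun i => (hcs i).toSchwartzMap (hsm i), fun i ζ hζ => hsupp i ζ hζ,
    fun i => SchwartzMap.smulLeftCLM ℂ (fun ζ => freq (EuclideanSpace.single i (1:ℝ)) ζ)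
      ((hcs i).toSchwartzMap (hsm i)), fun i ζ => ?_, ?_⟩
  · rw [SchwartzMap.smulLeftCLM_apply_apply (hfr i), smul_eq_mul]
  · ext ζ
    rw [sum_apply]
    have hval : ∀ i, SchwartzMap.smulLeftCLM ℂ (fun ζ => freq (EuclideanSpace.single i (1:ℝ)) ζ)
        ((hcs i).toSchwartzMap (hsm i)) ζ
        = 2 * Real.pi * Complex.I * ((⟪EuclideanSpace.single i (1:ℝ), ζ⟫ : ℝ) : ℂ) *
        (g ζ * (((ζ i / ‖ζ‖ ^ 2 : ℝ) : ℂ) * (2 * Real.pi * Complex.I)⁻¹)) := by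
      intro i
      rw [SchwartzMap.smulLeftCLM_apply_apply (hfr i)]
      rfl
    simp only [hval]
    by_cases hζ : ζ = 0
    · simp [hζ, hg 0 (by simp)]
    have hn : (‖ζ‖ : ℂ) ≠ 0 := by simpa using hζ
    have hs : (∑ i, ((ζ i : ℝ) : ℂ) * ((ζ i : ℝ) : ℂ)) = (‖ζ‖ : ℂ) ^ 2 := by
      have := EuclideanSpace.norm_sq_eq ζ
      simp only [Real.norm_eq_abs, sq_abs] at this
      rw [← Complex.ofReal_pow, this]
      push_cast
      exact Finset.sum_congr rfl fun i _ => by ring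
    have : ∀ i, 2 * Real.pi * Complex.I * ((⟪EuclideanSpace.single i (1:ℝ), ζ⟫ : ℝ) : ℂ) *
        (g ζ * (((ζ i / ‖ζ‖ ^ 2 : ℝ) : ℂ) * (2 * Real.pi * Complex.I)⁻¹))
        = g ζ / (‖ζ‖ : ℂ) ^ 2 * (((ζ i : ℝ) : ℂ) * ((ζ i : ℝ) : ℂ)) := by
      intro i
      simp only [EuclideanSpace.inner_single_left, map_one, one_mul]
      push_cast
      field_simp
    simp only [this]
    rw [← Finset.mul_sum, hs]
    field_simp

theorem kerS_sum {ι : Type*} (s : Finset ι) (g : ι → 𝓢(RD d, ℂ)) (n : ℕ) (x : RD d) :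
    kerS (∑ i ∈ s, g i) n x = ∑ i ∈ s, kerS (g i) n x := by
  ext y
  rw [sum_apply]
  simp only [kerS_apply, ← invL_apply, map_sum, sum_apply, Finset.mul_sum]

theorem SymB.norm_deriv_amp_ker_le {L : ℕ} {m : ℝ} {b : RD d → RD d → ℂ} (h : SymB L m b)
    {g : 𝓢(RD d, ℂ)} (hg : AnnSupp g) {K : ℝ} (hK : 0 ≤ K) (l : ℕ) : ∃ C : ℝ, 0 ≤ C ∧
    ∀ (n : ℕ) (x ξ : RD d), 1 + ‖ξ‖ ≤ K * 2 ^ n →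
    ‖iteratedFDeriv ℝ l (amp (phased b x) (kerS g n x)) ξ‖
      ≤ C * (((2 : ℝ) ^ n)⁻¹ ^ L * (1 + ‖ξ‖) ^ (m + L - (l : ℝ))) := by
  induction L generalizing m b g with
  | zero => simpa using h.zero.norm_deriv_amp_ker_le g hK l
  | succ L ih =>
    obtain ⟨f, hf, f', hf', hsum⟩ := hg.decomp
    choose C hC hb using fun i => ih (h.ibpSym (EuclideanSpace.single i (1:ℝ))) (hf i)
    refine ⟨∑ i, C i, Finset.sum_nonneg fun i _ => hC i, fun n x ξ hξ => ?_⟩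
    set H : Fin d → RD d → ℂ := fun i =>
      amp (phased (_root_.ibpSym (EuclideanSpace.single i (1:ℝ)) b) x) (kerS (f i) n x) with hH
    have hHs : ∀ i, ContDiff ℝ ∞ (H i) := fun i =>
      (((h.ibpSym (EuclideanSpace.single i (1:ℝ))).uReg.reg.phased x).amp_deriv _).1
    have e : amp (phased b x) (kerS g n x) = fun ξ => ∑ i, (((2 : ℝ) ^ n)⁻¹ : ℝ) • H i ξ := by
      ext ξ
      rw [hsum, kerS_sum, amp]
      simp only [sum_apply, Finset.mul_sum]
      rw [integral_finsetSum _ fun i _ => (h.uReg.reg.phased x).integrable_mul _ ξ]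
      refine Finset.sum_congr rfl fun i _ => ?_
      rw [Complex.real_smul]
      exact amp_ker_ibp h (hf' i) n x ξ
    have e2 : iteratedFDeriv ℝ l (amp (phased b x) (kerS g n x)) ξ
        = ∑ i, ((2 : ℝ) ^ n)⁻¹ • iteratedFDeriv ℝ l (H i) ξ := by
      rw [e, iteratedFDeriv_sum (fun i _ => ((hHs i).const_smul _).of_le (by exact_mod_cast le_top))]
      rw [Finset.sum_apply]
      refine Finset.sum_congr rfl fun i _ => ?_
      exact iteratedFDeriv_const_smul_apply ((hHs i).of_le (by exact_mod_cast le_top)).contDiffAt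
    rw [e2, Finset.sum_mul]
    refine (norm_sum_le _ _).trans (Finset.sum_le_sum fun i _ => ?_)
    rw [norm_smul, norm_inv, norm_pow, Real.norm_ofNat]
    calc _ ≤ ((2 : ℝ) ^ n)⁻¹ * (C i * (((2 : ℝ) ^ n)⁻¹ ^ L *
          (1 + ‖ξ‖) ^ (m + 1 + L - (l : ℝ)))) := by gcongr; exact hb i n x ξ hξ
      _ = _ := by push_cast; rw [show m + 1 + (L:ℝ) - l = m + (L + 1) - l by ring]; ring

/-! ### Almost orthogonality at a fixed frequency scale -/

theorem SN_mul_le_of_tsupport {A : ℕ} {χ E : 𝓢(RD d, ℂ)} {g : RD d → ℂ} (hg : ContDiff ℝ ∞ g)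
    (hE : ∀ ζ, E ζ = χ ζ * g ζ) {B : ℝ} (hB : 0 ≤ B)
    (h : ∀ ζ ∈ tsupport χ, ∀ l ≤ A, ‖iteratedFDeriv ℝ l g ζ‖ ≤ B) :
    SN A E ≤ 4 ^ A * SN A χ * B := by
  have hS := SN_nonneg A χ
  refine SN_le (by positivity) fun l hl ζ => ?_
  have hEf : (E : RD d → ℂ) = fun ζ => χ ζ * g ζ := funext hE
  have h1 : ∀ i ∈ Finset.range (l + 1), (1 + ‖ζ‖) ^ A * ((l.choose i : ℝ) * ‖iteratedFDeriv ℝ i χ ζ‖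
      * ‖iteratedFDeriv ℝ (l - i) g ζ‖) ≤ (l.choose i : ℝ) * (2 ^ A * SN A χ * B) := by
    intro i hi
    have hi' : i ≤ A := by have := Finset.mem_range.1 hi; omega
    by_cases hζ : ζ ∈ tsupport χ
    · have h2 := h ζ hζ (l - i) (by omega)
      have h3 := pow_mul_le_SN le_rfl hi' χ ζ
      calc _ = (l.choose i : ℝ) * (((1 + ‖ζ‖) ^ A * ‖iteratedFDeriv ℝ i χ ζ‖)
            * ‖iteratedFDeriv ℝ (l - i) g ζ‖) := by ring
        _ ≤ _ := by gcongr
    · have h2 : iteratedFDeriv ℝ i χ ζ = 0 := by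
        by_contra h0
        exact hζ (support_iteratedFDeriv_subset (𝕜 := ℝ) i h0)
      rw [h2]
      simp only [norm_zero, mul_zero, zero_mul]
      positivity
  have h2 := norm_iteratedFDeriv_mul_le (𝕜 := ℝ) (N := ∞) (n := l) (χ.smooth ⊤) hg ζ
    (by exact_mod_cast le_top)
  rw [hEf]
  calc _ ≤ (1 + ‖ζ‖) ^ A * _ := mul_le_mul_of_nonneg_left h2 (by positivity)
    _ ≤ ∑ i ∈ Finset.range (l + 1), (l.choose i : ℝ) * (2 ^ A * SN A χ * B) := by
        rw [Finset.mul_sum]; exact Finset.sum_le_sum h1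
    _ = 2 ^ l * (2 ^ A * SN A χ * B) := by
        rw [← Finset.sum_mul]
        congr 1
        exact_mod_cast Nat.sum_range_choose l
    _ ≤ 2 ^ A * (2 ^ A * SN A χ * B) := by gcongr; norm_num
    _ = _ := by
        rw [show (4:ℝ) ^ A = 2 ^ A * 2 ^ A by rw [← mul_pow]; norm_num]; ring

theorem norm_fourierS_modulated_le (χ : 𝓢(RD d, ℂ)) (σ : ℕ) : ∃ (A : ℕ) (C : ℝ), 0 ≤ C ∧
    ∀ (k : ℕ) (x : RD d) (h : RD d → ℂ) (H : 𝓢(RD d, ℂ)) (B : ℝ), ContDiff ℝ ∞ h → 0 ≤ B →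
    (∀ ξ, H ξ = χ (((2 : ℝ) ^ k)⁻¹ • ξ) * (ee x ξ * h ξ)) →
    (∀ ξ, ((2 : ℝ) ^ k)⁻¹ • ξ ∈ tsupport χ → ∀ l ≤ A,
      ‖iteratedFDeriv ℝ l h ξ‖ ≤ B * (((2 : ℝ) ^ k)⁻¹) ^ l) →
    ∀ y, ‖fourierS H y‖ ≤ C * B * (((2 : ℝ) ^ k) ^ d * ((1 + ‖(2 : ℝ) ^ k • (x - y)‖) ^ σ)⁻¹) := by
  obtain ⟨A, C, hC, hb⟩ := clm_SN_le (invL (d := d)) σ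
  have hS := SN_nonneg A χ
  refine ⟨A, 2 ^ σ * (C * (4 ^ A * SN A χ)), by positivity, fun k x h H B hh hB hH hd y => ?_⟩
  have h2 : (2 : ℝ) ^ k ≠ 0 := by positivity
  set E := dil ((2 : ℝ) ^ k) h2 (reg_ee.cut H (-x)) with hE
  have hEa : ∀ ζ, E ζ = χ ζ * h ((2 : ℝ) ^ k • ζ) := by
    intro ζ
    rw [hE, dil_apply, Reg.cut_apply, hH, smul_smul, inv_mul_cancel₀ h2, one_smul]
    linear_combination (χ ζ * h ((2 : ℝ) ^ k • ζ)) * ee_neg_mul x ((2 : ℝ) ^ k • ζ)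
  have hHE : fourierS H = kerS E k x := by
    rw [kerS]
    congr 1
    ext ξ
    rw [Reg.cut_apply, dil_apply, hEa, smul_smul, mul_inv_cancel₀ h2, one_smul, hH]
    ring
  have hSN : SN A E ≤ 4 ^ A * SN A χ * B := by
    refine SN_mul_le_of_tsupport (hh.comp (contDiff_const_smul _)) hEa hB fun ζ hζ l hl => ?_
    have h3 := hd ((2 : ℝ) ^ k • ζ) (by rwa [smul_smul, inv_mul_cancel₀ h2, one_smul]) l hl
    have h4 : iteratedFDeriv ℝ l (h ∘ fun ζ => (2 : ℝ) ^ k • ζ) ζ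
        = ((2 : ℝ) ^ k) ^ l • iteratedFDeriv ℝ l h ((2 : ℝ) ^ k • ζ) := by
      have h5 : ContDiff ℝ l h := hh.of_le (by exact_mod_cast le_top)
      exact congrFun (iteratedFDeriv_comp_const_smul ((2 : ℝ) ^ k) h5) ζ
    rw [h4, norm_smul, norm_pow, norm_pow, Real.norm_ofNat]
    calc _ ≤ ((2 : ℝ) ^ k) ^ l * (B * (((2 : ℝ) ^ k)⁻¹) ^ l) := by gcongr
      _ = B := by rw [inv_pow]; field_simp
  have h3 := pow_mul_le_SN (k := σ) (l := 0) le_rfl (Nat.zero_le σ) (invL E) ((2 : ℝ) ^ k • (x - y))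
  rw [norm_iteratedFDeriv_zero] at h3
  have h4 := hb E
  rw [hHE, kerS_apply, norm_mul, Complex.norm_real, Real.norm_of_nonneg (by positivity)]
  have hp : 0 < (1 + ‖(2 : ℝ) ^ k • (x - y)‖) ^ σ := by positivity
  have h5 : ‖invS E ((2 : ℝ) ^ k • (x - y))‖ ≤ (2 ^ σ * (C * (4 ^ A * SN A χ)) * B)
      * ((1 + ‖(2 : ℝ) ^ k • (x - y)‖) ^ σ)⁻¹ := by
    rw [← div_eq_mul_inv, le_div_iff₀ hp, mul_comm]
    refine h3.trans ?_
    calc _ ≤ 2 ^ σ * (C * (4 ^ A * SN A χ * B)) := by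
          gcongr; exact h4.trans (by gcongr)
      _ = _ := by ring
  calc _ ≤ ((2 : ℝ) ^ k) ^ d * _ := mul_le_mul_of_nonneg_left h5 (by positivity)
    _ = _ := by ring

theorem fourierTD_mulS_LPhatS (D : LPData d) (k : ℕ) (u : TD d) (H : 𝓢(RD d, ℂ)) :
    fourierTD u (mulS (LPhatS D k) H) = ∫ y, LPdist D k u y * fourierS H y := by
  obtain ⟨Ψ, h1, h2⟩ := (reg_ee.polyFam_cut (LPhatS D k)).exists_integral (fourierS H)
  have : mulS (LPhatS D k) H = Ψ := by
    ext ξ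
    rw [h1, mulS_apply]
    conv_lhs => rw [← invS_fourierS H, invS_apply, ← integral_const_mul]
    refine integral_congr_ae (Eventually.of_forall fun y => ?_)
    simp only [Reg.cut_apply]
    rw [ee_comm]; ring
  rw [this, h2]
  simp only [LPdist_eq]

theorem integrable_comp_scale (n : ℕ) (x : RD d) {F : RD d → ℝ} (hF : Integrable F) :
    Integrable (fun y => ((2 : ℝ) ^ n) ^ d * F ((2 : ℝ) ^ n • (x - y))) := by
  have h1 := hF.comp_smul (R := (2 : ℝ) ^ n) (by positivity)
  exact (h1.comp_sub_left x).const_mul _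

theorem integrable_one_add_norm_inv (d : ℕ) :
    Integrable (fun z : RD d => ((1 + ‖z‖) ^ (d + 1))⁻¹) := by
  have := integrable_one_add_norm (E := RD d) (μ := volume) (r := (d : ℝ) + 1) (by simp)
  refine this.congr (Eventually.of_forall fun z => ?_)
  have hp : 0 < 1 + ‖z‖ := by positivity
  simp only
  rw [Real.rpow_neg hp.le, ← Real.rpow_natCast]
  push_cast
  rfl

theorem norm_fourierTD_mulS_modulated_le (D : LPData d) (χ : 𝓢(RD d, ℂ)) (σ : ℕ) :
    ∃ (A : ℕ) (C : ℝ), 0 ≤ C ∧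
    ∀ (u : TD d) (k : ℕ) (x : RD d) (h : RD d → ℂ) (H : 𝓢(RD d, ℂ)) (B S : ℝ),
    ContDiff ℝ ∞ h → 0 ≤ B → 0 ≤ S →
    (∀ ξ, H ξ = χ (((2 : ℝ) ^ k)⁻¹ • ξ) * (ee x ξ * h ξ)) →
    (∀ ξ, ((2 : ℝ) ^ k)⁻¹ • ξ ∈ tsupport χ → ∀ l ≤ A,
      ‖iteratedFDeriv ℝ l h ξ‖ ≤ B * (((2 : ℝ) ^ k)⁻¹) ^ l) →
    (∀ y, ‖LPdist D k u y‖ ≤ S * (1 + ‖(2 : ℝ) ^ k • (x - y)‖) ^ σ) →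
    ‖fourierTD u (mulS (LPhatS D k) H)‖ ≤ C * B * S := by
  obtain ⟨A, C, hC, hb⟩ := norm_fourierS_modulated_le χ (σ + (d + 1))
  set I := ∫ z : RD d, ((1 + ‖z‖) ^ (d + 1))⁻¹ with hI
  have hI0 : 0 ≤ I := integral_nonneg fun z => by positivity
  refine ⟨A, C * I, by positivity, fun u k x h H B S hh hB hS hH hd hf => ?_⟩
  have h1 := hb k x h H B hh hB hH hd
  rw [fourierTD_mulS_LPhatS]
  calc _ ≤ ∫ y, (C * B * S) * (((2 : ℝ) ^ k) ^ d * (fun z : RD d => ((1 + ‖z‖) ^ (d + 1))⁻¹)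
        ((2 : ℝ) ^ k • (x - y))) := by
        refine norm_integral_le_of_norm_le ((integrable_comp_scale k x
          (integrable_one_add_norm_inv d)).const_mul _) (Eventually.of_forall fun y => ?_)
        have hp : 0 < (1 + ‖(2 : ℝ) ^ k • (x - y)‖) := by positivity
        rw [norm_mul]
        calc _ ≤ (S * (1 + ‖(2 : ℝ) ^ k • (x - y)‖) ^ σ) * _ :=
              mul_le_mul (hf y) (h1 y) (norm_nonneg _) (by positivity)
          _ = _ := by
            rw [pow_add]
            simp only
            field_simp
    _ = C * I * B * S := by
        rw [integral_const_mul, integral_comp_scale k x (fun z : RD d => ((1 + ‖z‖) ^ (d + 1))⁻¹), ← hI]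
        ring

/-- Frequency cutoffs equal to `1` near the support of `φ̂_k`, after rescaling. -/
def chi (D : LPData d) : ℕ → 𝓢(RD d, ℂ)
  | 0 => cutΘ D 4 (by norm_num)
  | (_ + 1) => cutΘ D 4 (by norm_num) - cutΘ D (1 / 8) (by norm_num)

theorem chi_eq_zero (D : LPData d) (k : ℕ) {ζ : RD d} (h : 8 < ‖ζ‖) : chi D k ζ = 0 := by
  have h4 : cutΘ D 4 (by norm_num) ζ = 0 := cutΘ_eq_zero D (by norm_num) _ (by linarith)
  cases k with
  | zero => exact h4
  | succ k =>
    rw [chi, sub_apply, h4, cutΘ_eq_zero D (by norm_num) _ (by linarith), sub_zero]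

theorem chi_succ_eq_zero (D : LPData d) (k : ℕ) {ζ : RD d} (h : ‖ζ‖ < 1 / 8) :
    chi D (k + 1) ζ = 0 := by
  rw [chi, sub_apply, cutΘ_eq_one D (by norm_num) _ (by linarith),
    cutΘ_eq_one D (by norm_num) _ h, sub_self]

theorem chi_mul_LPhat (D : LPData d) (k : ℕ) (ξ : RD d) :
    chi D k (((2 : ℝ) ^ k)⁻¹ • ξ) * LPhat D k ξ = LPhat D k ξ := by
  by_cases h0 : LPhat D k ξ = 0
  · rw [h0, mul_zero]
  obtain ⟨h1, h2⟩ := LPhat_support D k h0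
  have hp : (0 : ℝ) < 2 ^ k := by positivity
  have h3 : ‖((2 : ℝ) ^ k)⁻¹ • ξ‖ ≤ 2 := by
    rw [norm_two_pow_inv_smul, div_le_iff₀ hp]; rw [pow_succ] at h1; linarith
  have h4 : cutΘ D 4 (by norm_num) (((2 : ℝ) ^ k)⁻¹ • ξ) = 1 :=
    cutΘ_eq_one D (by norm_num) _ (by linarith)
  cases k with
  | zero => rw [chi, h4, one_mul]
  | succ k =>
    have h5 : 1 / 2 ≤ ‖((2 : ℝ) ^ (k + 1))⁻¹ • ξ‖ := by
      rw [norm_two_pow_inv_smul, le_div_iff₀ hp]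
      have := h2 (by omega); linarith
    rw [chi, sub_apply, h4, cutΘ_eq_zero D (by norm_num) _ (by linarith), sub_zero, one_mul]

theorem tsupport_chi (D : LPData d) (k : ℕ) {ξ : RD d}
    (h : ((2 : ℝ) ^ k)⁻¹ • ξ ∈ tsupport (chi D k)) :
    2 ^ k / 8 ≤ 1 + ‖ξ‖ ∧ ‖ξ‖ ≤ 8 * 2 ^ k := by
  have hp : (0 : ℝ) < 2 ^ k := by positivity
  constructor
  · cases k with
    | zero => have := norm_nonneg ξ; norm_num; linarith
    | succ k =>
      have hc : IsClosed {ζ : RD d | 1 / 8 ≤ ‖ζ‖} := isClosed_le continuous_const continuous_norm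
      have : tsupport (chi D (k + 1)) ⊆ {ζ : RD d | 1 / 8 ≤ ‖ζ‖} :=
        closure_minimal (fun ζ hζ => by
          by_contra h0
          exact hζ (chi_succ_eq_zero D k (not_le.1 h0))) hc
      have h1 := this h
      rw [Set.mem_ofPred, norm_two_pow_inv_smul, le_div_iff₀ hp] at h1
      linarith
  · have hc : IsClosed {ζ : RD d | ‖ζ‖ ≤ 8} := isClosed_le continuous_norm continuous_const
    have : tsupport (chi D k) ⊆ {ζ : RD d | ‖ζ‖ ≤ 8} :=
      closure_minimal (fun ζ hζ => by
        by_contra h0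
        exact hζ (chi_eq_zero D k (not_le.1 h0))) hc
    have h1 := this h
    rwa [Set.mem_ofPred, norm_two_pow_inv_smul, div_le_iff₀ hp] at h1

theorem hasCompactSupport_chi (D : LPData d) (k : ℕ) : HasCompactSupport (chi D k) :=
  HasCompactSupport.intro (isCompact_closedBall (0 : RD d) 8) fun ζ hζ =>
    chi_eq_zero D k (by simpa using hζ)

theorem norm_fourierTD_LPhat_mul_le (D : LPData d) (σ : ℕ) : ∃ (A : ℕ) (C : ℝ), 0 ≤ C ∧
    ∀ (u : TD d) (k : ℕ) (x : RD d) (h : RD d → ℂ) (B S : ℝ) (E : 𝓢(RD d, ℂ)),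
    ContDiff ℝ ∞ h → 0 ≤ B → 0 ≤ S →
    (∀ ξ, E ξ = LPhat D k ξ * (ee x ξ * h ξ)) →
    (∀ ξ, 2 ^ k / 8 ≤ 1 + ‖ξ‖ → ‖ξ‖ ≤ 8 * 2 ^ k → ∀ l ≤ A,
      ‖iteratedFDeriv ℝ l h ξ‖ ≤ B * (((2 : ℝ) ^ k)⁻¹) ^ l) →
    (∀ y, ‖LPdist D k u y‖ ≤ S * (1 + ‖(2 : ℝ) ^ k • (x - y)‖) ^ σ) →
    ‖fourierTD u E‖ ≤ C * B * S := by
  obtain ⟨A₀, C₀, hC₀, hb₀⟩ := norm_fourierTD_mulS_modulated_le D (chi D 0) σ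
  obtain ⟨A₁, C₁, hC₁, hb₁⟩ := norm_fourierTD_mulS_modulated_le D (chi D 1) σ
  refine ⟨max A₀ A₁, C₀ + C₁, by positivity, fun u k x h B S E hh hB hS hE hd hf => ?_⟩
  have hcs : HasCompactSupport (fun ξ => chi D k (((2 : ℝ) ^ k)⁻¹ • ξ) * (ee x ξ * h ξ)) := by
    refine HasCompactSupport.mul_right ?_
    exact (hasCompactSupport_chi D k).comp_smul (two_pow_inv_ne k)
  have hsm : ContDiff ℝ ∞ (fun ξ => chi D k (((2 : ℝ) ^ k)⁻¹ • ξ) * (ee x ξ * h ξ)) :=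
    (((chi D k).smooth ⊤).comp (contDiff_const_smul _)).mul ((contDiff_ee_right x).mul hh)
  set H : 𝓢(RD d, ℂ) := hcs.toSchwartzMap hsm with hH
  have hHa : ∀ ξ, H ξ = chi D k (((2 : ℝ) ^ k)⁻¹ • ξ) * (ee x ξ * h ξ) := fun ξ => rfl
  have hEH : E = mulS (LPhatS D k) H := by
    ext ξ
    rw [mulS_apply, LPhatS_apply, hHa, hE]
    linear_combination (-(ee x ξ * h ξ)) * chi_mul_LPhat D k ξ
  have hd' : ∀ ξ, ((2 : ℝ) ^ k)⁻¹ • ξ ∈ tsupport (chi D k) → ∀ l ≤ max A₀ A₁,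
      ‖iteratedFDeriv ℝ l h ξ‖ ≤ B * (((2 : ℝ) ^ k)⁻¹) ^ l := fun ξ hξ =>
    hd ξ (tsupport_chi D k hξ).1 (tsupport_chi D k hξ).2
  have hBS : 0 ≤ B * S := by positivity
  rw [hEH]
  cases k with
  | zero =>
    refine (hb₀ u 0 x h H B S hh hB hS hHa (fun ξ hξ l hl => hd' ξ hξ l (hl.trans (le_max_left _ _)))
      hf).trans ?_
    nlinarith
  | succ k =>
    refine (hb₁ u (k + 1) x h H B S hh hB hS hHa
      (fun ξ hξ l hl => hd' ξ hξ l (hl.trans (le_max_right _ _))) hf).trans ?_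
    nlinarith

/-! ### Peetre-type pointwise estimates -/

theorem norm_one_sub_ee_le (w ξ : RD d) : ‖1 - ee w ξ‖ ≤ 2 * Real.pi * (‖w‖ * ‖ξ‖) := by
  have h1 := Real.norm_exp_I_mul_ofReal_sub_one_le (x := 2 * Real.pi * ⟪w, ξ⟫)
  have h2 : Complex.exp (Complex.I * ((2 * Real.pi * ⟪w, ξ⟫ : ℝ) : ℂ)) = ee w ξ := by
    rw [ee]; congr 1; push_cast; ring
  rw [h2, norm_sub_rev, Real.norm_eq_abs, abs_mul, abs_of_pos (by positivity)] at h1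
  refine h1.trans ?_
  gcongr
  exact abs_real_inner_le_norm w ξ

theorem norm_deriv_one_sub_ee_le {A l : ℕ} (hl : l ≤ A) {δ : ℝ} (hδ : 0 ≤ δ) (hδ1 : δ ≤ 1) (k : ℕ)
    {w ξ : RD d} (hw : ‖w‖ ≤ δ * ((2 : ℝ) ^ k)⁻¹) (hξ : ‖ξ‖ ≤ 8 * 2 ^ k) :
    ‖iteratedFDeriv ℝ l (fun ξ => 1 - ee w ξ) ξ‖
      ≤ 8 * (2 * Real.pi) ^ (A + 1) * δ * (((2 : ℝ) ^ k)⁻¹) ^ l := by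
  have hπ : 1 ≤ 2 * Real.pi := by have := Real.pi_gt_three; linarith
  have hp : (0 : ℝ) < 2 ^ k := by positivity
  rcases Nat.eq_zero_or_pos l with rfl | hl0
  · rw [norm_iteratedFDeriv_zero, pow_zero, mul_one]
    calc _ ≤ 2 * Real.pi * ((δ * ((2 : ℝ) ^ k)⁻¹) * (8 * 2 ^ k)) :=
          (norm_one_sub_ee_le w ξ).trans (by gcongr)
      _ = 8 * (2 * Real.pi) ^ 1 * δ := by field_simp
      _ ≤ _ := by gcongr; omega
  · have h1 : iteratedFDeriv ℝ l (fun ξ => 1 - ee w ξ) ξ = - iteratedFDeriv ℝ l (ee w) ξ := by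
      have h2 : (fun ξ => 1 - ee w ξ) = (fun _ : RD d => (1 : ℂ)) - ee w := rfl
      rw [h2, iteratedFDeriv_sub_apply contDiffAt_const
        ((contDiff_ee_right w).of_le (by exact_mod_cast le_top)).contDiffAt,
        iteratedFDeriv_const_of_ne hl0.ne']
      simp
    rw [h1, norm_neg]
    calc _ ≤ (2 * Real.pi * ‖w‖) ^ l := norm_iteratedFDeriv_ee_le l w ξ
      _ ≤ (2 * Real.pi * (δ * ((2 : ℝ) ^ k)⁻¹)) ^ l := by gcongr
      _ = 1 * (2 * Real.pi) ^ l * δ ^ l * (((2 : ℝ) ^ k)⁻¹) ^ l := by rw [mul_pow, mul_pow]; ring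
      _ ≤ _ := by
        gcongr
        · norm_num
        · omega
        · calc δ ^ l ≤ δ ^ 1 := pow_le_pow_of_le_one hδ hδ1 hl0
            _ = δ := pow_one δ

/-- The weighted mean of `|f_k|^q` around `x` at scale `2^{-k}`. -/
def WW (D : LPData d) (q τ : ℝ) (k : ℕ) (u : TD d) (x : RD d) : ℝ≥0∞ :=
  ∫⁻ z, ENNReal.ofReal ‖LPdist D k u (x - ((2 : ℝ) ^ k)⁻¹ • z)‖ ^ q
    * ENNReal.ofReal ((1 + ‖z‖) ^ (-τ))

theorem LPdist_sub_le (D : LPData d) (σ : ℕ) : ∃ δ : ℝ, 0 < δ ∧ δ ≤ 1 ∧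
    ∀ (u : TD d) (k : ℕ) (y z : RD d) (S : ℝ), 0 ≤ S → ‖(2 : ℝ) ^ k • (z - y)‖ ≤ δ →
    (∀ w, ‖LPdist D k u w‖ ≤ S * (1 + ‖(2 : ℝ) ^ k • (y - w)‖) ^ σ) →
    ‖LPdist D k u y - LPdist D k u z‖ ≤ S / 2 := by
  obtain ⟨A, C, hC, hb⟩ := norm_fourierTD_LPhat_mul_le D σ
  set Q := C * (8 * (2 * Real.pi) ^ (A + 1)) with hQ
  have hQ0 : 0 ≤ Q := by positivity
  refine ⟨(2 * Q + 1)⁻¹, by positivity, inv_le_one_of_one_le₀ (by linarith),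
    fun u k y z S hS hyz hf => ?_⟩
  set δ := (2 * Q + 1)⁻¹ with hδ
  have hδ0 : 0 < δ := by positivity
  have hδ1 : δ ≤ 1 := inv_le_one_of_one_le₀ (by linarith)
  have hw : ‖z - y‖ ≤ δ * ((2 : ℝ) ^ k)⁻¹ := by
    rw [norm_smul, norm_pow, Real.norm_ofNat] at hyz
    rw [← div_eq_mul_inv, le_div_iff₀ (by positivity)]; linarith
  have h1 := hb u k y (fun ξ => 1 - ee (z - y) ξ) (8 * (2 * Real.pi) ^ (A + 1) * δ) S
    (reg_ee.cut (LPhatS D k) y - reg_ee.cut (LPhatS D k) z)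
    (contDiff_const.sub (contDiff_ee_right _)) (by positivity) hS (fun ξ => ?_)
    (fun ξ _ hξ l hl => norm_deriv_one_sub_ee_le hl hδ0.le hδ1 k hw hξ) hf
  · rw [LPdist_eq, LPdist_eq, ← map_sub]
    refine h1.trans ?_
    have h2 : Q * δ ≤ 1 / 2 := by
      rw [hδ, ← div_eq_mul_inv, div_le_iff₀ (by positivity)]; linarith
    calc _ = (Q * δ) * S := by rw [hQ]; ring
      _ ≤ 1 / 2 * S := by gcongr
      _ = _ := by ring
  · rw [sub_apply, Reg.cut_apply, Reg.cut_apply, LPhatS_apply]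
    have h2 : ee z ξ = ee y ξ * ee (z - y) ξ := by rw [← ee_add]; congr 1; abel
    rw [h2]; ring

theorem peetre_le (D : LPData d) (σ : ℕ) {q : ℝ} (hq : 0 < q) : ∃ C : ℝ≥0,
    ∀ (u : TD d) (k : ℕ) (x : RD d) (K : ℝ),
    (∀ y, ‖LPdist D k u y‖ ≤ K * (1 + ‖(2 : ℝ) ^ k • (x - y)‖) ^ σ) →
    ∃ S : ℝ, 0 ≤ S ∧ (∀ y, ‖LPdist D k u y‖ ≤ S * (1 + ‖(2 : ℝ) ^ k • (x - y)‖) ^ σ) ∧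
      ENNReal.ofReal S ^ q ≤ C * WW D q (σ * q) k u x := by
  obtain ⟨δ, hδ, hδ1, hsub⟩ := LPdist_sub_le D σ
  set V := volume (Metric.ball (0 : RD d) δ) with hV
  have hV0 : V ≠ 0 := (Metric.measure_ball_pos volume _ hδ).ne'
  have hVt : V ≠ ⊤ := measure_ball_lt_top.ne
  set c : ℝ := (1 / 4) ^ q * 2 ^ (-(σ * q : ℝ)) with hc
  have hc0 : 0 < c := by positivity
  have hcV : ENNReal.ofReal c * V ≠ 0 := mul_ne_zero (by simpa using hc0) hV0
  have hcVt : ENNReal.ofReal c * V ≠ ⊤ := ENNReal.mul_ne_top ENNReal.ofReal_ne_top hVt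
  refine ⟨(ENNReal.ofReal c * V)⁻¹.toNNReal, fun u k x K hK => ?_⟩
  rw [ENNReal.coe_toNNReal (ENNReal.inv_ne_top.2 hcV)]
  have h2k : (0 : ℝ) < 2 ^ k := by positivity
  set T : RD d → ℝ := fun y => 1 + ‖(2 : ℝ) ^ k • (x - y)‖ with hT
  have hT1 : ∀ y, 1 ≤ T y := fun y => one_le_one_add_norm _
  have hTp : ∀ y, 0 < T y ^ σ := fun y => pow_pos (by linarith [hT1 y]) σ
  set g : RD d → ℝ := fun y => ‖LPdist D k u y‖ / T y ^ σ with hg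
  have hg0 : ∀ y, 0 ≤ g y := fun y => div_nonneg (norm_nonneg _) (hTp y).le
  have hbdd : BddAbove (Set.range g) := ⟨K, by
    rintro _ ⟨y, rfl⟩
    exact (div_le_iff₀ (hTp y)).2 (hK y)⟩
  set S := ⨆ y, g y with hS
  have hS0 : 0 ≤ S := (hg0 x).trans (le_ciSup hbdd x)
  have hSb : ∀ y, ‖LPdist D k u y‖ ≤ S * T y ^ σ := fun y =>
    (div_le_iff₀ (hTp y)).1 (le_ciSup hbdd y)
  refine ⟨S, hS0, hSb, ?_⟩
  rcases hS0.eq_or_lt with h0 | hSpos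
  · rw [← h0, ENNReal.ofReal_zero, ENNReal.zero_rpow_of_pos hq]; exact zero_le
  obtain ⟨y, hy⟩ := exists_lt_of_lt_ciSup (show 3 / 4 * S < ⨆ y, g y by linarith)
  have hy' : 3 / 4 * S * T y ^ σ < ‖LPdist D k u y‖ := (lt_div_iff₀ (hTp y)).1 hy
  have hfy : ∀ w, ‖LPdist D k u w‖ ≤ (S * T y ^ σ) * (1 + ‖(2 : ℝ) ^ k • (y - w)‖) ^ σ := by
    intro w
    refine (hSb w).trans ?_
    rw [mul_assoc, ← mul_pow]
    have h1 : T w ≤ T y * (1 + ‖(2 : ℝ) ^ k • (y - w)‖) := by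
      have h2 : (2 : ℝ) ^ k • (x - w) = (2 : ℝ) ^ k • (x - y) + (2 : ℝ) ^ k • (y - w) := by
        rw [← smul_add]; congr 1; abel
      have h3 := norm_add_le ((2 : ℝ) ^ k • (x - y)) ((2 : ℝ) ^ k • (y - w))
      simp only [hT]
      rw [h2]
      nlinarith [norm_nonneg ((2 : ℝ) ^ k • (x - y)), norm_nonneg ((2 : ℝ) ^ k • (y - w))]
    have h0 : 0 ≤ T w := by linarith [hT1 w]
    gcongr
  have hlow : ENNReal.ofReal S ^ q * (ENNReal.ofReal c * V) ≤ WW D q (σ * q) k u x := by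
    have hVc : V = volume (Metric.ball ((2 : ℝ) ^ k • (x - y)) δ) :=
      (Measure.addHaar_ball_center volume _ δ).symm
    rw [hVc, ← mul_assoc, ← setLIntegral_const, WW]
    refine le_trans (setLIntegral_mono' measurableSet_ball fun z hz => ?_) (setLIntegral_le_lintegral _ _)
    have hz' : ‖z - (2 : ℝ) ^ k • (x - y)‖ < δ := by rwa [mem_ball_iff_norm] at hz
    have hzT : 1 + ‖z‖ ≤ 2 * T y := by
      have h1 := norm_add_le (z - (2 : ℝ) ^ k • (x - y)) ((2 : ℝ) ^ k • (x - y))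
      rw [sub_add_cancel] at h1
      simp only [hT]
      linarith [norm_nonneg ((2 : ℝ) ^ k • (x - y))]
    have h1 := hsub u k y (x - ((2 : ℝ) ^ k)⁻¹ • z) (S * T y ^ σ) (by have := hTp y; positivity) (by
      have h3 : (2 : ℝ) ^ k • (x - ((2 : ℝ) ^ k)⁻¹ • z - y) = -(z - (2 : ℝ) ^ k • (x - y)) := by
        rw [smul_sub, smul_sub, smul_smul, mul_inv_cancel₀ h2k.ne', one_smul, smul_sub]; abel
      rw [h3, norm_neg]; exact hz'.le) hfy
    have h2 : S / 4 * T y ^ σ ≤ ‖LPdist D k u (x - ((2 : ℝ) ^ k)⁻¹ • z)‖ := by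
      have h3 := norm_sub_norm_le (LPdist D k u y) (LPdist D k u (x - ((2 : ℝ) ^ k)⁻¹ • z))
      linarith
    have hTy := hT1 y
    have hTσ := hTp y
    calc ENNReal.ofReal S ^ q * ENNReal.ofReal c
        = ENNReal.ofReal (S / 4 * T y ^ σ) ^ q * ENNReal.ofReal ((2 * T y) ^ (-(σ * q : ℝ))) := by
          rw [ENNReal.ofReal_rpow_of_nonneg hS0 hq.le,
            ENNReal.ofReal_rpow_of_nonneg (by positivity) hq.le, ← ENNReal.ofReal_mul (by positivity),
            ← ENNReal.ofReal_mul (by positivity)]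
          congr 1
          have e1 : (T y ^ σ) ^ q = T y ^ (σ * q : ℝ) := by
            rw [← Real.rpow_natCast, ← Real.rpow_mul (by linarith)]
          have e2 : T y ^ (σ * q : ℝ) * T y ^ (-(σ * q : ℝ)) = 1 := by
            rw [← Real.rpow_add (by linarith)]; simp
          rw [hc, show S / 4 = S * (1 / 4) by ring, Real.mul_rpow (by positivity) hTσ.le,
            Real.mul_rpow hS0 (by norm_num), e1, Real.mul_rpow (by norm_num) (by linarith)]
          linear_combination (-(S ^ q * (1 / 4) ^ q * 2 ^ (-(σ * q : ℝ)))) * e2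
      _ ≤ _ := by
        gcongr ENNReal.ofReal ?_ ^ _ * ENNReal.ofReal ?_
        refine Real.rpow_le_rpow_of_nonpos (by positivity) hzT ?_
        have : 0 ≤ (σ : ℝ) * q := by positivity
        linarith
  rw [mul_comm, ← div_eq_mul_inv, ENNReal.le_div_iff_mul_le (Or.inl hcV) (Or.inl hcVt)]
  exact hlow

/-! ### Dyadic cubes -/

theorem mem_dyadicCube_iff (μ : ℕ) (n : Fin d → ℤ) (x : RD d) :
    x ∈ dyadicCube d μ n ↔ ∀ i, ⌊(2 : ℝ) ^ μ * x i⌋ = n i := by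
  have hp : (0 : ℝ) < 2 ^ μ := by positivity
  refine forall_congr' fun i => ?_
  rw [Int.floor_eq_iff, zpow_neg, zpow_natCast, ← div_eq_mul_inv, ← div_eq_mul_inv,
    div_le_iff₀ hp, lt_div_iff₀ hp, mul_comm (x i)]

theorem measurableSet_dyadicCube (μ : ℕ) (n : Fin d → ℤ) : MeasurableSet (dyadicCube d μ n) := by
  have : dyadicCube d μ n = ⋂ i, {x : RD d | ⌊(2 : ℝ) ^ μ * x i⌋ = n i} := by
    ext x; rw [mem_dyadicCube_iff]; simp
  rw [this]
  refine MeasurableSet.iInter fun i => ?_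
  have hm : Measurable fun x : RD d => ⌊(2 : ℝ) ^ μ * x i⌋ := by fun_prop
  exact hm (measurableSet_singleton (n i))

theorem volume_dyadicCube (μ : ℕ) (n : Fin d → ℤ) :
    (2 : ℝ≥0∞) ^ ((μ : ℝ) * (d : ℝ)) * volume (dyadicCube d μ n) = 1 := by
  have hp : (0 : ℝ) < 2 ^ μ := by positivity
  have h1 : dyadicCube d μ n = (WithLp.ofLp : RD d → (Fin d → ℝ)) ⁻¹' Set.pi Set.univ
      (fun i => Set.Ico ((n i : ℝ) * (2 : ℝ) ^ (-(μ : ℤ))) (((n i : ℝ) + 1) * (2 : ℝ) ^ (-(μ : ℤ)))) := by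
    ext x; simp [dyadicCube]
  rw [h1, (PiLp.volume_preserving_ofLp (Fin d)).measure_preimage
    (MeasurableSet.univ_pi fun i => measurableSet_Ico).nullMeasurableSet, Real.volume_pi_Ico]
  have h2 : ∀ i, ((n i : ℝ) + 1) * (2 : ℝ) ^ (-(μ : ℤ)) - (n i : ℝ) * (2 : ℝ) ^ (-(μ : ℤ))
      = ((2 : ℝ) ^ μ)⁻¹ := fun i => by rw [zpow_neg, zpow_natCast]; ring
  simp only [h2, Finset.prod_const, Finset.card_univ, Fintype.card_fin]
  rw [ENNReal.ofReal_inv_of_pos hp, ENNReal.ofReal_pow (by norm_num), ENNReal.ofReal_ofNat,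
    ENNReal.rpow_mul, ENNReal.rpow_natCast, ENNReal.rpow_natCast, ← ENNReal.inv_pow]
  refine ENNReal.mul_inv_cancel ?_ ?_
  · positivity
  · exact ENNReal.pow_ne_top (ENNReal.pow_ne_top (by norm_num))

theorem exists_mem_dyadicCube (μ : ℕ) (x : RD d) : ∃ n, x ∈ dyadicCube d μ n :=
  ⟨fun i => ⌊(2 : ℝ) ^ μ * x i⌋, (mem_dyadicCube_iff _ _ _).2 fun _ => rfl⟩

theorem norm_sub_le_of_mem_dyadicCube {μ : ℕ} {n : Fin d → ℤ} {x y : RD d}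
    (hx : x ∈ dyadicCube d μ n) (hy : y ∈ dyadicCube d μ n) :
    ‖(2 : ℝ) ^ μ • (x - y)‖ ≤ d := by
  rw [mem_dyadicCube_iff] at hx hy
  rw [EuclideanSpace.norm_eq, Real.sqrt_le_left (by positivity)]
  have h1 : ∀ i, ‖((2 : ℝ) ^ μ • (x - y)) i‖ ^ 2 ≤ 1 := by
    intro i
    have h2 := Int.abs_sub_lt_one_of_floor_eq_floor ((hx i).trans (hy i).symm)
    have h3 : ((2 : ℝ) ^ μ • (x - y)) i = 2 ^ μ * x i - 2 ^ μ * y i := by simp [mul_sub]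
    rw [h3, Real.norm_eq_abs]
    exact pow_le_one₀ (abs_nonneg _) h2.le
  calc _ ≤ ∑ i : Fin d, (1 : ℝ) := Finset.sum_le_sum fun i _ => h1 i
    _ = (d : ℝ) := by simp
    _ ≤ (d : ℝ) ^ 2 := by
      have : d ≤ d ^ 2 := Nat.le_self_pow (by norm_num) d
      exact_mod_cast this

/-- Translations by vectors of size at most `R` cube lengths. -/
def nbrs (d : ℕ) (R : ℕ) : Finset (Fin d → ℤ) :=
  Fintype.piFinset fun _ => Finset.Icc (-(R : ℤ)) R

theorem card_nbrs (d R : ℕ) : (nbrs d R).card = (2 * R + 1) ^ d := by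
  rw [nbrs, Fintype.card_piFinset_const, Int.card_Icc]
  congr 1; omega

theorem exists_nbr {μ : ℕ} {n : Fin d → ℤ} {x w : RD d} {R : ℕ} (hw : ‖(2 : ℝ) ^ μ • w‖ + 1 ≤ R)
    (hx : x + w ∈ dyadicCube d μ n) : ∃ p ∈ nbrs d R, x ∈ dyadicCube d μ (n + p) := by
  obtain ⟨n', hn'⟩ := exists_mem_dyadicCube μ x
  refine ⟨n' - n, ?_, by rwa [add_sub_cancel]⟩
  rw [nbrs, Fintype.mem_piFinset]
  intro i
  have h1 := (mem_dyadicCube_iff _ _ _).1 hx i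
  have h2 := (mem_dyadicCube_iff _ _ _).1 hn' i
  rw [Int.floor_eq_iff] at h1 h2
  have h3 : |(2 : ℝ) ^ μ * w i| ≤ ‖(2 : ℝ) ^ μ • w‖ := by
    have := PiLp.norm_apply_le ((2 : ℝ) ^ μ • w) i
    simpa [abs_mul] using this
  rw [abs_le] at h3
  simp only [PiLp.add_apply, mul_add] at h1
  rw [Finset.mem_Icc, Pi.sub_apply]
  constructor
  · have : -(R : ℝ) < (n' i : ℝ) - n i + 1 := by linarith
    have h4 : -(R : ℤ) < n' i - n i + 1 := by exact_mod_cast this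
    omega
  · have : (n' i : ℝ) - n i < R := by linarith
    have h4 : n' i - n i < (R : ℤ) := by exact_mod_cast this
    omega

theorem setLIntegral_dyadicCube_sub_le {F : RD d → ℝ≥0∞} (hF : Measurable F) (μ : ℕ)
    (n : Fin d → ℤ) (w : RD d) {R : ℕ} (hw : ‖(2 : ℝ) ^ μ • w‖ + 1 ≤ R) :
    ∫⁻ x in dyadicCube d μ n, F (x - w)
      ≤ ∑ p ∈ nbrs d R, ∫⁻ x in dyadicCube d μ (n + p), F x := by
  have hm := measurableSet_dyadicCube (d := d) μ
  calc _ = ∫⁻ x, (dyadicCube d μ n).indicator (fun x => F (x - w)) x :=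
        (lintegral_indicator (hm n) _).symm
    _ = ∫⁻ x, (fun y => (dyadicCube d μ n).indicator (fun x => F (x - w)) (y + w)) (x - w) := by
        simp only [sub_add_cancel]
    _ = ∫⁻ y, (dyadicCube d μ n).indicator (fun x => F (x - w)) (y + w) :=
        lintegral_sub_right_eq_self (μ := (volume : Measure (RD d)))
          (fun y => (dyadicCube d μ n).indicator (fun x => F (x - w)) (y + w)) w
    _ ≤ ∫⁻ y, ∑ p ∈ nbrs d R, (dyadicCube d μ (n + p)).indicator F y := by
        refine lintegral_mono fun y => ?_
        by_cases hy : y + w ∈ dyadicCube d μ n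
        · obtain ⟨p, hp, hyp⟩ := exists_nbr hw hy
          rw [Set.indicator_of_mem hy, add_sub_cancel_right]
          calc F y = (dyadicCube d μ (n + p)).indicator F y := (Set.indicator_of_mem hyp F).symm
            _ ≤ _ := Finset.single_le_sum
              (f := fun p => (dyadicCube d μ (n + p)).indicator F y) (fun _ _ => zero_le) hp
        · rw [Set.indicator_of_notMem hy]; exact zero_le
    _ = _ := by
        rw [lintegral_finsetSum _ fun p _ => hF.indicator (hm _)]
        exact Finset.sum_congr rfl fun p _ => lintegral_indicator (hm _) _

/-! ### Means over cubes -/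

theorem continuous_LPdist (D : LPData d) (k : ℕ) (u : TD d) : Continuous (LPdist D k u) := by
  have : LPdist D k u = fun x => fourierTD u (reg_ee.cut (LPhatS D k) x) :=
    funext fun x => LPdist_eq D k u x
  rw [this]
  exact (fourierTD u).continuous.comp (reg_ee.polyFam_cut (LPhatS D k)).cont

/-- `2^{skq}|f_k|^q`. -/
def fq (D : LPData d) (s q : ℝ) (u : TD d) (k : ℕ) (x : RD d) : ℝ≥0∞ :=
  (2 : ℝ≥0∞) ^ (s * k * q) * ENNReal.ofReal ‖LPdist D k u x‖ ^ q

theorem measurable_fq (D : LPData d) (s q : ℝ) (u : TD d) (k : ℕ) : Measurable (fq D s q u k) := by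
  have := (continuous_LPdist D k u).measurable
  unfold fq
  fun_prop

theorem cubePiece_eq (D : LPData d) (s q : ℝ) (u : TD d) (μ : ℕ) (n : Fin d → ℤ) :
    cubePiece d μ n μ s q (fun k x => LPdist D k u x) = ((2 : ℝ≥0∞) ^ ((μ : ℝ) * (d : ℝ)) *
      ∫⁻ x in dyadicCube d μ n, ∑' j : ℕ, fq D s q u (μ + j) x) ^ (1 / q) := by
  unfold cubePiece fq
  simp only [ofReal_norm, Nat.cast_add]
  rfl

theorem cube_le_norm (D : LPData d) (s : ℝ) {q : ℝ} (hq : 0 < q) (u : TD d) {μ : ℕ} (hμ : 1 ≤ μ)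
    (n : Fin d → ℤ) : (2 : ℝ≥0∞) ^ ((μ : ℝ) * (d : ℝ)) *
      ∫⁻ x in dyadicCube d μ n, ∑' j : ℕ, fq D s q u (μ + j) x ≤ FinftyNormDist D s q u ^ q := by
  have h1 : cubePiece d μ n μ s q (fun k x => LPdist D k u x) ≤ FinftyNormDist D s q u := by
    refine le_trans ?_ le_add_self
    exact le_iSup₂_of_le μ hμ (le_iSup_of_le n le_rfl)
  rw [cubePiece_eq] at h1
  have h2 := ENNReal.rpow_le_rpow h1 hq.le
  rwa [← ENNReal.rpow_mul, one_div, inv_mul_cancel₀ hq.ne', ENNReal.rpow_one] at h2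

theorem norm_zero_le_norm (D : LPData d) (s q : ℝ) (u : TD d) (x : RD d) :
    ENNReal.ofReal ‖LPdist D 0 u x‖ ≤ FinftyNormDist D s q u := by
  refine le_trans ?_ le_self_add
  rw [ofReal_norm]
  exact le_iSup (fun x => (‖LPdist D 0 u x‖₊ : ℝ≥0∞)) x

/-- The constant in the cube estimate. -/
def wconst (d : ℕ) (τ : ℝ) : ℝ≥0∞ :=
  ∫⁻ z : RD d, ENNReal.ofReal ((1 + ‖z‖) ^ (-τ)) * ENNReal.ofReal ((7 * (1 + ‖z‖)) ^ d)

theorem wconst_ne_top {τ : ℝ} (hτ : 2 * d < τ) : wconst d τ ≠ ⊤ := by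
  have h1 := finite_integral_one_add_norm (E := RD d) (μ := volume) (r := τ - d)
    (by simp; linarith)
  have h2 : wconst d τ = ENNReal.ofReal (7 ^ d) *
      ∫⁻ z : RD d, ENNReal.ofReal ((1 + ‖z‖) ^ (-(τ - d))) := by
    rw [wconst, ← lintegral_const_mul _ (by fun_prop)]
    refine lintegral_congr fun z => ?_
    have hp : 0 < 1 + ‖z‖ := by positivity
    rw [← ENNReal.ofReal_mul (by positivity), ← ENNReal.ofReal_mul (by positivity)]
    congr 1
    rw [neg_sub, sub_eq_add_neg, Real.rpow_add hp, Real.rpow_natCast, mul_pow]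
    ring
  rw [h2]
  exact ENNReal.mul_ne_top ENNReal.ofReal_ne_top h1.ne

theorem two_rpow_ne_top (t : ℝ) : (2 : ℝ≥0∞) ^ t ≠ ⊤ :=
  ENNReal.rpow_ne_top_of_ne_zero (by norm_num) (by norm_num)

theorem tsum_WW_eq (D : LPData d) (s q τ : ℝ) (u : TD d) (μ : ℕ) (x : RD d) :
    ∑' j : ℕ, (2 : ℝ≥0∞) ^ (s * ((μ + j : ℕ) : ℝ) * q) * WW D q τ (μ + j) u x
      = ∫⁻ z, ∑' j : ℕ, fq D s q u (μ + j) (x - ((2 : ℝ) ^ (μ + j))⁻¹ • z)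
        * ENNReal.ofReal ((1 + ‖z‖) ^ (-τ)) := by
  have hx : ∀ j, Measurable fun z : RD d =>
      fq D s q u (μ + j) (x - ((2 : ℝ) ^ (μ + j))⁻¹ • z) * ENNReal.ofReal ((1 + ‖z‖) ^ (-τ)) :=
    fun j => ((measurable_fq D s q u (μ + j)).comp (by fun_prop)).mul (by fun_prop)
  rw [lintegral_tsum fun j => (hx j).aemeasurable]
  refine tsum_congr fun j => ?_
  rw [WW, ← lintegral_const_mul' _ _ (two_rpow_ne_top _)]
  refine lintegral_congr fun z => ?_
  rw [fq, ← mul_assoc]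

set_option maxHeartbeats 1000000 in
theorem cube_WW_le (D : LPData d) (s : ℝ) {q : ℝ} (hq : 0 < q) (τ : ℝ) (u : TD d) {μ : ℕ}
    (hμ : 1 ≤ μ) (n : Fin d → ℤ) : (2 : ℝ≥0∞) ^ ((μ : ℝ) * (d : ℝ)) *
      ∫⁻ x in dyadicCube d μ n, ∑' j : ℕ, (2 : ℝ≥0∞) ^ (s * ((μ + j : ℕ) : ℝ) * q)
        * WW D q τ (μ + j) u x ≤ wconst d τ * FinftyNormDist D s q u ^ q := by
  set N := FinftyNormDist D s q u ^ q with hN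
  set c := (2 : ℝ≥0∞) ^ ((μ : ℝ) * (d : ℝ)) with hc
  have hct : c ≠ ⊤ := two_rpow_ne_top _
  set wt : RD d → ℝ≥0∞ := fun z => ENNReal.ofReal ((1 + ‖z‖) ^ (-τ)) with hwt
  have hwm : Measurable wt := by simp only [hwt]; fun_prop
  have hfm := measurable_fq D s q u
  have hjm : ∀ j, Measurable fun p : RD d × RD d =>
      fq D s q u (μ + j) (p.1 - ((2 : ℝ) ^ (μ + j))⁻¹ • p.2) * wt p.2 := fun j =>
    ((hfm (μ + j)).comp (by fun_prop)).mul (hwm.comp measurable_snd)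
  simp only [tsum_WW_eq D s q τ u μ]
  rw [lintegral_lintegral_swap (Measurable.tsum hjm).aemeasurable,
    ← lintegral_const_mul' _ _ hct, wconst, ← lintegral_mul_const _ (by fun_prop)]
  refine lintegral_mono fun z => ?_
  set R := ⌈‖z‖⌉₊ + 1 with hR
  have hRz : ‖z‖ + 1 ≤ R := by
    rw [hR]; push_cast; linarith [Nat.le_ceil ‖z‖]
  have hw : ∀ j : ℕ, ‖(2 : ℝ) ^ μ • (((2 : ℝ) ^ (μ + j))⁻¹ • z)‖ + 1 ≤ R := by
    intro j
    refine le_trans ?_ hRz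
    have : (2 : ℝ) ^ μ * ((2 : ℝ) ^ (μ + j))⁻¹ ≤ 1 := by
      rw [← div_eq_mul_inv]
      exact div_le_one_of_le₀ (pow_le_pow_right₀ (by norm_num) (by omega)) (by positivity)
    rw [smul_smul, norm_smul, Real.norm_of_nonneg (by positivity)]
    nlinarith [norm_nonneg z]
  have hcard : ((nbrs d R).card : ℝ≥0∞) ≤ ENNReal.ofReal ((7 * (1 + ‖z‖)) ^ d) := by
    rw [card_nbrs, ← ENNReal.ofReal_natCast]
    refine ENNReal.ofReal_le_ofReal ?_
    push_cast
    gcongr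
    have := (Nat.ceil_lt_add_one (norm_nonneg z)).le
    rw [hR]; push_cast; linarith [norm_nonneg z]
  have hxm : ∀ j, Measurable fun x : RD d => fq D s q u (μ + j) (x - ((2 : ℝ) ^ (μ + j))⁻¹ • z) :=
    fun j => (hfm (μ + j)).comp (by fun_prop)
  calc c * ∫⁻ x in dyadicCube d μ n,
        ∑' j : ℕ, fq D s q u (μ + j) (x - ((2 : ℝ) ^ (μ + j))⁻¹ • z) * wt z
      = c * ((∑' j : ℕ, ∫⁻ x in dyadicCube d μ n,
        fq D s q u (μ + j) (x - ((2 : ℝ) ^ (μ + j))⁻¹ • z)) * wt z) := by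
        simp only [ENNReal.tsum_mul_right]
        rw [lintegral_mul_const _ (Measurable.tsum hxm), lintegral_tsum fun j => (hxm j).aemeasurable]
    _ ≤ c * ((∑' j : ℕ, ∑ p ∈ nbrs d R, ∫⁻ x in dyadicCube d μ (n + p), fq D s q u (μ + j) x)
        * wt z) := by
        gcongr with j
        exact setLIntegral_dyadicCube_sub_le (hfm (μ + j)) μ n _ (hw j)
    _ = (∑ p ∈ nbrs d R, c * ∫⁻ x in dyadicCube d μ (n + p), ∑' j : ℕ, fq D s q u (μ + j) x)
        * wt z := by
        rw [Summable.tsum_finsetSum fun _ _ => ENNReal.summable, ← mul_assoc, Finset.mul_sum]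
        congr 1
        refine Finset.sum_congr rfl fun p _ => ?_
        rw [lintegral_tsum fun j => (hfm (μ + j)).aemeasurable]
    _ ≤ (∑ p ∈ nbrs d R, N) * wt z := by
        gcongr with p
        exact cube_le_norm D s hq u hμ _
    _ = wt z * (nbrs d R).card * N := by
        rw [Finset.sum_const, nsmul_eq_mul]; ring
    _ ≤ _ := by gcongr

theorem WW_le_of_near (D : LPData d) (q : ℝ) {τ : ℝ} (hτ : 0 ≤ τ) (k : ℕ) (u : TD d) {x x' : RD d}
    {K : ℝ} (h : ‖(2 : ℝ) ^ k • (x - x')‖ ≤ K) :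
    WW D q τ k u x ≤ ENNReal.ofReal ((1 + K) ^ τ) * WW D q τ k u x' := by
  have h2 : (2 : ℝ) ^ k ≠ 0 := by positivity
  set a := (2 : ℝ) ^ k • (x - x') with ha
  have hK : 0 ≤ K := (norm_nonneg _).trans h
  rw [WW, WW, ← lintegral_const_mul' _ _ ENNReal.ofReal_ne_top]
  rw [← lintegral_add_right_eq_self (μ := (volume : Measure (RD d)))
    (fun z => ENNReal.ofReal ‖LPdist D k u (x - ((2 : ℝ) ^ k)⁻¹ • z)‖ ^ q
    * ENNReal.ofReal ((1 + ‖z‖) ^ (-τ))) a]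
  refine lintegral_mono fun z => ?_
  have h1 : x - ((2 : ℝ) ^ k)⁻¹ • (z + a) = x' - ((2 : ℝ) ^ k)⁻¹ • z := by
    rw [smul_add, ha, smul_smul, inv_mul_cancel₀ h2, one_smul]; abel
  simp only [h1]
  rw [mul_left_comm, ← ENNReal.ofReal_mul (by positivity)]
  gcongr
  have hp : 0 < 1 + ‖z‖ := by positivity
  have hp' : 0 < 1 + ‖z + a‖ := by positivity
  have h3 : 1 + ‖z‖ ≤ (1 + K) * (1 + ‖z + a‖) := by
    have := norm_sub_le (z + a) a
    rw [add_sub_cancel_right] at this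
    nlinarith [norm_nonneg (z + a)]
  have h4 := Real.rpow_le_rpow hp.le h3 hτ
  rw [Real.mul_rpow (by positivity) hp'.le] at h4
  rw [Real.rpow_neg hp.le, Real.rpow_neg hp'.le, ← div_eq_mul_inv, inv_eq_one_div,
    div_le_div_iff₀ (by positivity) (by positivity), one_mul]
  exact h4

theorem WW_le_norm (D : LPData d) (s : ℝ) {q τ : ℝ} (hq : 0 < q) (hτ : 0 ≤ τ) (u : TD d) {k : ℕ}
    (hk : 1 ≤ k) (x : RD d) : (2 : ℝ≥0∞) ^ (s * k * q) * WW D q τ k u x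
      ≤ ENNReal.ofReal ((1 + d) ^ τ) * wconst d τ * FinftyNormDist D s q u ^ q := by
  obtain ⟨n, hn⟩ := exists_mem_dyadicCube k x
  set c := (2 : ℝ≥0∞) ^ ((k : ℝ) * (d : ℝ)) with hc
  set b := (2 : ℝ≥0∞) ^ (s * k * q) with hb
  calc b * WW D q τ k u x = c * ∫⁻ _ in dyadicCube d k n, b * WW D q τ k u x := by
        rw [setLIntegral_const, mul_left_comm, volume_dyadicCube, mul_one]
    _ ≤ c * ∫⁻ x' in dyadicCube d k n, ENNReal.ofReal ((1 + d) ^ τ) * (b * WW D q τ k u x') := by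
        gcongr 1
        refine setLIntegral_mono' (measurableSet_dyadicCube k n) fun x' hx' => ?_
        rw [mul_left_comm]
        gcongr
        exact WW_le_of_near D q hτ k u (norm_sub_le_of_mem_dyadicCube hn hx')
    _ = ENNReal.ofReal ((1 + d) ^ τ) * (c * ∫⁻ x' in dyadicCube d k n, b * WW D q τ k u x') := by
        rw [lintegral_const_mul' _ _ ENNReal.ofReal_ne_top, mul_left_comm]
    _ ≤ ENNReal.ofReal ((1 + d) ^ τ) * (c * ∫⁻ x in dyadicCube d k n, ∑' j : ℕ,
        (2 : ℝ≥0∞) ^ (s * ((k + j : ℕ) : ℝ) * q) * WW D q τ (k + j) u x) := by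
        gcongr with x'
        exact ENNReal.le_tsum (f := fun j : ℕ => (2 : ℝ≥0∞) ^ (s * ((k + j : ℕ) : ℝ) * q)
          * WW D q τ (k + j) u x') 0
    _ ≤ _ := by
        rw [mul_assoc]
        exact mul_le_mul' le_rfl (cube_WW_le D s hq τ u hk n)

/-! ### Uniform Peetre majorants -/

theorem exists_norm_LPdist_le_pow (D : LPData d) (u : TD d) (k : ℕ) :
    ∃ (K : ℝ) (M : ℕ), 0 ≤ K ∧ ∀ y, ‖LPdist D k u y‖ ≤ K * (1 + ‖y‖) ^ M := by
  obtain ⟨n, C, hC, hv⟩ := dist_le_SN (fourierTD u)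
  obtain ⟨C', M, hC', hg⟩ := ((reg_ee (d := d)).polyFam_cut (LPhatS D k)).growth n
  refine ⟨C * C', M, by positivity, fun y => ?_⟩
  rw [LPdist_eq, mul_assoc]
  exact (hv _).trans (mul_le_mul_of_nonneg_left (hg y) hC)

theorem one_add_norm_le_mul (k : ℕ) (x y : RD d) :
    1 + ‖y‖ ≤ (1 + ‖x‖) * (1 + ‖(2 : ℝ) ^ k • (x - y)‖) := by
  have h1 : ‖y‖ ≤ ‖x‖ + ‖x - y‖ := by
    have := norm_sub_le x (x - y)
    rwa [sub_sub_cancel] at this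
  have h2 : ‖x - y‖ ≤ ‖(2 : ℝ) ^ k • (x - y)‖ := by
    rw [norm_smul, Real.norm_of_nonneg (by positivity)]
    have : (1 : ℝ) ≤ 2 ^ k := one_le_pow₀ (by norm_num)
    nlinarith [norm_nonneg (x - y)]
  nlinarith [norm_nonneg x, norm_nonneg ((2 : ℝ) ^ k • (x - y))]

theorem bounded_LPdist (D : LPData d) (s : ℝ) {q : ℝ} (hq : 0 < q) (u : TD d)
    (hN : FinftyNormDist D s q u ≠ ⊤) {k : ℕ} (hk : 1 ≤ k) :
    ∃ K : ℝ, 0 ≤ K ∧ ∀ y, ‖LPdist D k u y‖ ≤ K := by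
  obtain ⟨K, M, hK, hM⟩ := exists_norm_LPdist_le_pow D u k
  obtain ⟨r, hr⟩ := exists_nat_gt (2 * d / q)
  have hσ : 2 * (d : ℝ) < ((M + r : ℕ) : ℝ) * q := by
    have h1 : 2 * (d : ℝ) < r * q := by rwa [div_lt_iff₀ hq] at hr
    push_cast
    nlinarith [mul_nonneg (Nat.cast_nonneg (α := ℝ) M) hq.le]
  obtain ⟨C, hC⟩ := peetre_le D (M + r) hq
  set τ : ℝ := ((M + r : ℕ) : ℝ) * q with hτ
  set b := (2 : ℝ≥0∞) ^ (s * k * q) with hb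
  have hb0 : b ≠ 0 := (ENNReal.rpow_pos (by norm_num) (by norm_num)).ne'
  have hbt : b ≠ ⊤ := two_rpow_ne_top _
  set Z := C * (b⁻¹ * (ENNReal.ofReal ((1 + d) ^ τ) * wconst d τ * FinftyNormDist D s q u ^ q))
    with hZ
  have hZt : Z ≠ ⊤ := by
    refine ENNReal.mul_ne_top ENNReal.coe_ne_top (ENNReal.mul_ne_top (ENNReal.inv_ne_top.2 hb0) ?_)
    exact ENNReal.mul_ne_top (ENNReal.mul_ne_top ENNReal.ofReal_ne_top (wconst_ne_top hσ))
      (ENNReal.rpow_ne_top_of_nonneg hq.le hN)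
  refine ⟨(Z ^ (1 / q)).toReal, ENNReal.toReal_nonneg, fun x => ?_⟩
  obtain ⟨S, hS, hbd, hle⟩ := hC u k x (K * (1 + ‖x‖) ^ (M + r)) fun y => by
    refine (hM y).trans ?_
    rw [mul_assoc, ← mul_pow]
    refine mul_le_mul_of_nonneg_left ?_ hK
    refine (pow_le_pow_right₀ (one_le_one_add_norm y) (Nat.le_add_right M r)).trans ?_
    exact pow_le_pow_left₀ (by positivity) (one_add_norm_le_mul k x y) _
  have h1 : ‖LPdist D k u x‖ ≤ S := by simpa using hbd x
  have h2 : ENNReal.ofReal S ^ q ≤ Z := by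
    refine hle.trans (mul_le_mul' le_rfl ?_)
    rw [← ENNReal.div_eq_inv_mul, ENNReal.le_div_iff_mul_le (Or.inl hb0) (Or.inl hbt), mul_comm]
    exact WW_le_norm D s hq (by positivity) u hk x
  have h3 : ENNReal.ofReal S ≤ Z ^ (1 / q) := by
    have := ENNReal.rpow_le_rpow h2 (one_div_nonneg.2 hq.le)
    rwa [← ENNReal.rpow_mul, mul_one_div_cancel hq.ne', ENNReal.rpow_one] at this
  exact h1.trans ((ENNReal.ofReal_le_iff_le_toReal
    (ENNReal.rpow_ne_top_of_nonneg (by positivity) hZt)).1 h3)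

theorem exists_peetre_majorant (D : LPData d) (s : ℝ) {q : ℝ} (hq : 0 < q) (σ : ℕ)
    (hσ : 2 * (d : ℝ) < σ * q) : ∃ C : ℝ≥0, ∀ u : TD d, FinftyNormDist D s q u ≠ ⊤ →
      ∀ k x, ∃ S : ℝ, 0 ≤ S ∧
        (∀ y, ‖LPdist D k u y‖ ≤ S * (1 + ‖(2 : ℝ) ^ k • (x - y)‖) ^ σ) ∧
        (1 ≤ k → ENNReal.ofReal S ^ q ≤ C * WW D q (σ * q) k u x) ∧
        (2 : ℝ≥0∞) ^ (s * k * q) * ENNReal.ofReal S ^ q ≤ C * FinftyNormDist D s q u ^ q := by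
  obtain ⟨C, hC⟩ := peetre_le D σ hq
  set V := ENNReal.ofReal ((1 + d) ^ ((σ : ℝ) * q)) * wconst d (σ * q) with hV
  have hVt : V ≠ ⊤ := ENNReal.mul_ne_top ENNReal.ofReal_ne_top (wconst_ne_top hσ)
  refine ⟨C + C * V.toNNReal + 1, fun u hN k x => ?_⟩
  rcases Nat.eq_zero_or_pos k with rfl | hk
  · refine ⟨(FinftyNormDist D s q u).toReal, ENNReal.toReal_nonneg, fun y => ?_, by simp, ?_⟩
    · have h1 := (ENNReal.ofReal_le_iff_le_toReal hN).1 (norm_zero_le_norm D s q u y)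
      refine h1.trans (le_mul_of_one_le_right ENNReal.toReal_nonneg ?_)
      exact one_le_pow₀ (one_le_one_add_norm _)
    · rw [ENNReal.ofReal_toReal hN]
      simp only [CharP.cast_eq_zero, mul_zero, zero_mul, ENNReal.rpow_zero]
      refine mul_le_mul' ?_ le_rfl
      push_cast
      exact le_add_self
  · obtain ⟨K, hK, hb⟩ := bounded_LPdist D s hq u hN hk
    obtain ⟨S, hS, hbd, hle⟩ := hC u k x K fun y =>
      (hb y).trans (le_mul_of_one_le_right hK (one_le_pow₀ (one_le_one_add_norm _)))
    refine ⟨S, hS, hbd, fun _ => hle.trans (mul_le_mul' ?_ le_rfl), ?_⟩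
    · push_cast
      rw [add_assoc]
      exact le_self_add
    · calc (2 : ℝ≥0∞) ^ (s * k * q) * ENNReal.ofReal S ^ q
          ≤ (2 : ℝ≥0∞) ^ (s * k * q) * (C * WW D q (σ * q) k u x) := mul_le_mul' le_rfl hle
        _ = C * ((2 : ℝ≥0∞) ^ (s * k * q) * WW D q (σ * q) k u x) := mul_left_comm _ _ _
        _ ≤ C * (V * FinftyNormDist D s q u ^ q) :=
          mul_le_mul' le_rfl (WW_le_norm D s hq (by positivity) u hk x)
        _ ≤ _ := by
          rw [← mul_assoc]
          refine mul_le_mul' ?_ le_rfl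
          push_cast
          rw [ENNReal.coe_toNNReal hVt]
          exact le_trans le_add_self le_self_add

/-! ### The pointwise estimate for the Littlewood–Paley pieces of the operator -/

/-- The translated kernel `y ↦ φ_n(x - y)` as a Schwartz function. -/
def lpk (D : LPData d) (n : ℕ) (x : RD d) : 𝓢(RD d, ℂ) := fourierS (reg_ee.cut (LPhatS D n) x)

theorem lpk_apply (D : LPData d) (n : ℕ) (x y : RD d) : lpk D n x y = LPkernel D n (x - y) := by
  rw [lpk, fourierS_cut_ee, invS_LPhatS]

theorem lpk_zero (D : LPData d) (x : RD d) : lpk D 0 x = kerS (Θ D) 0 x := by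
  unfold lpk kerS
  congr 2
  ext ξ
  rw [dil_apply]
  simp [LPhatS, Θ]

theorem lpk_succ (D : LPData d) (n : ℕ) (x : RD d) :
    lpk D (n + 1) x = kerS (fourierS D.φ) (n + 1) x := rfl

theorem LPdist_eq_lpk (D : LPData d) (n : ℕ) (u : TD d) (x : RD d) :
    LPdist D n u x = u (lpk D n x) :=
  pairing_coe u _ (funext fun y => lpk_apply D n x y)

theorem fourierS_fourierS (g : 𝓢(RD d, ℂ)) (ζ : RD d) : fourierS (fourierS g) ζ = g (-ζ) := by
  conv_rhs => rw [← invS_fourierS g]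
  rw [fourierS_apply, invS_apply]

theorem fourierS_lpk_eq_zero (D : LPData d) (n : ℕ) (x : RD d) {ζ : RD d}
    (h : (2 : ℝ) ^ (n + 1) < ‖ζ‖) : fourierS (lpk D n x) ζ = 0 := by
  rw [lpk, fourierS_fourierS, Reg.cut_apply, LPhatS_apply]
  by_contra hne
  have := (LPhat_support D n (right_ne_zero_of_mul hne)).1
  rw [norm_neg] at this
  linarith

theorem Gf_eq_ee_mul (a : RD d → RD d → ℂ) (ψ : 𝓢(RD d, ℂ)) (x ξ : RD d) :
    Gf a ψ ξ = ee x ξ * amp (phased a x) ψ ξ := by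
  rw [Gf, amp, amp, ← integral_const_mul]
  refine integral_congr_ae (Eventually.of_forall fun y => ?_)
  simp only [phased]
  have : ee (y - 0) ξ = ee x ξ * ee (y - x) ξ := by
    rw [← ee_add]; congr 1; abel
  rw [this]; ring

theorem norm_deriv_amp_lpk_le {m : ℝ} {a : RD d → RD d → ℂ} (ha : IsSymbolS11 d m a)
    (D : LPData d) (L : ℕ) {K : ℝ} (hK : 0 ≤ K) (l : ℕ) : ∃ C : ℝ, 0 ≤ C ∧
    ∀ (n : ℕ) (x ξ : RD d), 1 + ‖ξ‖ ≤ K * 2 ^ n →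
    ‖iteratedFDeriv ℝ l (amp (phased a x) (lpk D n x)) ξ‖
      ≤ C * (((2 : ℝ) ^ n)⁻¹ ^ L * (1 + ‖ξ‖) ^ (m + L - (l : ℝ))) := by
  obtain ⟨C₁, hC₁, h₁⟩ := (ha.symB 0).zero.norm_deriv_amp_ker_le (Θ D) hK l
  obtain ⟨C₂, hC₂, h₂⟩ := (ha.symB L).norm_deriv_amp_ker_le (g := fourierS D.φ)
    (fun ζ h => fourierS_φ_eq_zero D h) hK l
  refine ⟨C₁ + C₂, by positivity, fun n x ξ hξ => ?_⟩
  have hp : 0 < 1 + ‖ξ‖ := by positivity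
  cases n with
  | zero =>
    rw [lpk_zero]
    refine (h₁ 0 x ξ hξ).trans ?_
    rw [pow_zero, inv_one, one_pow, one_mul]
    refine mul_le_mul (by linarith) ?_ (by positivity) (by positivity)
    exact Real.rpow_le_rpow_of_exponent_le (one_le_one_add_norm ξ)
      (by linarith [Nat.cast_nonneg (α := ℝ) L])
  | succ n =>
    rw [lpk_succ]
    refine (h₂ (n + 1) x ξ hξ).trans ?_
    exact mul_le_mul_of_nonneg_right (by linarith) (by positivity)

theorem rpow_le_of_comparable {t P : ℝ} (hP : 0 < P) (h1 : P / 8 ≤ t) (h2 : t ≤ 9 * P) (r : ℝ) :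
    t ^ r ≤ 9 ^ |r| * P ^ r := by
  have ht : 0 < t := lt_of_lt_of_le (by positivity) h1
  rcases le_total 0 r with hr | hr
  · rw [abs_of_nonneg hr, ← Real.mul_rpow (by norm_num) hP.le]
    exact Real.rpow_le_rpow ht.le h2 hr
  · have h3 : t ^ r ≤ (9⁻¹ * P) ^ r :=
      Real.rpow_le_rpow_of_nonpos (by positivity) (by linarith) hr
    rw [Real.mul_rpow (by norm_num) hP.le, Real.inv_rpow (by norm_num)] at h3
    rwa [abs_of_nonpos hr, Real.rpow_neg (by norm_num)]

theorem norm_LPdist_comp_le {C₀ : ℝ} (hC₀ : 1 < C₀) {m : ℝ} {a : RD d → RD d → ℂ}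
    (ha : IsSymbolS11 d m a) (ht : TwistCond C₀ a) (D : LPData d) (L σ : ℕ) :
    ∃ (κ : ℕ), ∃ C : ℝ, 0 ≤ C ∧ ∀ (G : 𝓢(RD d, ℂ) →L[ℂ] 𝓢(RD d, ℂ)),
      (∀ ψ ξ, G ψ ξ = Gf a ψ ξ) → ∀ (u : TD d) (n : ℕ) (x : RD d) (S : ℕ → ℝ), (∀ k, 0 ≤ S k) →
      (∀ k y, ‖LPdist D k u y‖ ≤ S k * (1 + ‖(2 : ℝ) ^ k • (x - y)‖) ^ σ) →
      ‖LPdist D n ((fourierTD u).comp G) x‖ ≤ C * ∑ k ∈ Finset.range (n + κ + 1),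
        (((2 : ℝ) ^ n)⁻¹ ^ L * ((2 : ℝ) ^ k) ^ (m + L)) * S k := by
  obtain ⟨κ, hκ⟩ := pow_unbounded_of_one_lt (3 * C₀) (one_lt_two (α := ℝ))
  obtain ⟨A, C₁, hC₁, hF⟩ := norm_fourierTD_LPhat_mul_le D σ
  choose c hc hb using norm_deriv_amp_lpk_le ha D L (K := 9 * 2 ^ κ) (by positivity)
  set M := ∑ l ∈ Finset.range (A + 1), c l * 9 ^ |m + L - (l : ℝ)| with hM
  have hM0 : 0 ≤ M := Finset.sum_nonneg fun l _ => mul_nonneg (hc l) (by positivity)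
  refine ⟨κ, C₁ * M, by positivity, fun G hG u n x S hS hbd => ?_⟩
  set ψ := lpk D n x with hψ
  set h := amp (phased a x) ψ with hh
  have hreg : Reg a := (ha.symB 0).uReg.reg
  have hGψ : ∀ ξ, G ψ ξ = ee x ξ * h ξ := fun ξ => by rw [hG, Gf_eq_ee_mul a ψ x ξ]
  have hzero : ∀ ξ, (2 : ℝ) ^ (n + κ) ≤ ‖ξ‖ → h ξ = 0 := by
    intro ξ hξ
    refine ht.amp_eq_zero hC₀ (R := 2 ^ (n + 1)) (fun ζ hζ => fourierS_lpk_eq_zero D n x hζ) ?_ x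
    refine le_trans ?_ hξ
    have h1 : (1 : ℝ) ≤ 2 ^ n := one_le_pow₀ (by norm_num)
    rw [pow_add 2 n κ, pow_succ]
    nlinarith
  have hdec : G ψ = ∑ k ∈ Finset.range (n + κ + 1), mulS (LPhatS D k) (G ψ) := by
    ext ξ
    rw [sum_apply]
    simp only [mulS_apply, LPhatS_apply]
    rw [← Finset.sum_mul, sum_LPhat]
    rcases lt_or_ge ‖ξ‖ ((2 : ℝ) ^ (n + κ)) with hξ | hξ
    · rw [Θ_eq_one, one_mul]
      rw [norm_smul, norm_inv, Real.norm_of_nonneg (by positivity), inv_mul_lt_iff₀ (by positivity),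
        mul_one]
      exact hξ
    · rw [hGψ, hzero ξ hξ]; simp
  have key : LPdist D n ((fourierTD u).comp G) x
      = ∑ k ∈ Finset.range (n + κ + 1), fourierTD u (mulS (LPhatS D k) (G ψ)) := by
    rw [LPdist_eq_lpk, ContinuousLinearMap.comp_apply, ← hψ]
    conv_lhs => rw [hdec]
    rw [map_sum]
  rw [key, Finset.mul_sum]
  refine (norm_sum_le _ _).trans (Finset.sum_le_sum fun k hk => ?_)
  have hkn : k ≤ n + κ := by rw [Finset.mem_range] at hk; omega
  set P : ℝ := (2 : ℝ) ^ k with hP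
  have hP0 : 0 < P := by positivity
  have hP1 : 1 ≤ P := one_le_pow₀ (by norm_num)
  have hPn : P ≤ 2 ^ n * 2 ^ κ := by
    rw [← pow_add]; exact pow_le_pow_right₀ (by norm_num) hkn
  set B := M * (((2 : ℝ) ^ n)⁻¹ ^ L * P ^ (m + L)) with hB
  have hB0 : 0 ≤ B := by positivity
  have := hF u k x h B (S k) (mulS (LPhatS D k) (G ψ)) ((hreg.phased x).amp_deriv ψ).1 hB0 (hS k)
    (fun ξ => by rw [mulS_apply, LPhatS_apply, hGψ]) (fun ξ h1 h2 l hl => ?_) (hbd k)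
  · refine this.trans (le_of_eq ?_)
    rw [hB]; ring
  · have h3 : 1 + ‖ξ‖ ≤ 9 * P := by linarith
    have h4 := hb l n x ξ (by nlinarith)
    have h5 : c l * 9 ^ |m + L - (l : ℝ)| ≤ M :=
      Finset.single_le_sum (f := fun l : ℕ => c l * (9 : ℝ) ^ |m + L - (l : ℝ)|)
        (fun i _ => mul_nonneg (hc i) (by positivity)) (Finset.mem_range.2 (by omega))
    have h6 := rpow_le_of_comparable hP0 h1 h3 (m + L - l)
    have h7 : P ^ (m + L - (l : ℝ)) = P ^ (m + L) * P⁻¹ ^ l := by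
      rw [Real.rpow_sub hP0, Real.rpow_natCast, inv_pow, div_eq_mul_inv]
    calc _ ≤ _ := h4
      _ ≤ c l * (((2 : ℝ) ^ n)⁻¹ ^ L * (9 ^ |m + L - (l : ℝ)| * P ^ (m + L - (l : ℝ)))) :=
        mul_le_mul_of_nonneg_left (mul_le_mul_of_nonneg_left h6 (by positivity)) (hc l)
      _ = (c l * 9 ^ |m + L - (l : ℝ)|) * (((2 : ℝ) ^ n)⁻¹ ^ L * P ^ (m + L) * P⁻¹ ^ l) := by
        rw [h7]; ring
      _ ≤ M * (((2 : ℝ) ^ n)⁻¹ ^ L * P ^ (m + L) * P⁻¹ ^ l) :=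
        mul_le_mul_of_nonneg_right h5 (by positivity)
      _ = _ := by rw [hB]; ring

theorem two_pow_weight_le {s L : ℝ} (m : ℝ) (κ : ℕ) (hL : |s| + 2 ≤ L) {n k : ℕ} (h : k ≤ n + κ) :
    (2 : ℝ) ^ (s * n) * ((2 : ℝ) ^ (-(L * n)) * (2 : ℝ) ^ ((m + L) * k))
      ≤ 2 ^ (κ * (2 * L)) * ((1 / 2) ^ (2 * Nat.dist n k) * 2 ^ ((s + m) * k)) := by
  have e : ((1 : ℝ) / 2) ^ (2 * Nat.dist n k) = 2 ^ (-(2 * (Nat.dist n k : ℝ))) := by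
    rw [Real.rpow_neg (by norm_num), one_div, inv_pow, ← Real.rpow_natCast]
    push_cast; rfl
  rw [e, ← Real.rpow_add two_pos, ← Real.rpow_add two_pos, ← Real.rpow_add two_pos,
    ← Real.rpow_add two_pos]
  refine Real.rpow_le_rpow_of_exponent_le (by norm_num) ?_
  have h1 := le_abs_self s
  have h2 := neg_abs_le s
  have hκ : (0 : ℝ) ≤ κ := Nat.cast_nonneg κ
  have hL0 : 0 ≤ L := by linarith [abs_nonneg s]
  have hkk : (k : ℝ) ≤ n + κ := by exact_mod_cast h
  rcases le_total k n with hkn | hkn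
  · rw [Nat.dist_eq_sub_of_le_right hkn, Nat.cast_sub hkn]
    have : (k : ℝ) ≤ n := by exact_mod_cast hkn
    nlinarith [mul_nonneg hκ hL0]
  · rw [Nat.dist_eq_sub_of_le hkn, Nat.cast_sub hkn]
    have : (n : ℝ) ≤ k := by exact_mod_cast hkn
    nlinarith [mul_nonneg (sub_nonneg.2 this) hL0]

theorem two_rpow_mul_norm_LPdist_comp_le {C₀ : ℝ} (hC₀ : 1 < C₀) {m : ℝ} {a : RD d → RD d → ℂ}
    (ha : IsSymbolS11 d m a) (ht : TwistCond C₀ a) (D : LPData d) (s : ℝ) (σ : ℕ) :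
    ∃ (κ : ℕ), ∃ C : ℝ, 0 ≤ C ∧ ∀ (G : 𝓢(RD d, ℂ) →L[ℂ] 𝓢(RD d, ℂ)),
      (∀ ψ ξ, G ψ ξ = Gf a ψ ξ) → ∀ (u : TD d) (n : ℕ) (x : RD d) (S : ℕ → ℝ), (∀ k, 0 ≤ S k) →
      (∀ k y, ‖LPdist D k u y‖ ≤ S k * (1 + ‖(2 : ℝ) ^ k • (x - y)‖) ^ σ) →
      2 ^ (s * n) * ‖LPdist D n ((fourierTD u).comp G) x‖ ≤ C * ∑ k ∈ Finset.range (n + κ + 1),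
        (1 / 2) ^ (2 * Nat.dist n k) * (2 ^ ((s + m) * k) * S k) := by
  obtain ⟨L, hL⟩ := exists_nat_ge (|s| + 2)
  obtain ⟨κ, C, hC, hb⟩ := norm_LPdist_comp_le hC₀ ha ht D L σ
  refine ⟨κ, C * 2 ^ ((κ : ℝ) * (2 * L)), by positivity, fun G hG u n x S hS hbd => ?_⟩
  have h1 := mul_le_mul_of_nonneg_left (hb G hG u n x S hS hbd)
    (Real.rpow_nonneg zero_le_two (s * n))
  refine h1.trans ?_
  rw [mul_left_comm, mul_assoc]
  refine mul_le_mul_of_nonneg_left ?_ hC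
  rw [Finset.mul_sum, Finset.mul_sum]
  refine (Finset.sum_le_sum fun k hk => ?_)
  have hkn : k ≤ n + κ := by rw [Finset.mem_range] at hk; omega
  have h2 := mul_le_mul_of_nonneg_right (two_pow_weight_le m κ hL hkn) (hS k)
  have e1 : ((2 : ℝ) ^ n)⁻¹ ^ L = 2 ^ (-((L : ℝ) * n)) := by
    rw [Real.rpow_neg (by norm_num), inv_pow, ← pow_mul, mul_comm (L : ℝ), ← Nat.cast_mul,
      Real.rpow_natCast]
  have e2 : ((2 : ℝ) ^ k) ^ (m + L) = 2 ^ ((m + L) * k) := by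
    rw [← Real.rpow_natCast, ← Real.rpow_mul (by norm_num), mul_comm]
  rw [e1, e2]
  calc _ = _ := by ring
    _ ≤ _ := h2
    _ = _ := by ring

/-! ### Summation over the dyadic pieces -/

theorem tsum_pow_dist_le {r : ℝ≥0∞} (hr : r ≤ 1) (n : ℕ) :
    ∑' k, r ^ Nat.dist n k ≤ 2 * (1 - r)⁻¹ := by
  rw [← Summable.sum_add_tsum_nat_add' (k := n) ENNReal.summable, two_mul]
  refine add_le_add ?_ (le_of_eq ?_)
  · calc ∑ k ∈ Finset.range n, r ^ Nat.dist n k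
        ≤ ∑ k ∈ Finset.range n, r ^ (n - 1 - k) := by
          refine Finset.sum_le_sum fun k hk => pow_le_pow_right_of_le_one' hr ?_
          rw [Finset.mem_range] at hk
          rw [Nat.dist_eq_sub_of_le_right hk.le]
          omega
      _ = ∑ k ∈ Finset.range n, r ^ k := Finset.sum_range_reflect (fun k => r ^ k) n
      _ ≤ ∑' k, r ^ k := ENNReal.sum_le_tsum _
      _ = _ := ENNReal.tsum_geometric r
  · rw [← ENNReal.tsum_geometric]
    refine tsum_congr fun k => ?_
    rw [Nat.dist_eq_sub_of_le (by omega), Nat.add_sub_cancel]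

theorem rpow_sum_mul_le {q : ℝ} (hq : 0 < q) (F : Finset ℕ) (w b : ℕ → ℝ≥0∞) :
    (∑ k ∈ F, w k * b k) ^ q ≤ (∑ k ∈ F, w k) ^ q * ∑ k ∈ F, b k ^ q := by
  rcases F.eq_empty_or_nonempty with rfl | hF
  · simp [hq]
  obtain ⟨k₀, hk₀, hmax⟩ := F.exists_max_image b hF
  have h1 : ∑ k ∈ F, w k * b k ≤ (∑ k ∈ F, w k) * b k₀ := by
    rw [Finset.sum_mul]
    exact Finset.sum_le_sum fun k hk => mul_le_mul' le_rfl (hmax k hk)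
  refine (ENNReal.rpow_le_rpow h1 hq.le).trans ?_
  rw [ENNReal.mul_rpow_of_nonneg _ _ hq.le]
  exact mul_le_mul' le_rfl (Finset.single_le_sum (f := fun k => b k ^ q) (fun _ _ => zero_le) hk₀)

theorem half_rpow_lt_one {q : ℝ} (hq : 0 < q) : (2⁻¹ : ℝ≥0∞) ^ q < 1 :=
  ENNReal.rpow_lt_one (by simp) hq

theorem ofReal_two_rpow (t : ℝ) : ENNReal.ofReal ((2 : ℝ) ^ t) = (2 : ℝ≥0∞) ^ t := by
  rw [← ENNReal.ofReal_rpow_of_pos two_pos]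
  simp

theorem fq_comp_le {C₀ : ℝ} (hC₀ : 1 < C₀) {m : ℝ} {a : RD d → RD d → ℂ}
    (ha : IsSymbolS11 d m a) (ht : TwistCond C₀ a) (D : LPData d) (s : ℝ) {q : ℝ} (hq : 0 < q)
    (σ : ℕ) : ∃ C : ℝ≥0, ∀ (G : 𝓢(RD d, ℂ) →L[ℂ] 𝓢(RD d, ℂ)),
      (∀ ψ ξ, G ψ ξ = Gf a ψ ξ) → ∀ (u : TD d) (n : ℕ) (x : RD d) (S : ℕ → ℝ), (∀ k, 0 ≤ S k) →
      (∀ k y, ‖LPdist D k u y‖ ≤ S k * (1 + ‖(2 : ℝ) ^ k • (x - y)‖) ^ σ) →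
      fq D s q ((fourierTD u).comp G) n x ≤ C * ∑' k, ((2⁻¹ : ℝ≥0∞) ^ q) ^ Nat.dist n k *
        ((2 : ℝ≥0∞) ^ ((s + m) * k * q) * ENNReal.ofReal (S k) ^ q) := by
  obtain ⟨κ, C, hC, hb⟩ := two_rpow_mul_norm_LPdist_comp_le hC₀ ha ht D s σ
  refine ⟨(C.toNNReal * 4) ^ q, fun G hG u n x S hS hbd => ?_⟩
  set T := LPdist D n ((fourierTD u).comp G) x with hT
  set F := Finset.range (n + κ + 1) with hF
  have h1 := ENNReal.ofReal_le_ofReal (hb G hG u n x S hS hbd)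
  set w : ℕ → ℝ≥0∞ := fun k => (2⁻¹ : ℝ≥0∞) ^ Nat.dist n k with hw
  set b : ℕ → ℝ≥0∞ := fun k => w k * ((2 : ℝ≥0∞) ^ ((s + m) * k) * ENNReal.ofReal (S k)) with hb'
  have h2 : ENNReal.ofReal (2 ^ (s * n) * ‖T‖) = (2 : ℝ≥0∞) ^ (s * n) * ENNReal.ofReal ‖T‖ := by
    rw [ENNReal.ofReal_mul (by positivity), ofReal_two_rpow]
  have h3 : ENNReal.ofReal (C * ∑ k ∈ F, (1 / 2) ^ (2 * Nat.dist n k) * (2 ^ ((s + m) * k) * S k))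
      = ENNReal.ofReal C * ∑ k ∈ F, w k * b k := by
    rw [ENNReal.ofReal_mul hC, ENNReal.ofReal_sum_of_nonneg fun k _ => by
      have := hS k; positivity]
    congr 1
    refine Finset.sum_congr rfl fun k _ => ?_
    rw [ENNReal.ofReal_mul (by positivity), ENNReal.ofReal_mul (by positivity), ofReal_two_rpow,
      ENNReal.ofReal_pow (by positivity), one_div, ENNReal.ofReal_inv_of_pos two_pos,
      ENNReal.ofReal_ofNat, hb', hw]
    simp only []
    rw [two_mul, pow_add, mul_assoc]
  rw [h2, h3] at h1
  have h4 : ∑ k ∈ F, w k ≤ 4 := by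
    refine (ENNReal.sum_le_tsum F).trans ((tsum_pow_dist_le (by simp) n).trans ?_)
    rw [ENNReal.one_sub_inv_two, inv_inv]
    norm_num
  have h5 : ∀ k, b k ^ q = ((2⁻¹ : ℝ≥0∞) ^ q) ^ Nat.dist n k *
      ((2 : ℝ≥0∞) ^ ((s + m) * k * q) * ENNReal.ofReal (S k) ^ q) := by
    intro k
    simp only [hb', hw]
    rw [ENNReal.mul_rpow_of_nonneg _ _ hq.le, ENNReal.mul_rpow_of_nonneg _ _ hq.le,
      ← ENNReal.rpow_mul, ← ENNReal.rpow_natCast, ← ENNReal.rpow_natCast, ← ENNReal.rpow_mul,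
      ← ENNReal.rpow_mul, mul_comm q]
  calc fq D s q ((fourierTD u).comp G) n x
      = ((2 : ℝ≥0∞) ^ (s * n) * ENNReal.ofReal ‖T‖) ^ q := by
        rw [fq, ENNReal.mul_rpow_of_nonneg _ _ hq.le, ← ENNReal.rpow_mul]
    _ ≤ (ENNReal.ofReal C * ∑ k ∈ F, w k * b k) ^ q := ENNReal.rpow_le_rpow h1 hq.le
    _ = ENNReal.ofReal C ^ q * (∑ k ∈ F, w k * b k) ^ q := ENNReal.mul_rpow_of_nonneg _ _ hq.le
    _ ≤ ENNReal.ofReal C ^ q * ((∑ k ∈ F, w k) ^ q * ∑ k ∈ F, b k ^ q) :=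
        mul_le_mul' le_rfl (rpow_sum_mul_le hq F w b)
    _ ≤ ENNReal.ofReal C ^ q * (4 ^ q * ∑' k, b k ^ q) :=
        mul_le_mul' le_rfl (mul_le_mul' (ENNReal.rpow_le_rpow h4 hq.le) (ENNReal.sum_le_tsum F))
    _ = _ := by
        rw [← mul_assoc, ← ENNReal.mul_rpow_of_nonneg _ _ hq.le, tsum_congr h5,
          ENNReal.coe_rpow_of_nonneg _ hq.le]
        push_cast
        rfl

theorem tsum_tsum_pow_dist_le {r : ℝ≥0∞} (hr : r ≤ 1) (g V : ℕ → ℝ≥0∞) {K : ℝ≥0∞}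
    (hK : ∀ k, g k ≤ K) (μ : ℕ) (hV : ∀ i, g (μ + i) ≤ V i) :
    ∑' j, ∑' k, r ^ Nat.dist (μ + j) k * g k
      ≤ (1 - r)⁻¹ * (2 * (1 - r)⁻¹) * K + 2 * (1 - r)⁻¹ * ∑' i, V i := by
  have hsplit : ∀ j, ∑' k, r ^ Nat.dist (μ + j) k * g k
      ≤ r ^ j * (2 * (1 - r)⁻¹) * K + ∑' i, r ^ Nat.dist j i * V i := by
    intro j
    rw [← Summable.sum_add_tsum_nat_add' (k := μ) ENNReal.summable]
    refine add_le_add ?_ (ENNReal.tsum_le_tsum fun i => ?_)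
    · calc ∑ k ∈ Finset.range μ, r ^ Nat.dist (μ + j) k * g k
          ≤ ∑ k ∈ Finset.range μ, r ^ j * (r ^ Nat.dist μ k * K) := by
            refine Finset.sum_le_sum fun k hk => ?_
            rw [Finset.mem_range] at hk
            rw [Nat.dist_eq_sub_of_le_right (by omega : k ≤ μ + j),
              Nat.dist_eq_sub_of_le_right hk.le, (by omega : μ + j - k = j + (μ - k)), pow_add,
              mul_assoc]
            exact mul_le_mul' le_rfl (mul_le_mul' le_rfl (hK k))
        _ = r ^ j * (∑ k ∈ Finset.range μ, r ^ Nat.dist μ k) * K := by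
            rw [← Finset.mul_sum, ← Finset.sum_mul, mul_assoc]
        _ ≤ _ := mul_le_mul' (mul_le_mul' le_rfl
            ((ENNReal.sum_le_tsum _).trans (tsum_pow_dist_le hr μ))) le_rfl
    · rw [add_comm i μ, Nat.dist_add_add_left]
      exact mul_le_mul' le_rfl (hV i)
  refine (ENNReal.tsum_le_tsum hsplit).trans ?_
  rw [ENNReal.tsum_add, ENNReal.tsum_mul_right, ENNReal.tsum_mul_right, ENNReal.tsum_geometric,
    ENNReal.tsum_comm]
  refine add_le_add le_rfl ?_
  rw [← ENNReal.tsum_mul_left]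
  refine ENNReal.tsum_le_tsum fun i => ?_
  rw [ENNReal.tsum_mul_right]
  simp only [Nat.dist_comm _ i]
  exact mul_le_mul' (tsum_pow_dist_le hr i) le_rfl

theorem FinftyNormDist_comp_le {C₀ : ℝ} (hC₀ : 1 < C₀) {m : ℝ} {a : RD d → RD d → ℂ}
    (ha : IsSymbolS11 d m a) (ht : TwistCond C₀ a) (D : LPData d) (s : ℝ) {q : ℝ} (hq : 0 < q) :
    ∃ C : ℝ≥0, ∀ (G : 𝓢(RD d, ℂ) →L[ℂ] 𝓢(RD d, ℂ)), (∀ ψ ξ, G ψ ξ = Gf a ψ ξ) →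
      ∀ u : TD d, FinftyNormDist D (s + m) q u ≠ ⊤ →
      FinftyNormDist D s q ((fourierTD u).comp G) ≤ C * FinftyNormDist D (s + m) q u := by
  obtain ⟨σ, hσ'⟩ := exists_nat_gt (2 * d / q)
  have hσ : 2 * (d : ℝ) < σ * q := by rwa [div_lt_iff₀ hq] at hσ'
  obtain ⟨C₁, h₁⟩ := fq_comp_le hC₀ ha ht D s hq σ
  obtain ⟨C₂, h₂⟩ := exists_peetre_majorant D (s + m) hq σ hσ
  set r : ℝ≥0∞ := (2⁻¹ : ℝ≥0∞) ^ q with hr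
  have hr1 : r < 1 := half_rpow_lt_one hq
  set g := (1 - r)⁻¹ with hg
  have hgt : g ≠ ⊤ := ENNReal.inv_ne_top.2 (tsub_pos_of_lt hr1).ne'
  set X : ℝ≥0∞ := C₁ * (2 * g) * C₂ with hX
  set Y : ℝ≥0∞ := C₁ * (g * (2 * g)) * C₂ + C₁ * (2 * g) * C₂ * wconst d (σ * q) with hY
  have hXt : X ≠ ⊤ := by simp [hX, ENNReal.mul_eq_top, hgt]
  have hYt : Y ≠ ⊤ := by simp [hY, ENNReal.mul_eq_top, hgt, wconst_ne_top hσ]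
  refine ⟨(X ^ (1 / q)).toNNReal + (Y ^ (1 / q)).toNNReal, fun G hG u hN => ?_⟩
  set N := FinftyNormDist D (s + m) q u with hNdef
  have hroot : ∀ Z : ℝ≥0∞, Z ≠ ⊤ →
      (Z * N ^ q) ^ (1 / q) = ((Z ^ (1 / q)).toNNReal : ℝ≥0∞) * N := by
    intro Z hZ
    rw [ENNReal.coe_toNNReal (ENNReal.rpow_ne_top_of_nonneg (by positivity) hZ),
      ENNReal.mul_rpow_of_nonneg _ _ (by positivity), ← ENNReal.rpow_mul,
      mul_one_div_cancel hq.ne', ENNReal.rpow_one]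
  choose S hS hSb hSW hSN using h₂ u hN
  have hpt := fun n x => h₁ G hG u n x (fun k => S k x) (fun k => hS k x) (fun k => hSb k x)
  rw [ENNReal.coe_add, add_mul, ← hroot X hXt, ← hroot Y hYt]
  refine add_le_add (iSup_le fun x => ?_) (iSup₂_le fun μ hμ => iSup_le fun n => ?_)
  · have h3 : fq D s q ((fourierTD u).comp G) 0 x ≤ X * N ^ q := by
      refine (hpt 0 x).trans ?_
      calc _ ≤ C₁ * ∑' k, r ^ Nat.dist 0 k * (C₂ * N ^ q) :=
            mul_le_mul' le_rfl (ENNReal.tsum_le_tsum fun k => mul_le_mul' le_rfl (hSN k x))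
        _ ≤ C₁ * ((2 * g) * (C₂ * N ^ q)) := by
            rw [ENNReal.tsum_mul_right]
            exact mul_le_mul' le_rfl (mul_le_mul' (tsum_pow_dist_le hr1.le 0) le_rfl)
        _ = X * N ^ q := by rw [hX]; ring
    rw [fq] at h3
    simp only [CharP.cast_eq_zero, mul_zero, zero_mul, ENNReal.rpow_zero, one_mul] at h3
    have h4 := ENNReal.rpow_le_rpow h3 (one_div_nonneg.2 hq.le)
    rw [← ENNReal.rpow_mul, mul_one_div_cancel hq.ne', ENNReal.rpow_one, ofReal_norm] at h4
    exact h4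
  · rw [cubePiece_eq]
    refine ENNReal.rpow_le_rpow ?_ (one_div_nonneg.2 hq.le)
    set c := (2 : ℝ≥0∞) ^ ((μ : ℝ) * (d : ℝ)) with hc
    set W : RD d → ℝ≥0∞ := fun x => ∑' j : ℕ, (2 : ℝ≥0∞) ^ ((s + m) * ((μ + j : ℕ) : ℝ) * q)
        * WW D q (σ * q) (μ + j) u x with hW
    have hsum : ∀ x, ∑' j : ℕ, fq D s q ((fourierTD u).comp G) (μ + j) x
        ≤ C₁ * (g * (2 * g)) * C₂ * N ^ q + C₁ * (2 * g) * C₂ * W x := by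
      intro x
      refine (ENNReal.tsum_le_tsum fun j => hpt (μ + j) x).trans ?_
      rw [ENNReal.tsum_mul_left]
      have h5 := tsum_tsum_pow_dist_le hr1.le
        (fun k : ℕ => (2 : ℝ≥0∞) ^ ((s + m) * k * q) * ENNReal.ofReal (S k x) ^ q)
        (fun i : ℕ => C₂ * ((2 : ℝ≥0∞) ^ ((s + m) * ((μ + i : ℕ) : ℝ) * q)
          * WW D q (σ * q) (μ + i) u x)) (fun k => hSN k x) μ (fun i => by
          rw [mul_left_comm]
          exact mul_le_mul' le_rfl (hSW (μ + i) x (by omega)))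
      refine (mul_le_mul' le_rfl h5).trans (le_of_eq ?_)
      rw [ENNReal.tsum_mul_left]
      simp only [hW, hNdef, hg]
      ring
    calc c * ∫⁻ x in dyadicCube d μ n, ∑' j : ℕ, fq D s q ((fourierTD u).comp G) (μ + j) x
        ≤ c * ∫⁻ x in dyadicCube d μ n,
          (C₁ * (g * (2 * g)) * C₂ * N ^ q + C₁ * (2 * g) * C₂ * W x) :=
          mul_le_mul' le_rfl (lintegral_mono hsum)
      _ = C₁ * (g * (2 * g)) * C₂ * N ^ q * (c * volume (dyadicCube d μ n))
          + C₁ * (2 * g) * C₂ * (c * ∫⁻ x in dyadicCube d μ n, W x) := by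
          rw [lintegral_add_left measurable_const, lintegral_const_mul' _ _ hXt, setLIntegral_const]
          ring
      _ ≤ C₁ * (g * (2 * g)) * C₂ * N ^ q
          + C₁ * (2 * g) * C₂ * (wconst d (σ * q) * N ^ q) := by
          rw [volume_dyadicCube, mul_one]
          exact add_le_add le_rfl (mul_le_mul' le_rfl (cube_WW_le D (s + m) hq (σ * q) u hμ n))
      _ = Y * N ^ q := by rw [hY]; ring

end Auxiliary

/-- under Hörmander's twisted diagonal condition, `T_a` is bounded from
`F_∞^{s+m,q}` to `F_∞^{s,q}` for every `s ∈ ℝ`. -/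
theorem statement3 (d : ℕ) (hd : 1 ≤ d) (q : ℝ) (hq : 0 < q) (s m : ℝ)
    (D : LPData d) (a : RD d → RD d → ℂ) (ha : IsSymbolS11 d m a)
    (C₀ : ℝ) (hC₀ : 1 < C₀)
    (htwist : ∀ ξ : RD d, ∀ ψ : 𝓢(RD d, ℂ),
      tsupport ⇑ψ ⊆ {η : RD d | C₀ * (‖η + ξ‖ + 1) ≤ ‖ξ‖} →
      ∫ x, a x ξ * fourierS ψ x = 0) :
    ∃ C : ℝ≥0, ∀ u : TD d, FinftyNormDist D (s+m) q u ≠ ⊤ →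
      ∃ Tf : TD d, ConvergesInSPrime D a u Tf ∧
        FinftyNormDist D s q Tf ≤ (C : ℝ≥0∞) * FinftyNormDist D (s+m) q u := by
  have ht : TwistCond C₀ a := htwist
  have hreg := (ha.symB 0).uReg
  obtain ⟨G, hG⟩ := ht.exists_GL hC₀ hreg D
  obtain ⟨C, hC⟩ := FinftyNormDist_comp_le hC₀ ha ht D s hq
  exact ⟨C, fun u hu => ⟨(fourierTD u).comp G, hreg.reg.convergesInSPrime D u G hG,
    hC G hG u hu⟩⟩

end
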